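/- Let t ≥ 1 be an integer and let m_n := (1/sc(n)) Σ_{λ ∈ SC(n)} N_t(λ) denote the mean of N_t over the self-conjugate partitions of n. Then the variance satisfies lim_{n→∞} ( (1/sc(n)) Σ_{λ ∈ SC(n)} (N_t(λ) − m_n)² − (π² − 6)√(6n)/π³ ) = 3(π² − 12)/π⁴ − δ_t/8. -/

import Mathlib

open scoped Real Classical
open Complex Filter Asymptotics

noncomputable section

/-- The conjugate part `λ'_k`: the number of parts of `P` that are at least `k`. -/
def colLen {n : ℕ} (P : n.Partition) (k : ℕ) : ℕ :=
  Multiset.card (P.parts.filter (fun p => k ≤ p))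

/-- The part `λ_j` (the `j`-th largest part, 1-indexed), recovered by conjugating twice. -/
def rowLen {n : ℕ} (P : n.Partition) (j : ℕ) : ℕ :=
  ((Finset.Icc 1 n).filter (fun k => j ≤ colLen P k)).card

/-- The hook number `h(j,k) = (λ_j - j) + (λ'_k - k) + 1` of the cell `(j,k)` (1-indexed). -/
def hookNum {n : ℕ} (P : n.Partition) (j k : ℕ) : ℤ :=
  ((rowLen P j : ℤ) - j) + ((colLen P k : ℤ) - k) + 1

/-- `N_t(λ)`: the number of cells of the Young diagram of `λ` with hook number `t`. -/
def Nhook {n : ℕ} (t : ℕ) (P : n.Partition) : ℕ :=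
  (((Finset.Icc 1 n) ×ˢ (Finset.Icc 1 n)).filter
    (fun c => c.2 ≤ rowLen P c.1 ∧ hookNum P c.1 c.2 = (t : ℤ))).card

/-- A partition is self-conjugate if `λ_k = λ'_k` for all `k ≥ 1`. -/
def IsSelfConjugate {n : ℕ} (P : n.Partition) : Prop :=
  ∀ k, 1 ≤ k → rowLen P k = colLen P k

/-- `SC(n)`, the set of self-conjugate partitions of `n`. -/
def SC (n : ℕ) : Finset (Nat.Partition n) :=
  Finset.univ.filter (fun P => IsSelfConjugate P)

/-- `δ_t = 1` if `t` is odd, else `0`. -/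
def delta (t : ℕ) : ℝ := if Odd t then 1 else 0

/-- The region `D_θ = { r e^{iα} : r ≥ 0, |α| ≤ θ }`. -/
def Dset (θ : ℝ) : Set ℂ := {z | z = 0 ∨ |z.arg| ≤ θ}

/-- The filter of punctured neighborhoods of `0` intersected with `D_θ`. -/
def near0 (θ : ℝ) : Filter ℂ := nhdsWithin 0 (Dset θ \ {0})

/-- The dilogarithm `Li₂(X) = -∫₀¹ log(1 - Xu)/u du` (principal logarithm). -/
def Li2 (X : ℂ) : ℂ := -∫ u in (0:ℝ)..1, Complex.log (1 - X * u) / (u : ℂ)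

/-- The real dilogarithm, for real arguments `x < 1`. -/
def Li2R (x : ℝ) : ℝ := -∫ u in (0:ℝ)..1, Real.log (1 - x * u) / u

/-- The principal complex square root. -/
def csqrt (z : ℂ) : ℂ := z ^ ((1:ℂ)/2)

/-- The infinite Pochhammer symbol `(a;q)_∞ = ∏_{j ≥ 0} (1 - a q^j)`. -/
def pochInf (a q : ℂ) : ℂ := ∏' j : ℕ, (1 - a * q ^ j)

/-- The finite Pochhammer symbol `(a;q)_n = ∏_{j=0}^{n-1} (1 - a q^j)`. -/
def pochN (a q : ℂ) (n : ℕ) : ℂ := ∏ j ∈ Finset.range n, (1 - a * q ^ j)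

/-- `C_T^+ = 1 + √((1-T)/(1+T))`. -/
def Cp (T : ℝ) : ℂ := 1 + csqrt ((1 - (T:ℂ)) / (1 + (T:ℂ)))

/-- `C_T^- = 1 - √((1-T)/(1+T))`. -/
def Cm (T : ℝ) : ℂ := 1 - csqrt ((1 - (T:ℂ)) / (1 + (T:ℂ)))

/-- `H*(T;q) = (1/(2T)) [ C_T^+ (√(1-T²);-q)_∞ + C_T^- (-√(1-T²);-q)_∞ ]`. -/
def Hstar (T : ℝ) (q : ℂ) : ℂ :=
  1 / (2 * (T:ℂ)) * (Cp T * pochInf (csqrt (1 - (T:ℂ)^2)) (-q)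
    + Cm T * pochInf (-csqrt (1 - (T:ℂ)^2)) (-q))

/-- `α_T^+ = (1/(2T)) ( C_T^+ + C_T^- √((1+√(1-T²))/(1-√(1-T²))) )`. -/
def alphaP (T : ℝ) : ℂ :=
  1 / (2 * (T:ℂ)) *
    (Cp T + Cm T * csqrt ((1 + csqrt (1 - (T:ℂ)^2)) / (1 - csqrt (1 - (T:ℂ)^2))))

/-- `α_T^- = (1/(2T)) ( C_T^+ - C_T^- √((1+√(1-T²))/(1-√(1-T²))) )`. -/
def alphaM (T : ℝ) : ℂ :=
  1 / (2 * (T:ℂ)) *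
    (Cp T - Cm T * csqrt ((1 + csqrt (1 - (T:ℂ)^2)) / (1 - csqrt (1 - (T:ℂ)^2))))

/-- `b_t(T)` from Proposition: saddle-point constant. -/
def bt (t : ℕ) (T : ℝ) : ℝ :=
  if Even t then (1/2) * Real.sqrt (π^2/6 - Li2R (1 - T^2))
  else (1/2) * Real.sqrt (π^2/6 - ((t-1 : ℝ)/t) * Li2R (1 - T^2))

end

theorem lt_card_filter_range_iff {p : ℕ → Prop} [DecidablePred p] {M : ℕ}
    (hp : ∀ i j, i ≤ j → p j → p i)
    (hM : ∀ i, p i → i < M) (j : ℕ) : j < ((Finset.range M).filter p).card ↔ p j := by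
  constructor
  · intro h
    by_contra hj
    have hsub : (Finset.range M).filter p ⊆ Finset.range j := by
      intro i hi
      simp only [Finset.mem_filter, Finset.mem_range] at hi ⊢
      by_contra hij
      exact hj (hp j i (by omega) hi.2)
    have := Finset.card_le_card hsub
    simp at this
    omega
  · intro h
    have hsub : Finset.range (j + 1) ⊆ (Finset.range M).filter p := by
      intro i hi
      simp only [Finset.mem_filter, Finset.mem_range] at hi ⊢
      have hpi := hp i j (by omega) h
      exact ⟨hM i hpi, hpi⟩
    have := Finset.card_le_card hsub
    simp at this
    omega

section PartitionShape

variable {n : ℕ} (P : n.Partition)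

theorem colLen_anti {k l : ℕ} (h : k ≤ l) : colLen P l ≤ colLen P k := by
  unfold colLen
  exact Multiset.card_le_card (Multiset.monotone_filter_right _ (fun b hb => h.trans hb))

theorem sum_colLen : ∑ k ∈ Finset.range n, colLen P (k + 1) = n := by
  have key : ∀ s : Multiset ℕ, (∀ p ∈ s, p ≤ n) →
      ∑ k ∈ Finset.range n, Multiset.card (s.filter (fun p => k + 1 ≤ p)) = s.sum := by
    intro s
    induction s using Multiset.induction_on with
    | empty => simp
    | cons a s ih =>
      intro hs
      have ha : a ≤ n := hs a (Multiset.mem_cons_self a s)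
      have ih' := ih (fun p hp => hs p (Multiset.mem_cons_of_mem hp))
      simp only [Multiset.filter_cons, Multiset.card_add, Finset.sum_add_distrib, ih',
        Multiset.sum_cons]
      congr 1
      have : ∀ k, Multiset.card (if k + 1 ≤ a then ({a} : Multiset ℕ) else 0)
          = if k < a then 1 else 0 := by
        intro k
        by_cases h : k < a
        · rw [if_pos h, if_pos (by omega)]; simp
        · rw [if_neg h, if_neg (by omega)]; simp
      simp only [this, Finset.sum_ite, Finset.sum_const_zero, add_zero, Finset.sum_const,
        smul_eq_mul, mul_one]
      have : (Finset.range n).filter (fun x => x < a) = Finset.range a := by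
        ext x; simp; omega
      rw [this, Finset.card_range]
  have h := key P.parts (fun p hp => by
    have := Multiset.le_sum_of_mem hp
    rwa [P.parts_sum] at this)
  rw [P.parts_sum] at h
  exact h

theorem colLen_eq_zero {k : ℕ} (h : n < k) : colLen P k = 0 := by
  unfold colLen
  rw [Multiset.card_eq_zero, Multiset.filter_eq_nil]
  intro p hp
  have := Multiset.le_sum_of_mem hp
  rw [P.parts_sum] at this
  omega

theorem le_rowLen_iff {j k : ℕ} (hj : 1 ≤ j) : k + 1 ≤ rowLen P j ↔ j ≤ colLen P (k + 1) := by
  have h : rowLen P j = ((Finset.range n).filter (fun k => j ≤ colLen P (k + 1))).card := by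
    unfold rowLen
    symm
    apply Finset.card_bij (fun a _ => a + 1)
    · intro a ha
      simp only [Finset.mem_filter, Finset.mem_range, Finset.mem_Icc] at ha ⊢
      exact ⟨by omega, ha.2⟩
    · intro a _ b _ hab
      omega
    · intro b hb
      simp only [Finset.mem_filter, Finset.mem_range, Finset.mem_Icc] at hb ⊢
      exact ⟨b - 1, ⟨by omega, by rw [Nat.sub_add_cancel hb.1.1]; exact hb.2⟩, by omega⟩
  rw [h, Nat.succ_le_iff]
  apply lt_card_filter_range_iff
  · intro a b hab hb
    exact hb.trans (colLen_anti P (by omega))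
  · intro a ha
    by_contra hna
    rw [colLen_eq_zero P (by omega)] at ha
    omega

theorem mem_SC {P : n.Partition} : P ∈ SC n ↔ IsSelfConjugate P := by
  simp [SC]

end PartitionShape

/-- Symmetric shapes: `L` lists the row lengths (indexed from `0`) of a self-conjugate diagram. -/
def IsSymShape (L : ℕ → ℕ) : Prop := ∀ j k, j < L k ↔ k < L j

theorem isSelfConjugate_iff {n : ℕ} (P : n.Partition) :
    IsSelfConjugate P ↔ IsSymShape (fun k => colLen P (k + 1)) := by
  constructor
  · intro h j k
    have h1 := le_rowLen_iff P (j := j + 1) (k := k) (by omega)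
    rw [h (j + 1) (by omega)] at h1
    simp only
    omega
  · intro h k hk
    obtain ⟨k, rfl⟩ : ∃ m, k = m + 1 := ⟨k - 1, by omega⟩
    apply le_antisymm
    · by_contra hlt
      have h1 := (le_rowLen_iff P (j := k + 1) (k := colLen P (k + 1)) (by omega)).1 (by omega)
      have h2 := (h k (colLen P (k + 1))).1 (by simp only; omega)
      simp at h2
    · rcases Nat.eq_zero_or_pos (colLen P (k + 1)) with h0 | h0
      · omega
      · obtain ⟨m, hm⟩ : ∃ m, colLen P (k + 1) = m + 1 := ⟨colLen P (k + 1) - 1, by omega⟩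
        rw [hm, le_rowLen_iff P (by omega)]
        have := (h m k).1 (by simp only; omega)
        simp only at this
        omega

namespace IsSymShape

variable {L : ℕ → ℕ} (hL : IsSymShape L)
include hL

theorem anti {k l : ℕ} (h : k ≤ l) : L l ≤ L k := by
  by_contra hlt
  have h1 := (hL (L k) l).1 (by omega)
  have h2 := (hL (L k) k).2 (by omega)
  omega

theorem inj {j k d : ℕ} (hj : L j = j + 1 + d) (hk : L k = k + 1 + d) : j = k := by
  rcases lt_trichotomy j k with h | h | h
  · have := hL.anti h.le; omega
  · exact h
  · have := hL.anti h.le; omega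

end IsSymShape

/-- `D` is the set of `d` such that `2 d + 1` is a diagonal hook length of the shape `L`. -/
def IsDiag (D : Finset ℕ) (L : ℕ → ℕ) : Prop := ∀ d, d ∈ D ↔ ∃ j, L j = j + 1 + d

namespace IsSymShape

variable {L : ℕ → ℕ} {D : Finset ℕ}

theorem lt_iff_of_le (hL : IsSymShape L) (hD : IsDiag D L) {j k : ℕ} (h : k ≤ j) :
    j < L k ↔ k < (D.filter (fun d => j - k ≤ d)).card := by
  constructor
  · intro hj
    have : (Finset.range (k + 1)).card ≤ (D.filter (fun d => j - k ≤ d)).card := by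
      apply Finset.card_le_card_of_injOn (fun i => L i - (i + 1))
      · intro i hi
        simp only [Finset.coe_range, Set.mem_Iio] at hi
        have := hL.anti (show i ≤ k by omega)
        simp only [Finset.coe_filter, Set.mem_ofPred_eq]
        exact ⟨(hD _).2 ⟨i, by omega⟩, by omega⟩
      · intro a ha b hb hab
        simp only [Finset.coe_range, Set.mem_Iio] at ha hb
        have h1 := hL.anti (show a ≤ k by omega)
        have h2 := hL.anti (show b ≤ k by omega)
        simp only at hab
        exact hL.inj (d := L a - (a + 1)) (by omega) (by omega)
    simpa using this
  · intro hk
    by_contra hj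
    have : (D.filter (fun d => j - k ≤ d)).card ≤ (Finset.range k).card := by
      apply Finset.card_le_card_of_surjOn (fun i => L i - (i + 1))
      intro d hd
      simp only [Finset.coe_filter, Set.mem_ofPred_eq] at hd
      obtain ⟨i, hi⟩ := (hD d).1 hd.1
      refine ⟨i, ?_, by simp only; omega⟩
      simp only [Finset.coe_range, Set.mem_Iio]
      by_contra hik
      have := hL.anti (show k ≤ i by omega)
      omega
    rw [Finset.card_range] at this
    omega

theorem lt_iff (hL : IsSymShape L) (hD : IsDiag D L) (j k : ℕ) :
    j < L k ↔ min j k < (D.filter (fun d => max j k - min j k ≤ d)).card := by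
  rcases le_total k j with h | h
  · rw [min_eq_right h, max_eq_left h, hL.lt_iff_of_le hD h]
  · rw [min_eq_left h, max_eq_right h, hL, hL.lt_iff_of_le hD h]

theorem sum_eq (hL : IsSymShape L) (hD : IsDiag D L) {n : ℕ} (hn : ∀ k, n ≤ k → L k = 0) :
    ∑ k ∈ Finset.range n, L k = ∑ d ∈ D, (2 * d + 1) := by
  have hLn : ∀ k, L k ≤ n := by
    intro k
    by_contra hlt
    have := (hL n k).1 (by omega)
    rw [hn n le_rfl] at this
    omega
  set C := ((Finset.range n) ×ˢ (Finset.range n)).filter (fun c => c.2 < L c.1) with hC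
  have h1 : C.card = ∑ k ∈ Finset.range n, L k := by
    rw [Finset.card_eq_sum_card_fiberwise (f := Prod.fst) (t := Finset.range n)]
    · apply Finset.sum_congr rfl
      intro k hk
      rw [← Finset.card_range (L k)]
      apply Finset.card_bij (fun c _ => c.2)
      · intro c hc
        simp only [hC, Finset.mem_filter, Finset.mem_product, Finset.mem_range] at hc ⊢
        rw [← hc.2]; exact hc.1.2
      · rintro ⟨a, b⟩ ha ⟨c, d⟩ hc h
        simp only [Finset.mem_filter] at ha hc h ⊢
        rw [Prod.mk.injEq]
        exact ⟨ha.2.trans hc.2.symm, h⟩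
      · intro b hb
        simp only [Finset.mem_range] at hb hk
        refine ⟨(k, b), ?_, rfl⟩
        simp only [hC, Finset.mem_filter, Finset.mem_product, Finset.mem_range]
        have := hLn k
        exact ⟨⟨⟨hk, by omega⟩, hb⟩, trivial⟩
    · intro c hc
      simp only [hC, Finset.coe_filter, Finset.mem_product, Finset.mem_range,
        Set.mem_ofPred_eq] at hc
      simpa using hc.1.1
  have h2 : C.card = ∑ m ∈ Finset.range n, ((L m - m) + (L m - m - 1)) := by
    rw [Finset.card_eq_sum_card_fiberwise (f := fun c => min c.1 c.2) (t := Finset.range n)]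
    · apply Finset.sum_congr rfl
      intro m hm
      simp only [Finset.mem_range] at hm
      have hLm := hLn m
      have : C.filter (fun c => min c.1 c.2 = m)
          = (Finset.Ico m (L m)).image (fun k => (m, k)) ∪
            (Finset.Ico (m + 1) (L m)).image (fun k => (k, m)) := by
        ext ⟨a, b⟩
        simp only [hC, Finset.mem_filter, Finset.mem_product, Finset.mem_range, Finset.mem_union,
          Finset.mem_image, Finset.mem_Ico, Prod.mk.injEq]
        constructor
        · rintro ⟨⟨⟨ha, hb⟩, hab⟩, hmin⟩
          rcases le_or_gt a b with h | h
          · rw [min_eq_left h] at hmin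
            subst hmin
            exact Or.inl ⟨b, ⟨h, hab⟩, rfl, rfl⟩
          · rw [min_eq_right h.le] at hmin
            subst hmin
            exact Or.inr ⟨a, ⟨h, (hL a b).2 hab⟩, rfl, rfl⟩
        · rintro (⟨k, hk, rfl, rfl⟩ | ⟨k, hk, rfl, rfl⟩)
          · exact ⟨⟨⟨hm, by omega⟩, hk.2⟩, by omega⟩
          · exact ⟨⟨⟨by omega, hm⟩, (hL _ _).1 hk.2⟩, by omega⟩
      rw [this, Finset.card_union_of_disjoint, Finset.card_image_of_injective,
        Finset.card_image_of_injective]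
      · simp; omega
      · intro a b h; simpa using h
      · intro a b h; simpa using h
      · rw [Finset.disjoint_left]
        intro c h1 h2
        simp only [Finset.mem_image, Finset.mem_Ico] at h1 h2
        obtain ⟨a, ha, rfl⟩ := h1
        obtain ⟨b, hb, hab⟩ := h2
        simp only [Prod.mk.injEq] at hab
        omega
    · intro c hc
      simp only [hC, Finset.coe_filter, Finset.mem_product, Finset.mem_range,
        Set.mem_ofPred_eq] at hc
      simp
      omega
  rw [← h1, h2, ← Finset.sum_filter_of_ne (p := fun m => m < L m)]
  · apply Finset.sum_bij (fun m _ => L m - (m + 1))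
    · intro m hm
      simp only [Finset.mem_filter] at hm
      exact (hD _).2 ⟨m, by omega⟩
    · intro a ha b hb hab
      simp only [Finset.mem_filter] at ha hb
      exact hL.inj (d := L a - (a + 1)) (by omega) (by omega)
    · intro d hd
      obtain ⟨j, hj⟩ := (hD d).1 hd
      refine ⟨j, ?_, by omega⟩
      simp only [Finset.mem_filter, Finset.mem_range]
      refine ⟨?_, by omega⟩
      have := hLn j
      omega
    · intro m hm
      simp only [Finset.mem_filter] at hm
      omega
  · intro m _ h
    omega

/-- The two halves of the bead sequence of a symmetric shape are complementary. -/
theorem exists_sub_iff (hL : IsSymShape L) (hD : IsDiag D L) {n : ℕ}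
    (hn : ∀ k, n ≤ k → L k = 0) (i : ℕ) :
    i ∉ D ↔ ∃ k, k = L k + i := by
  rw [hD]
  constructor
  · intro hno
    have hex : ∃ k, L k + i ≤ k := ⟨max n i, by rw [hn _ (le_max_left _ _)]; simp⟩
    have hmin := fun m => Nat.find_min (m := m) hex
    have hspec := Nat.find_spec hex
    set k := Nat.find hex
    by_contra hne
    push Not at hne
    have hlt : L k + i < k := lt_of_le_of_ne hspec (fun h => hne k h.symm)
    have h1 := hmin (k - 1) (by omega)
    have h2 := (hL (k - i - 1) (k - 1)).1 (by omega)
    have h3 : ¬ (k < L (k - i - 1)) := fun h => by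
      have := (hL k (k - i - 1)).1 h
      omega
    exact hno ⟨k - i - 1, by omega⟩
  · rintro ⟨k, hk⟩ ⟨j, hj⟩
    have h1 := hL j k
    omega

end IsSymShape

/-- Number of elements of `D` that are at least `v`. -/
def cntGe (D : Finset ℕ) (v : ℕ) : ℕ := (D.filter (fun d => v ≤ d)).card

theorem cntGe_anti (D : Finset ℕ) {v w : ℕ} (h : v ≤ w) : cntGe D w ≤ cntGe D v :=
  Finset.card_le_card (Finset.monotone_filter_right _ (fun _ _ hb => h.trans hb))

theorem cntGe_le_add (D : Finset ℕ) (v s : ℕ) : cntGe D v ≤ cntGe D (v + s) + s := by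
  have hsub : D.filter (fun d => v ≤ d)
      ⊆ D.filter (fun d => v + s ≤ d) ∪ Finset.Ico v (v + s) := by
    intro d hd
    simp only [Finset.mem_filter, Finset.mem_union, Finset.mem_Ico] at hd ⊢
    rcases le_or_gt (v + s) d with h | h
    · exact Or.inl ⟨hd.1, h⟩
    · exact Or.inr ⟨hd.2, h⟩
  have := (Finset.card_le_card hsub).trans (Finset.card_union_le _ _)
  simpa [cntGe] using this

theorem lt_of_cntGe_pos {D : Finset ℕ} {M v : ℕ} (hM : D ⊆ Finset.range M) (h : 0 < cntGe D v) :
    v < M := by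
  obtain ⟨d, hd⟩ := Finset.card_pos.1 h
  simp only [Finset.mem_filter] at hd
  have := Finset.mem_range.1 (hM hd.1)
  omega

/-- The symmetric shape with diagonal hook lengths `2 d + 1`, `d ∈ D`. -/
def shapeOf (D : Finset ℕ) (k : ℕ) : ℕ :=
  ((Finset.range (2 * (D.sup id + 1) + k)).filter
    (fun j => min j k < cntGe D (max j k - min j k))).card

theorem lt_shapeOf_iff (D : Finset ℕ) (j k : ℕ) :
    j < shapeOf D k ↔ min j k < cntGe D (max j k - min j k) := by
  unfold shapeOf
  apply lt_card_filter_range_iff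
  · intro i j hij h
    rcases le_or_gt k i with hk | hk
    · rw [min_eq_right (by omega), max_eq_left (by omega)] at h ⊢
      exact h.trans_le (cntGe_anti D (by omega))
    · rw [min_eq_left hk.le, max_eq_right hk.le]
      rcases le_or_gt k j with hj | hj
      · rw [min_eq_right (by omega), max_eq_left (by omega)] at h
        have h1 := h.trans_le (cntGe_anti D (Nat.zero_le _))
        have h2 := cntGe_le_add D 0 (k - i)
        rw [zero_add] at h2
        omega
      · rw [min_eq_left (by omega), max_eq_right (by omega)] at h
        have h2 := cntGe_le_add D (k - j) (j - i)
        rw [show k - j + (j - i) = k - i by omega] at h2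
        omega
  · intro j h
    have hM : D ⊆ Finset.range (D.sup id + 1) := fun d hd => by
      exact Finset.mem_range.2 (Nat.lt_succ_of_le (Finset.le_sup (f := id) hd))
    have := lt_of_cntGe_pos hM (lt_of_le_of_lt (Nat.zero_le _) h)
    omega

theorem isSymShape_shapeOf (D : Finset ℕ) : IsSymShape (shapeOf D) := by
  intro j k
  rw [lt_shapeOf_iff, lt_shapeOf_iff, min_comm, max_comm]

theorem isDiag_shapeOf (D : Finset ℕ) : IsDiag D (shapeOf D) := by
  have hcnt : ∀ d, cntGe D d = cntGe D (d + 1) + if d ∈ D then 1 else 0 := by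
    intro d
    have : D.filter (fun e => d ≤ e) = D.filter (fun e => d + 1 ≤ e) ∪ D.filter (fun e => e = d) := by
      rw [← Finset.filter_or]
      exact Finset.filter_congr (fun e _ => by omega)
    unfold cntGe
    rw [this, Finset.card_union_of_disjoint]
    · rw [Finset.filter_eq']
      split_ifs <;> simp
    · rw [Finset.disjoint_filter]
      intro e _ h; omega
  have key : ∀ d j, shapeOf D j = j + 1 + d ↔ j < cntGe D d ∧ cntGe D (d + 1) ≤ j := by
    intro d j
    have h1 := lt_shapeOf_iff D (j + d) j
    have h2 := lt_shapeOf_iff D (j + d + 1) j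
    rw [min_eq_right (by omega), max_eq_left (by omega)] at h1 h2
    rw [show j + d - j = d by omega] at h1
    rw [show j + d + 1 - j = d + 1 by omega] at h2
    omega
  intro d
  simp only [key]
  have := hcnt d
  constructor
  · intro hd
    rw [if_pos hd] at this
    exact ⟨cntGe D (d + 1), by omega, le_rfl⟩
  · rintro ⟨j, h1, h2⟩
    by_contra hd
    rw [if_neg hd] at this
    omega

theorem exists_partition_of_shape {L : ℕ → ℕ} (hL : IsSymShape L) {n : ℕ}
    (hn : ∀ k, n ≤ k → L k = 0) (hsum : ∑ k ∈ Finset.range n, L k = n) :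
    ∃ P : n.Partition, ∀ k, colLen P (k + 1) = L k := by
  refine ⟨Nat.Partition.ofSums n ((Multiset.range n).map L)
    (show ((Multiset.range n).map L).sum = n from hsum), fun k => ?_⟩
  change Multiset.card (Multiset.filter (fun p => k + 1 ≤ p)
    (Multiset.filter (fun p => p ≠ 0) ((Multiset.range n).map L))) = L k
  rw [Multiset.filter_filter, Multiset.filter_map, Multiset.card_map]
  have : Multiset.card (Multiset.filter ((fun a => k + 1 ≤ a ∧ a ≠ 0) ∘ L) (Multiset.range n))
      = ((Finset.range n).filter (fun j => j < L k)).card := by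
    rw [Finset.card_def, Finset.filter_val, Finset.range_val]
    congr 1
    apply Multiset.filter_congr
    intro j _
    have := hL j k
    simp only [Function.comp]
    omega
  rw [this]
  have hk : L k ≤ n := by
    by_contra hlt
    have := (hL n k).1 (by omega)
    rw [hn n le_rfl] at this
    omega
  rw [← Finset.card_range (L k)]
  congr 1
  ext j
  simp
  omega

theorem colLen_injective {n : ℕ} {P Q : n.Partition} (h : ∀ k, colLen P (k + 1) = colLen Q (k + 1)) :
    P = Q := by
  have hcount : ∀ (R : n.Partition) p, colLen R p = colLen R (p + 1) + R.parts.count p := by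
    intro R p
    unfold colLen
    induction R.parts using Multiset.induction_on with
    | empty => simp
    | cons a s ih =>
      simp only [Multiset.filter_cons, Multiset.count_cons, Multiset.card_add, ih]
      split_ifs <;> first | omega | (simp only [Multiset.card_singleton, Multiset.card_zero]; omega)
  ext p
  rcases Nat.eq_zero_or_pos p with rfl | hp
  · rw [Multiset.count_eq_zero_of_notMem (fun h0 => lt_irrefl _ (P.parts_pos h0)),
      Multiset.count_eq_zero_of_notMem (fun h0 => lt_irrefl _ (Q.parts_pos h0))]
  · obtain ⟨k, rfl⟩ : ∃ k, p = k + 1 := ⟨p - 1, by omega⟩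
    have h1 := hcount P (k + 1)
    have h2 := hcount Q (k + 1)
    rw [h k, h (k + 1)] at h1
    omega

/-- The number of cells with hook number `t`, in terms of the diagonal hooks. -/
def hookStat (t : ℕ) (D : Finset ℕ) : ℕ :=
  2 * (D.filter (fun d => t ≤ d ∧ d - t ∉ D)).card
    + (D.filter (fun a => a < t ∧ t - 1 - a ∈ D)).card

theorem card_hooks_eq {L : ℕ → ℕ} (hL : IsSymShape L) {D : Finset ℕ} (hD : IsDiag D L) {n t : ℕ}
    (hn : ∀ k, n ≤ k → L k = 0) :
    (((Finset.range n) ×ˢ (Finset.range n)).filter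
      (fun c => L c.1 + L c.2 = c.1 + c.2 + 1 + t)).card = hookStat t D := by
  have hLn : ∀ k, L k ≤ n := by
    intro k
    by_contra hlt
    have := (hL n k).1 (by omega)
    rw [hn n le_rfl] at this
    omega
  set T := ((Finset.range n) ×ˢ (Finset.range n)).filter
      (fun c => L c.1 + L c.2 = c.1 + c.2 + 1 + t) with hT
  have memT : ∀ j k, (j, k) ∈ T ↔ (j < n ∧ k < n) ∧ L j + L k = j + k + 1 + t := by
    intro j k; simp [hT]
  clear_value T
  have h1 : (T.filter (fun c => c.1 < L c.1 ∧ c.2 < L c.2)).card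
      = (D.filter (fun a => a < t ∧ t - 1 - a ∈ D)).card := by
    apply Finset.card_bij (fun c _ => L c.1 - (c.1 + 1))
    · rintro ⟨j, k⟩ hc
      simp only [Finset.mem_filter, memT] at hc ⊢
      exact ⟨(hD _).2 ⟨j, by omega⟩, by omega, (hD _).2 ⟨k, by omega⟩⟩
    · rintro ⟨j, k⟩ hc ⟨j', k'⟩ hc' h
      simp only [Finset.mem_filter, memT] at hc hc' h
      have e1 := hL.inj (j := j) (k := j') (d := L j - (j + 1)) (by omega) (by omega)
      subst e1
      have e2 := hL.inj (j := k) (k := k') (d := L k - (k + 1)) (by omega) (by omega)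
      rw [e2]
    · intro a ha
      simp only [Finset.mem_filter] at ha
      obtain ⟨j, hj⟩ := (hD _).1 ha.1
      obtain ⟨k, hk⟩ := (hD _).1 ha.2.2
      refine ⟨(j, k), ?_, by simp only; omega⟩
      have := hLn j
      have := hLn k
      simp only [Finset.mem_filter, memT]
      omega
  have h2 : (T.filter (fun c => c.1 < L c.1 ∧ ¬ c.2 < L c.2)).card
      = (D.filter (fun d => t ≤ d ∧ d - t ∉ D)).card := by
    apply Finset.card_bij (fun c _ => L c.1 - (c.1 + 1))
    · rintro ⟨j, k⟩ hc
      simp only [Finset.mem_filter, memT] at hc ⊢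
      exact ⟨(hD _).2 ⟨j, by omega⟩, by omega, (hL.exists_sub_iff hD hn _).2 ⟨k, by omega⟩⟩
    · rintro ⟨j, k⟩ hc ⟨j', k'⟩ hc' h
      simp only [Finset.mem_filter, memT] at hc hc' h
      have e1 := hL.inj (j := j) (k := j') (d := L j - (j + 1)) (by omega) (by omega)
      subst e1
      have e2 : k = k' := by
        rcases lt_trichotomy k k' with h' | h' | h'
        · have := hL.anti h'.le; omega
        · exact h'
        · have := hL.anti h'.le; omega
      rw [e2]
    · intro a ha
      simp only [Finset.mem_filter] at ha
      obtain ⟨j, hj⟩ := (hD _).1 ha.1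
      obtain ⟨k, hk⟩ := (hL.exists_sub_iff hD hn _).1 ha.2.2
      have hkn : k < n := by
        by_contra h
        have := hn k (by omega)
        have := hLn j
        omega
      refine ⟨(j, k), ?_, by simp only; omega⟩
      have := hLn j
      have := hLn k
      simp only [Finset.mem_filter, memT]
      omega
  have h3 : (T.filter (fun c => ¬ c.1 < L c.1)).card
      = (T.filter (fun c => c.1 < L c.1 ∧ ¬ c.2 < L c.2)).card := by
    apply Finset.card_bij (fun c _ => c.swap)
    · rintro ⟨j, k⟩ hc
      simp only [Finset.mem_filter, memT, Prod.swap_prod_mk] at hc ⊢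
      omega
    · intro a _ b _ h
      exact Prod.swap_injective h
    · rintro ⟨j, k⟩ hc
      refine ⟨(k, j), ?_, rfl⟩
      simp only [Finset.mem_filter, memT] at hc ⊢
      omega
  have h4 := Finset.card_filter_add_card_filter_not (s := T) (fun c => c.1 < L c.1)
  have h5 := Finset.card_filter_add_card_filter_not (s := T.filter (fun c => c.1 < L c.1))
    (fun c => c.2 < L c.2)
  rw [Finset.filter_filter, Finset.filter_filter] at h5
  unfold hookStat
  omega

theorem Nhook_eq_hookStat {n t : ℕ} {P : n.Partition} (hP : IsSelfConjugate P)
    {D : Finset ℕ} (hD : IsDiag D (fun k => colLen P (k + 1))) :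
    Nhook t P = hookStat t D := by
  have hL := (isSelfConjugate_iff P).1 hP
  rw [← card_hooks_eq (n := n) hL hD (fun k hk => colLen_eq_zero P (by omega))]
  unfold Nhook
  symm
  apply Finset.card_bij (fun c _ => (c.1 + 1, c.2 + 1))
  · rintro ⟨j, k⟩ hc
    simp only [Finset.mem_filter, Finset.mem_product, Finset.mem_range, Finset.mem_Icc] at hc ⊢
    refine ⟨by omega, ?_, ?_⟩
    · rw [hP _ (by omega)]
      have := hL j k
      simp only at this
      omega
    · unfold hookNum
      rw [hP _ (by omega)]
      push_cast
      omega
  · rintro ⟨j, k⟩ _ ⟨j', k'⟩ _ h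
    simpa using h
  · rintro ⟨j, k⟩ hc
    simp only [Finset.mem_filter, Finset.mem_product, Finset.mem_Icc] at hc
    obtain ⟨⟨⟨hj, hj'⟩, hk, hk'⟩, hcell, hhook⟩ := hc
    obtain ⟨j, rfl⟩ : ∃ m, j = m + 1 := ⟨j - 1, by omega⟩
    obtain ⟨k, rfl⟩ : ∃ m, k = m + 1 := ⟨k - 1, by omega⟩
    refine ⟨(j, k), ?_, rfl⟩
    unfold hookNum at hhook
    rw [hP _ (by omega)] at hhook
    simp only [Finset.mem_filter, Finset.mem_product, Finset.mem_range]
    push_cast at hhook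
    omega

theorem exists_isDiag {n : ℕ} (P : n.Partition) :
    ∃ D : Finset ℕ, IsDiag D (fun k => colLen P (k + 1)) := by
  have hle : ∀ k, colLen P (k + 1) ≤ n := fun k => by
    rcases lt_or_ge k n with h | h
    · calc colLen P (k + 1) ≤ ∑ k ∈ Finset.range n, colLen P (k + 1) :=
            Finset.single_le_sum (f := fun k => colLen P (k + 1)) (fun _ _ => Nat.zero_le _)
              (Finset.mem_range.2 h)
        _ = n := sum_colLen P
    · rw [colLen_eq_zero P (by omega)]; omega
  refine ⟨(Finset.range n).filter (fun d => ∃ j, colLen P (j + 1) = j + 1 + d), fun d => ?_⟩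
  simp only [Finset.mem_filter, Finset.mem_range, and_iff_right_iff_imp]
  rintro ⟨j, hj⟩
  have := hle j
  omega

theorem isDiag_unique {D E : Finset ℕ} {L : ℕ → ℕ} (hD : IsDiag D L) (hE : IsDiag E L) : D = E := by
  ext d
  rw [hD, hE]

/-- Sums over self-conjugate partitions as sums over sets of distinct odd diagonal hooks. -/
theorem sum_SC_eq {β : Type*} [AddCommMonoid β] (t n M : ℕ) (hM : n ≤ M) (φ : ℕ → β) :
    ∑ P ∈ SC n, φ (Nhook t P)
      = ∑ D ∈ (Finset.range M).powerset.filter (fun D => ∑ d ∈ D, (2 * d + 1) = n),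
          φ (hookStat t D) := by
  choose diag hdiag using fun P : n.Partition => exists_isDiag P
  apply Finset.sum_bij (fun P _ => diag P)
  · intro P hP
    have hL := (isSelfConjugate_iff P).1 (mem_SC.1 hP)
    have hs := hL.sum_eq (hdiag P) (n := n) (fun k hk => colLen_eq_zero P (by omega))
    rw [sum_colLen] at hs
    simp only [Finset.mem_filter, Finset.mem_powerset]
    refine ⟨fun d hd => Finset.mem_range.2 ?_, hs.symm⟩
    have := Finset.single_le_sum (f := fun d => 2 * d + 1) (fun _ _ => Nat.zero_le _) hd
    omega
  · intro P hP Q hQ h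
    have hLP := (isSelfConjugate_iff P).1 (mem_SC.1 hP)
    have hLQ := (isSelfConjugate_iff Q).1 (mem_SC.1 hQ)
    apply colLen_injective
    intro k
    have hQ' := hdiag Q
    rw [← h] at hQ'
    have key : ∀ j, j < colLen P (k + 1) ↔ j < colLen Q (k + 1) := fun j =>
      (hLP.lt_iff (hdiag P) j k).trans (hLQ.lt_iff hQ' j k).symm
    have k1 := key (colLen P (k + 1))
    have k2 := key (colLen Q (k + 1))
    omega
  · intro D hD
    simp only [Finset.mem_filter, Finset.mem_powerset] at hD
    have hDn : D ⊆ Finset.range n := fun d hd => by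
      have := Finset.single_le_sum (f := fun d => 2 * d + 1) (fun _ _ => Nat.zero_le _) hd
      exact Finset.mem_range.2 (by omega)
    have hL := isSymShape_shapeOf D
    have hz : ∀ k, n ≤ k → shapeOf D k = 0 := by
      intro k hk
      by_contra hne
      have h0 := (lt_shapeOf_iff D 0 k).1 (Nat.pos_of_ne_zero hne)
      simp only [Nat.zero_le, inf_of_le_left, sup_of_le_right, Nat.sub_zero] at h0
      have := lt_of_cntGe_pos hDn h0
      omega
    obtain ⟨P, hP⟩ := exists_partition_of_shape hL hz
      ((hL.sum_eq (isDiag_shapeOf D) hz).trans hD.2)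
    have hfun : (fun k => colLen P (k + 1)) = shapeOf D := funext hP
    refine ⟨P, mem_SC.2 ((isSelfConjugate_iff P).2 (by rw [hfun]; exact hL)), ?_⟩
    have := hdiag P
    rw [hfun] at this
    exact isDiag_unique this (isDiag_shapeOf D)
  · intro P hP
    rw [Nhook_eq_hookStat (mem_SC.1 hP) (hdiag P)]

/-- The sum of `f D * ∏ d ∈ D, x d` over all `D ⊆ {0, …, L - 1}`. -/
noncomputable def wsum (L : ℕ) (x : ℕ → ℂ) (f : Finset ℕ → ℂ) : ℂ :=
  ∑ D ∈ (Finset.range L).powerset, f D * ∏ d ∈ D, x d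

theorem wsum_add (L : ℕ) (x : ℕ → ℂ) (f g : Finset ℕ → ℂ) :
    wsum L x (fun D => f D + g D) = wsum L x f + wsum L x g := by
  simp only [wsum, add_mul, Finset.sum_add_distrib]

theorem wsum_const_mul (L : ℕ) (x : ℕ → ℂ) (c : ℂ) (f : Finset ℕ → ℂ) :
    wsum L x (fun D => c * f D) = c * wsum L x f := by
  simp only [wsum, Finset.mul_sum, mul_assoc]

theorem wsum_sum {ι : Type*} (L : ℕ) (x : ℕ → ℂ) (s : Finset ι) (f : ι → Finset ℕ → ℂ) :
    wsum L x (fun D => ∑ i ∈ s, f i D) = ∑ i ∈ s, wsum L x (f i) := by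
  simp only [wsum, Finset.sum_mul]
  rw [Finset.sum_comm]

theorem wsum_congr {L : ℕ} {x : ℕ → ℂ} {f g : Finset ℕ → ℂ}
    (h : ∀ D ⊆ Finset.range L, f D = g D) : wsum L x f = wsum L x g :=
  Finset.sum_congr rfl fun D hD => by rw [h D (Finset.mem_powerset.1 hD)]

theorem wsum_pattern {L : ℕ} {x : ℕ → ℂ} (hx : ∀ d, 1 + x d ≠ 0) {S R : Finset ℕ}
    (hS : S ⊆ Finset.range L) (hR : R ⊆ Finset.range L) (hSR : Disjoint S R) :
    wsum L x (fun D => if S ⊆ D ∧ Disjoint R D then 1 else 0)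
      = (∏ d ∈ Finset.range L, (1 + x d)) * (∏ d ∈ S, x d / (1 + x d))
        * ∏ d ∈ R, (1 - x d / (1 + x d)) := by
  have h1 : ∏ i ∈ Finset.range L, ((if i ∈ R then 0 else x i) + (if i ∈ S then 0 else (1 : ℂ)))
      = (∏ d ∈ Finset.range L, (1 + x d)) * (∏ d ∈ S, x d / (1 + x d))
        * ∏ d ∈ R, (1 - x d / (1 + x d)) := by
    have e1 : ∏ d ∈ S, x d / (1 + x d)
        = ∏ d ∈ Finset.range L, if d ∈ S then x d / (1 + x d) else 1 := by
      rw [Finset.prod_ite_mem, Finset.inter_eq_right.2 hS]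
    have e2 : ∏ d ∈ R, (1 - x d / (1 + x d))
        = ∏ d ∈ Finset.range L, if d ∈ R then 1 - x d / (1 + x d) else 1 := by
      rw [Finset.prod_ite_mem, Finset.inter_eq_right.2 hR]
    rw [e1, e2, ← Finset.prod_mul_distrib, ← Finset.prod_mul_distrib]
    refine Finset.prod_congr rfl fun i _ => ?_
    have := hx i
    by_cases h1 : i ∈ S <;> by_cases h2 : i ∈ R
    · exact absurd h2 (Finset.disjoint_left.1 hSR h1)
    all_goals simp only [h1, h2, if_true, if_false]; field_simp; try ring
  rw [← h1, Finset.prod_add, wsum]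
  refine Finset.sum_congr rfl fun D hD => ?_
  rw [Finset.mem_powerset] at hD
  by_cases hc : S ⊆ D ∧ Disjoint R D
  · rw [if_pos hc, one_mul]
    have e1 : ∏ i ∈ D, (if i ∈ R then 0 else x i) = ∏ i ∈ D, x i :=
      Finset.prod_congr rfl fun i hi => if_neg fun h => Finset.disjoint_left.1 hc.2 h hi
    rw [e1, Finset.prod_eq_one (s := Finset.range L \ D), mul_one]
    intro i hi
    exact if_neg fun h => (Finset.mem_sdiff.1 hi).2 (hc.1 h)
  · rw [if_neg hc, zero_mul]
    rw [not_and_or] at hc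
    rcases hc with hc | hc
    · obtain ⟨i, hi, hiD⟩ := Finset.not_subset.1 hc
      rw [Finset.prod_eq_zero (s := Finset.range L \ D) (i := i)
        (Finset.mem_sdiff.2 ⟨hS hi, hiD⟩) (by simp [hi]), mul_zero]
    · obtain ⟨i, hi, hiD⟩ := Finset.not_disjoint_iff.1 hc
      rw [Finset.prod_eq_zero (s := D) (i := i) hiD (by simp [hi]), zero_mul]

theorem wsum_indicator {L : ℕ} {x : ℕ → ℂ} (hx : ∀ d, 1 + x d ≠ 0) (S R : Finset ℕ)
    {f : Finset ℕ → ℂ} (hf : ∀ D, f D = if S ⊆ D ∧ Disjoint R D then 1 else 0)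
    (hS : S ⊆ Finset.range L) (hR : R ⊆ Finset.range L) (hSR : Disjoint S R) :
    wsum L x f
      = (∏ d ∈ Finset.range L, (1 + x d)) * (∏ d ∈ S, x d / (1 + x d))
        * ∏ d ∈ R, (1 - x d / (1 + x d)) := by
  rw [← wsum_pattern hx hS hR hSR]
  exact wsum_congr fun D _ => hf D

section

variable (t : ℕ) (x : ℕ → ℂ)

noncomputable def gapInd (D : Finset ℕ) (i : ℕ) : ℂ := if i ∉ D ∧ i + t ∈ D then 1 else 0

noncomputable def pairInd (D : Finset ℕ) (a : ℕ) : ℂ := if a ∈ D ∧ t - 1 - a ∈ D then 1 else 0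

/-- The probability that `d` is chosen when the odds are `x d`. -/
noncomputable def occ (d : ℕ) : ℂ := x d / (1 + x d)

noncomputable def gapProb (i : ℕ) : ℂ := (1 - occ x i) * occ x (i + t)

noncomputable def pairProb (a : ℕ) : ℂ :=
  if a = t - 1 - a then occ x a else occ x a * occ x (t - 1 - a)

end

theorem hookStat_eq_sum {t K : ℕ} {D : Finset ℕ} (hD : D ⊆ Finset.range (K + t)) :
    (hookStat t D : ℂ)
      = 2 * ∑ i ∈ Finset.range K, gapInd t D i + ∑ a ∈ Finset.range t, pairInd t D a := by
  have h1 : (D.filter (fun d => t ≤ d ∧ d - t ∉ D)).card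
      = ((Finset.range K).filter (fun i => i ∉ D ∧ i + t ∈ D)).card := by
    refine Finset.card_bij' (fun d _ => d - t) (fun i _ => i + t) ?_ ?_ ?_ ?_
    · intro d hd
      simp only [Finset.mem_filter, Finset.mem_range] at hd ⊢
      have := Finset.mem_range.1 (hD hd.1)
      refine ⟨by omega, hd.2.2, ?_⟩
      rw [Nat.sub_add_cancel hd.2.1]; exact hd.1
    · intro i hi
      simp only [Finset.mem_filter, Finset.mem_range] at hi ⊢
      refine ⟨hi.2.2, by omega, ?_⟩
      rw [Nat.add_sub_cancel]; exact hi.2.1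
    · intro d hd
      simp only [Finset.mem_filter] at hd
      omega
    · intro i hi
      omega
  have h2 : D.filter (fun a => a < t ∧ t - 1 - a ∈ D)
      = (Finset.range t).filter (fun a => a ∈ D ∧ t - 1 - a ∈ D) := by
    ext a
    simp only [Finset.mem_filter, Finset.mem_range]
    tauto
  rw [hookStat, h1, h2]
  simp only [gapInd, pairInd, Finset.sum_boole]
  push_cast
  rfl

section

variable {t L : ℕ} {x : ℕ → ℂ}

theorem wsum_one : wsum L x (fun _ => 1) = ∏ d ∈ Finset.range L, (1 + x d) := by
  simp only [wsum, one_mul]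
  rw [Finset.prod_one_add]

theorem wsum_gap (hx : ∀ d, 1 + x d ≠ 0) (ht : 1 ≤ t) {i : ℕ} (hi : i + t < L) :
    wsum L x (fun D => gapInd t D i) = (∏ d ∈ Finset.range L, (1 + x d)) * gapProb t x i := by
  rw [wsum_indicator hx {i + t} {i}]
  · simp only [Finset.prod_singleton, gapProb, occ]; ring
  · intro D
    simp [gapInd, and_comm]
  · simpa using hi
  · simp; omega
  · simp; omega

theorem wsum_pair (hx : ∀ d, 1 + x d ≠ 0) (htL : t ≤ L) {a : ℕ} (ha : a < t) :
    wsum L x (fun D => pairInd t D a) = (∏ d ∈ Finset.range L, (1 + x d)) * pairProb t x a := by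
  rw [wsum_indicator hx {a, t - 1 - a} ∅]
  · rw [pairProb]
    split_ifs with h
    · rw [← h]; simp [occ]
    · rw [Finset.prod_pair h]; simp [occ]
  · intro D
    simp [pairInd, Finset.insert_subset_iff]
  · intro d; simp; omega
  · simp
  · simp

theorem wsum_gap_gap (hx : ∀ d, 1 + x d ≠ 0) (ht : 1 ≤ t) {i j : ℕ} (hi : i + t < L)
    (hj : j + t < L) :
    wsum L x (fun D => gapInd t D i * gapInd t D j) = (∏ d ∈ Finset.range L, (1 + x d)) *
      (gapProb t x i * gapProb t x j
        + (if i = j then gapProb t x i - gapProb t x i ^ 2 else 0)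
        - (if j = i + t then gapProb t x i * gapProb t x (i + t) else 0)
        - (if i = j + t then gapProb t x j * gapProb t x (j + t) else 0)) := by
  by_cases h1 : i = j
  · subst h1
    have : wsum L x (fun D => gapInd t D i * gapInd t D i) = wsum L x (fun D => gapInd t D i) :=
      wsum_congr fun D _ => by simp [gapInd]
    rw [this, wsum_gap hx ht hi, if_pos rfl, if_neg (by omega)]
    ring
  rw [if_neg h1]
  by_cases h2 : j = i + t
  · have : wsum L x (fun D => gapInd t D i * gapInd t D j) = wsum L x (fun D => 0 * 1) :=
      wsum_congr fun D _ => by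
        simp only [gapInd, h2]
        split_ifs <;> simp_all
    rw [this, wsum_const_mul, if_pos h2, if_neg (by omega), h2]
    ring
  by_cases h3 : i = j + t
  · have : wsum L x (fun D => gapInd t D i * gapInd t D j) = wsum L x (fun D => 0 * 1) :=
      wsum_congr fun D _ => by
        simp only [gapInd, h3]
        split_ifs <;> simp_all
    rw [this, wsum_const_mul, if_neg (by omega), if_pos h3, h3]
    ring
  rw [if_neg h2, if_neg h3, wsum_indicator hx {i + t, j + t} {i, j}]
  · rw [Finset.prod_pair (by omega), Finset.prod_pair h1]
    simp only [gapProb, occ]; ring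
  · intro D
    simp only [gapInd, Finset.insert_subset_iff, Finset.singleton_subset_iff,
      Finset.disjoint_insert_left, Finset.disjoint_singleton_left]
    rw [ite_zero_mul_ite_zero, one_mul]
    congr 1
    apply propext; tauto
  · intro d; simp; omega
  · intro d; simp; omega
  · simp; omega

theorem wsum_gap_pair (hx : ∀ d, 1 + x d ≠ 0) (ht : 1 ≤ t) {i a : ℕ} (hi : i + t < L)
    (ha : a < t) :
    wsum L x (fun D => gapInd t D i * pairInd t D a) = (∏ d ∈ Finset.range L, (1 + x d)) *
      (gapProb t x i * pairProb t x a
        - (if i = a then gapProb t x a * pairProb t x a else 0)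
        - (if i = t - 1 - a then
            (if a = t - 1 - a then 0 else gapProb t x (t - 1 - a) * pairProb t x a) else 0)) := by
  by_cases h1 : i = a ∨ i = t - 1 - a
  · have : wsum L x (fun D => gapInd t D i * pairInd t D a) = wsum L x (fun D => 0 * 1) :=
      wsum_congr fun D _ => by
        simp only [gapInd, pairInd]
        rcases h1 with h1 | h1 <;> rw [h1] <;> split_ifs <;> simp_all
    rw [this, wsum_const_mul]
    by_cases h2 : i = a
    · subst h2
      rw [if_pos rfl]
      split_ifs <;> ring
    · have h3 : i = t - 1 - a := by tauto
      rw [if_neg h2, if_pos h3, if_neg (by omega), ← h3]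
      ring
  push Not at h1
  rw [if_neg h1.1, if_neg h1.2, wsum_indicator hx {i + t, a, t - 1 - a} {i}]
  · rw [Finset.prod_insert (by simp; omega), Finset.prod_singleton, pairProb]
    split_ifs with h
    · rw [← h]; simp [occ, gapProb]; ring
    · rw [Finset.prod_pair h]; simp [occ, gapProb]; ring
  · intro D
    simp only [gapInd, pairInd, Finset.insert_subset_iff, Finset.singleton_subset_iff,
      Finset.disjoint_singleton_left]
    rw [ite_zero_mul_ite_zero, one_mul]
    congr 1
    apply propext; tauto
  · intro d; simp; omega
  · intro d; simp; omega
  · simp; omega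

theorem wsum_pair_pair (hx : ∀ d, 1 + x d ≠ 0) (htL : t ≤ L) {a b : ℕ} (ha : a < t)
    (hb : b < t) :
    wsum L x (fun D => pairInd t D a * pairInd t D b) = (∏ d ∈ Finset.range L, (1 + x d)) *
      (pairProb t x a * pairProb t x b
        + (if b = a then pairProb t x a - pairProb t x a ^ 2 else 0)
        + (if b = t - 1 - a then
            (if a = t - 1 - a then 0 else pairProb t x a - pairProb t x a ^ 2) else 0)) := by
  have hsymm : pairProb t x (t - 1 - a) = pairProb t x a := by
    simp only [pairProb]
    rw [show t - 1 - (t - 1 - a) = a by omega]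
    by_cases h : a = t - 1 - a
    · rw [if_pos h, if_pos h.symm, ← h]
    · rw [if_neg h, if_neg (Ne.symm h), mul_comm]
  by_cases h1 : b = a ∨ b = t - 1 - a
  · have : wsum L x (fun D => pairInd t D a * pairInd t D b)
        = wsum L x (fun D => pairInd t D a) :=
      wsum_congr fun D _ => by
        simp only [pairInd]
        rcases h1 with h1 | h1 <;> rw [h1]
        · simp
        · rw [show t - 1 - (t - 1 - a) = a by omega]
          split_ifs <;> simp_all
    rw [this, wsum_pair hx htL ha]
    by_cases h2 : b = a
    · subst h2
      rw [if_pos rfl]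
      split_ifs <;> ring
    · have h3 : b = t - 1 - a := by tauto
      rw [if_neg h2, if_pos h3, if_neg (by omega), h3, hsymm]
      ring
  push Not at h1
  rw [if_neg h1.1, if_neg h1.2, wsum_indicator hx ({a, t - 1 - a} ∪ {b, t - 1 - b}) ∅]
  · rw [Finset.prod_union (by simp; omega)]
    simp only [pairProb]
    split_ifs with h h' h'
    · rw [← h, ← h']; simp [occ]; try ring
    · rw [← h, Finset.prod_pair h']; simp [occ]; try ring
    · rw [← h', Finset.prod_pair h]; simp [occ]; try ring
    · rw [Finset.prod_pair h, Finset.prod_pair h']; simp [occ]; try ring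
  · intro D
    simp only [pairInd, Finset.union_subset_iff, Finset.insert_subset_iff,
      Finset.singleton_subset_iff, Finset.disjoint_empty_left, and_true]
    rw [ite_zero_mul_ite_zero, one_mul]
  · intro d; simp; omega
  · simp
  · simp

end

section

variable {t K : ℕ} {x : ℕ → ℂ}

noncomputable def meanUpTo (t : ℕ) (x : ℕ → ℂ) (K : ℕ) : ℂ :=
  2 * ∑ i ∈ Finset.range K, gapProb t x i + ∑ a ∈ Finset.range t, pairProb t x a

noncomputable def varUpTo (t : ℕ) (x : ℕ → ℂ) (K : ℕ) : ℂ :=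
  4 * (∑ i ∈ Finset.range K, (gapProb t x i - gapProb t x i ^ 2)
    - 2 * ∑ i ∈ Finset.range (K - t), gapProb t x i * gapProb t x (i + t))
  - 4 * ∑ a ∈ Finset.range t, (gapProb t x a * pairProb t x a
      + if a = t - 1 - a then 0 else gapProb t x (t - 1 - a) * pairProb t x a)
  + ∑ a ∈ Finset.range t, (pairProb t x a - pairProb t x a ^ 2
      + if a = t - 1 - a then 0 else pairProb t x a - pairProb t x a ^ 2)

theorem wsum_hookStat (hx : ∀ d, 1 + x d ≠ 0) (ht : 1 ≤ t) :
    wsum (K + t) x (fun D => (hookStat t D : ℂ))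
      = (∏ d ∈ Finset.range (K + t), (1 + x d)) * meanUpTo t x K := by
  rw [wsum_congr fun D hD => hookStat_eq_sum hD, wsum_add, wsum_const_mul, wsum_sum, wsum_sum,
    Finset.sum_congr rfl fun i hi => wsum_gap hx ht (by have := Finset.mem_range.1 hi; omega),
    Finset.sum_congr rfl fun i hi => wsum_pair hx (by omega) (Finset.mem_range.1 hi),
    ← Finset.mul_sum, ← Finset.mul_sum, meanUpTo]
  ring

theorem wsum_hookStat_sq (hx : ∀ d, 1 + x d ≠ 0) (ht : 1 ≤ t) (hK : t ≤ K) :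
    wsum (K + t) x (fun D => (hookStat t D : ℂ) ^ 2)
      = (∏ d ∈ Finset.range (K + t), (1 + x d)) * (meanUpTo t x K ^ 2 + varUpTo t x K) := by
  have e : ∀ D ⊆ Finset.range (K + t), (hookStat t D : ℂ) ^ 2
      = 4 * (∑ i ∈ Finset.range K, ∑ j ∈ Finset.range K, gapInd t D i * gapInd t D j)
        + 4 * (∑ a ∈ Finset.range t, ∑ i ∈ Finset.range K, gapInd t D i * pairInd t D a)
        + ∑ a ∈ Finset.range t, ∑ b ∈ Finset.range t, pairInd t D a * pairInd t D b := by
    intro D hD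
    rw [hookStat_eq_sum hD, Finset.sum_comm (s := Finset.range t) (t := Finset.range K),
      ← Finset.sum_mul_sum, ← Finset.sum_mul_sum, ← Finset.sum_mul_sum]
    ring
  rw [wsum_congr e, wsum_add, wsum_add, wsum_const_mul, wsum_const_mul, wsum_sum, wsum_sum,
    wsum_sum]
  have e1 : ∀ i ∈ Finset.range K, wsum (K + t) x
      (fun D => ∑ j ∈ Finset.range K, gapInd t D i * gapInd t D j)
      = (∏ d ∈ Finset.range (K + t), (1 + x d)) * ∑ j ∈ Finset.range K,
        (gapProb t x i * gapProb t x j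
        + (if i = j then gapProb t x i - gapProb t x i ^ 2 else 0)
        - (if j = i + t then gapProb t x i * gapProb t x (i + t) else 0)
        - (if i = j + t then gapProb t x j * gapProb t x (j + t) else 0)) := by
    intro i hi
    rw [Finset.mem_range] at hi
    rw [wsum_sum, Finset.mul_sum]
    refine Finset.sum_congr rfl fun j hj => ?_
    rw [Finset.mem_range] at hj
    exact wsum_gap_gap hx ht (by omega) (by omega)
  have e2 : ∀ a ∈ Finset.range t, wsum (K + t) x
      (fun D => ∑ i ∈ Finset.range K, gapInd t D i * pairInd t D a)
      = (∏ d ∈ Finset.range (K + t), (1 + x d)) * ∑ i ∈ Finset.range K,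
        (gapProb t x i * pairProb t x a
        - (if i = a then gapProb t x a * pairProb t x a else 0)
        - (if i = t - 1 - a then
            (if a = t - 1 - a then 0 else gapProb t x (t - 1 - a) * pairProb t x a) else 0)) := by
    intro a ha
    rw [Finset.mem_range] at ha
    rw [wsum_sum, Finset.mul_sum]
    refine Finset.sum_congr rfl fun i hi => ?_
    rw [Finset.mem_range] at hi
    exact wsum_gap_pair hx ht (by omega) ha
  have e3 : ∀ a ∈ Finset.range t, wsum (K + t) x
      (fun D => ∑ b ∈ Finset.range t, pairInd t D a * pairInd t D b)
      = (∏ d ∈ Finset.range (K + t), (1 + x d)) * ∑ b ∈ Finset.range t,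
        (pairProb t x a * pairProb t x b
        + (if b = a then pairProb t x a - pairProb t x a ^ 2 else 0)
        + (if b = t - 1 - a then
            (if a = t - 1 - a then 0 else pairProb t x a - pairProb t x a ^ 2) else 0)) := by
    intro a ha
    rw [Finset.mem_range] at ha
    rw [wsum_sum, Finset.mul_sum]
    refine Finset.sum_congr rfl fun b hb => ?_
    exact wsum_pair_pair hx (by omega) ha (Finset.mem_range.1 hb)
  rw [Finset.sum_congr rfl e1, Finset.sum_congr rfl e2, Finset.sum_congr rfl e3,
    ← Finset.mul_sum, ← Finset.mul_sum, ← Finset.mul_sum]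
  simp only [Finset.sum_add_distrib, Finset.sum_sub_distrib]
  have f1 : ∑ i ∈ Finset.range K, ∑ j ∈ Finset.range K,
      (if i = j then gapProb t x i - gapProb t x i ^ 2 else 0)
      = ∑ i ∈ Finset.range K, (gapProb t x i - gapProb t x i ^ 2) := by
    refine Finset.sum_congr rfl fun i hi => ?_
    rw [Finset.sum_ite_eq, if_pos hi]
  have f2 : ∑ i ∈ Finset.range K, ∑ j ∈ Finset.range K,
      (if j = i + t then gapProb t x i * gapProb t x (i + t) else 0)
      = ∑ i ∈ Finset.range (K - t), gapProb t x i * gapProb t x (i + t) := by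
    simp only [Finset.sum_ite_eq', Finset.mem_range]
    rw [← Finset.sum_filter]
    refine Finset.sum_congr ?_ fun _ _ => rfl
    ext i
    simp only [Finset.mem_filter, Finset.mem_range]
    omega
  have f3 : ∑ i ∈ Finset.range K, ∑ j ∈ Finset.range K,
      (if i = j + t then gapProb t x j * gapProb t x (j + t) else 0)
      = ∑ i ∈ Finset.range (K - t), gapProb t x i * gapProb t x (i + t) := by
    rw [Finset.sum_comm, f2]
  have f4 : ∑ a ∈ Finset.range t, ∑ i ∈ Finset.range K,
      (if i = a then gapProb t x a * pairProb t x a else 0)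
      = ∑ a ∈ Finset.range t, gapProb t x a * pairProb t x a := by
    refine Finset.sum_congr rfl fun a ha => ?_
    rw [Finset.mem_range] at ha
    rw [Finset.sum_ite_eq', if_pos (Finset.mem_range.2 (by omega))]
  have f5 : ∑ a ∈ Finset.range t, ∑ i ∈ Finset.range K,
      (if i = t - 1 - a then
            (if a = t - 1 - a then 0 else gapProb t x (t - 1 - a) * pairProb t x a) else 0)
      = ∑ a ∈ Finset.range t,
        if a = t - 1 - a then 0 else gapProb t x (t - 1 - a) * pairProb t x a := by
    refine Finset.sum_congr rfl fun a ha => ?_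
    rw [Finset.mem_range] at ha
    rw [Finset.sum_ite_eq', if_pos (Finset.mem_range.2 (by omega))]
  have f6 : ∑ a ∈ Finset.range t, ∑ b ∈ Finset.range t,
      (if b = a then pairProb t x a - pairProb t x a ^ 2 else 0)
      = ∑ a ∈ Finset.range t, (pairProb t x a - pairProb t x a ^ 2) := by
    refine Finset.sum_congr rfl fun a ha => ?_
    rw [Finset.sum_ite_eq', if_pos ha]
  have f7 : ∑ a ∈ Finset.range t, ∑ b ∈ Finset.range t,
      (if b = t - 1 - a then
            (if a = t - 1 - a then 0 else pairProb t x a - pairProb t x a ^ 2) else 0)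
      = ∑ a ∈ Finset.range t,
        if a = t - 1 - a then 0 else pairProb t x a - pairProb t x a ^ 2 := by
    refine Finset.sum_congr rfl fun a ha => ?_
    rw [Finset.mem_range] at ha
    rw [Finset.sum_ite_eq', if_pos (Finset.mem_range.2 (by omega))]
  rw [f1, f2, f3, f4, f5, f6, f7]
  simp only [← Finset.sum_mul_sum, meanUpTo, varUpTo, Finset.sum_add_distrib,
    Finset.sum_sub_distrib]
  rw [Finset.sum_comm (s := Finset.range t) (t := Finset.range K), ← Finset.sum_mul_sum]
  ring

end

/-- The generating-function mean of the hook statistic, in terms of `X = q ^ t`. -/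
noncomputable def meanFun (t : ℕ) (X : ℂ) : ℂ :=
  t * (X ^ 2 / (1 - X ^ 2)) + delta t * (X / (1 + X) ^ 2)

/-- The generating-function variance of the hook statistic, in terms of `X = q ^ t`. -/
noncomputable def varFun (t : ℕ) (X : ℂ) : ℂ :=
  t * (2 * X ^ 2 / (1 - X ^ 4))
    + delta t * (X * (1 - X - 2 * X ^ 2 - X ^ 3 + X ^ 4) / ((1 + X) ^ 3 * (1 + X ^ 3)))

theorem one_add_ne_zero_of_norm {z : ℂ} (hz : ‖z‖ < 1) : 1 + z ≠ 0 := by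
  intro h
  have : z = -1 := by linear_combination h
  rw [this] at hz
  simp at hz

theorem one_sub_ne_zero_of_norm {z : ℂ} (hz : ‖z‖ < 1) : 1 - z ≠ 0 := by
  have := one_add_ne_zero_of_norm (z := -z) (by simpa using hz)
  rwa [← sub_eq_add_neg] at this

theorem sum_range_sub_shift (h : ℕ → ℂ) (t K : ℕ) :
    ∑ i ∈ Finset.range K, (h i - h (i + t))
      = ∑ i ∈ Finset.range t, h i - ∑ i ∈ Finset.range t, h (K + i) := by
  have h1 := Finset.sum_range_add h K t
  have h2 := Finset.sum_range_add h t K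
  rw [Finset.sum_sub_distrib]
  rw [add_comm t K, h1] at h2
  simp only [add_comm _ t]
  linear_combination h2

theorem sum_range_eq_of_reflect (t : ℕ) (f : ℕ → ℂ) (c e : ℂ)
    (h1 : ∀ a < t, a ≠ t - 1 - a → f a + f (t - 1 - a) = 2 * c)
    (h2 : ∀ a < t, a = t - 1 - a → f a = c + e) :
    ∑ a ∈ Finset.range t, f a = t * c + delta t * e := by
  have hr := Finset.sum_range_reflect f t
  have key : ∑ a ∈ Finset.range t, (f a + f (t - 1 - a))
      = ∑ a ∈ Finset.range t, (2 * c + if a = t - 1 - a then 2 * e else 0) := by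
    refine Finset.sum_congr rfl fun a ha => ?_
    rw [Finset.mem_range] at ha
    split_ifs with h
    · rw [← h, h2 a ha h]; ring
    · rw [h1 a ha h]; ring
  have hm : ∑ a ∈ Finset.range t, (if a = t - 1 - a then 2 * e else 0) = delta t * (2 * e) := by
    rw [delta]
    split_ifs with h
    · obtain ⟨k, hk⟩ := h
      rw [Finset.sum_eq_single k]
      · rw [if_pos (by omega)]; simp
      · intro b _ hb; rw [if_neg (by omega)]
      · intro hk'; simp at hk'; omega
    · rw [Finset.sum_eq_zero]
      · simp
      · intro a ha
        rw [Finset.mem_range] at ha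
        rw [if_neg]
        intro h'
        exact h ⟨a, by omega⟩
  rw [Finset.sum_add_distrib, hr, Finset.sum_add_distrib, hm] at key
  simp only [Finset.sum_const, Finset.card_range, nsmul_eq_mul] at key
  linear_combination key / 2

section

variable {q : ℂ}

/-- The odds of the diagonal hook `2 d + 1`. -/
def oddPow (q : ℂ) (d : ℕ) : ℂ := q ^ (2 * d + 1)

theorem norm_oddPow_lt (hq : ‖q‖ < 1) (d : ℕ) : ‖oddPow q d‖ < 1 := by
  rw [oddPow, norm_pow]
  exact pow_lt_one₀ (norm_nonneg _) hq (by omega)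

theorem tendsto_occ (hq : ‖q‖ < 1) (i : ℕ) :
    Tendsto (fun K => occ (oddPow q) (K + i)) atTop (nhds 0) := by
  have h : Tendsto (fun K : ℕ => oddPow q (K + i)) atTop (nhds 0) := by
    have : Tendsto (fun K : ℕ => 2 * (K + i) + 1) atTop atTop :=
      tendsto_atTop_mono (fun K => by simp only [id]; omega) tendsto_id
    exact (tendsto_pow_atTop_nhds_zero_of_norm_lt_one hq).comp this
  simpa [occ, Pi.div_def] using h.div (h.const_add 1) (by simp)

variable {t : ℕ}

theorem norm_pow_lt_of_pos (hq : ‖q‖ < 1) {k : ℕ} (hk : 1 ≤ k) : ‖q ^ k‖ < 1 := by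
  rw [norm_pow]
  exact pow_lt_one₀ (norm_nonneg _) hq (by omega)

noncomputable def gapPot (t : ℕ) (q : ℂ) (i : ℕ) : ℂ :=
  q ^ (2 * t) / (1 - q ^ (2 * t)) * occ (oddPow q) i
    - (q ^ (2 * t) / (1 - q ^ (2 * t)) * occ (oddPow q) i) ^ 2
    + 2 * (q ^ (2 * t) / (1 - q ^ (2 * t))) * ((q ^ (2 * t)) ^ 2 / (1 - (q ^ (2 * t)) ^ 2))
      * occ (oddPow q) i * occ (oddPow q) (i + t)

theorem gapProb_eq (hq : ‖q‖ < 1) (ht : 1 ≤ t) (i : ℕ) :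
    gapProb t (oddPow q) i
      = q ^ (2 * t) / (1 - q ^ (2 * t)) * (occ (oddPow q) i - occ (oddPow q) (i + t)) := by
  have h1 := one_add_ne_zero_of_norm (norm_oddPow_lt hq i)
  have h2 := one_add_ne_zero_of_norm (norm_oddPow_lt hq (i + t))
  have h3 := one_sub_ne_zero_of_norm (norm_pow_lt_of_pos hq (k := 2 * t) (by omega))
  have h4 : oddPow q (i + t) = oddPow q i * q ^ (2 * t) := by
    simp only [oddPow]; ring
  simp only [gapProb, occ]
  rw [h4] at h2 ⊢
  generalize oddPow q i = x at *
  generalize q ^ (2 * t) = y at *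
  field_simp
  ring

theorem gapPot_sub (hq : ‖q‖ < 1) (ht : 1 ≤ t) (i : ℕ) :
    gapProb t (oddPow q) i - gapProb t (oddPow q) i ^ 2
      - 2 * (gapProb t (oddPow q) i * gapProb t (oddPow q) (i + t))
      = gapPot t q i - gapPot t q (i + t) := by
  have h1 := one_add_ne_zero_of_norm (norm_oddPow_lt hq i)
  have h2 := one_add_ne_zero_of_norm (norm_oddPow_lt hq (i + t))
  have h2' := one_add_ne_zero_of_norm (norm_oddPow_lt hq (i + t + t))
  have hy := norm_pow_lt_of_pos hq (k := 2 * t) (by omega)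
  have h3 := one_sub_ne_zero_of_norm hy
  have h3' := one_add_ne_zero_of_norm hy
  have h4 : oddPow q (i + t) = oddPow q i * q ^ (2 * t) := by
    simp only [oddPow]; ring
  have h5 : oddPow q (i + t + t) = oddPow q i * (q ^ (2 * t)) ^ 2 := by
    simp only [oddPow]; ring
  rw [gapProb_eq hq ht, gapProb_eq hq ht]
  simp only [gapPot, occ]
  rw [h4] at h2 ⊢
  rw [h5] at h2' ⊢
  generalize oddPow q i = x at *
  generalize q ^ (2 * t) = y at *
  have h6 : 1 - y ^ 2 ≠ 0 := by
    rw [show 1 - y ^ 2 = (1 - y) * (1 + y) by ring]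
    exact mul_ne_zero h3 h3'
  have key : y / (1 - y) * (x * y ^ 2 / (1 + x * y ^ 2)) * (x / (1 + x) - x * y / (1 + x * y))
      = y ^ 2 / (1 - y ^ 2) * (x * y / (1 + x * y)) * (x / (1 + x) - x * y ^ 2 / (1 + x * y ^ 2)) := by
    have d1 : x / (1 + x) - x * y / (1 + x * y) = x * (1 - y) / ((1 + x) * (1 + x * y)) := by
      rw [div_sub_div _ _ h1 h2]; ring
    have d2 : x / (1 + x) - x * y ^ 2 / (1 + x * y ^ 2)
        = x * (1 - y ^ 2) / ((1 + x) * (1 + x * y ^ 2)) := by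
      rw [div_sub_div _ _ h1 h2']; ring
    rw [d1, d2]
    field_simp
  linear_combination 2 * (y / (1 - y)) * key

end

section

variable {q : ℂ} {t : ℕ}

theorem meanUpTo_eq (hq : ‖q‖ < 1) (ht : 1 ≤ t) (K : ℕ) :
    meanUpTo t (oddPow q) K
      = ∑ a ∈ Finset.range t, (2 * (q ^ (2 * t) / (1 - q ^ (2 * t))) * occ (oddPow q) a
          + pairProb t (oddPow q) a)
        - 2 * (q ^ (2 * t) / (1 - q ^ (2 * t))) * ∑ i ∈ Finset.range t, occ (oddPow q) (K + i) := by
  rw [meanUpTo, Finset.sum_congr rfl fun i _ => gapProb_eq hq ht i, ← Finset.mul_sum,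
    sum_range_sub_shift, Finset.sum_add_distrib, ← Finset.mul_sum]
  ring

theorem varUpTo_eq (hq : ‖q‖ < 1) (ht : 1 ≤ t) (K : ℕ) :
    varUpTo t (oddPow q) (K + t)
      = ∑ a ∈ Finset.range t, (4 * gapPot t q a
          - 4 * (gapProb t (oddPow q) a * pairProb t (oddPow q) a
              + if a = t - 1 - a then 0
                else gapProb t (oddPow q) (t - 1 - a) * pairProb t (oddPow q) a)
          + (pairProb t (oddPow q) a - pairProb t (oddPow q) a ^ 2
              + if a = t - 1 - a then 0
                else pairProb t (oddPow q) a - pairProb t (oddPow q) a ^ 2))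
        - 4 * ∑ i ∈ Finset.range t, gapPot t q (K + i)
        + 4 * ∑ i ∈ Finset.range t,
            (gapProb t (oddPow q) (K + i) - gapProb t (oddPow q) (K + i) ^ 2) := by
  have h := Finset.sum_congr (s₁ := Finset.range K) rfl fun i _ => gapPot_sub hq ht i
  rw [sum_range_sub_shift, Finset.sum_sub_distrib, ← Finset.mul_sum] at h
  rw [varUpTo, Nat.add_sub_cancel, Finset.sum_range_add]
  simp only [Finset.sum_add_distrib, Finset.sum_sub_distrib, ← Finset.mul_sum] at h ⊢
  linear_combination 4 * h

theorem tendsto_gapPot (hq : ‖q‖ < 1) (i : ℕ) :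
    Tendsto (fun K => gapPot t q (K + i)) atTop (nhds 0) := by
  have h1 := tendsto_occ hq i
  have h2 := tendsto_occ hq (i + t)
  simp only [gapPot]
  have := ((h1.const_mul (q ^ (2 * t) / (1 - q ^ (2 * t)))).sub
    ((h1.const_mul (q ^ (2 * t) / (1 - q ^ (2 * t)))).pow 2)).add
    ((h1.const_mul (2 * (q ^ (2 * t) / (1 - q ^ (2 * t)))
      * ((q ^ (2 * t)) ^ 2 / (1 - (q ^ (2 * t)) ^ 2)))).mul h2)
  simpa [add_assoc] using this

theorem tendsto_gapProb (hq : ‖q‖ < 1) (i : ℕ) :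
    Tendsto (fun K => gapProb t (oddPow q) (K + i)) atTop (nhds 0) := by
  have h1 := tendsto_occ hq i
  have h2 := tendsto_occ hq (i + t)
  simpa [gapProb, add_assoc] using (h1.const_sub 1).mul h2

theorem oddPow_mul_reflect {a : ℕ} (ha : a < t) :
    oddPow q a * oddPow q (t - 1 - a) = q ^ (2 * t) := by
  rw [oddPow, oddPow, ← pow_add]
  congr 1
  omega

theorem sum_mean_eq (hq : ‖q‖ < 1) (ht : 1 ≤ t) :
    ∑ a ∈ Finset.range t, (2 * (q ^ (2 * t) / (1 - q ^ (2 * t))) * occ (oddPow q) a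
          + pairProb t (oddPow q) a) = meanFun t (q ^ t) := by
  have hX := norm_pow_lt_of_pos hq (k := t) (by omega)
  have hy := norm_pow_lt_of_pos hq (k := 2 * t) (by omega)
  have h3 := one_sub_ne_zero_of_norm hy
  have hX1 := one_add_ne_zero_of_norm hX
  have hX2 := one_sub_ne_zero_of_norm hX
  have e : q ^ (2 * t) = (q ^ t) ^ 2 := by ring
  refine (sum_range_eq_of_reflect t _ (q ^ (2 * t) / (1 - q ^ (2 * t)))
    (q ^ t / (1 + q ^ t) ^ 2) ?_ ?_).trans (by rw [meanFun, e])
  · intro a ha hne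
    have hr := oddPow_mul_reflect (q := q) ha
    have h1 := one_add_ne_zero_of_norm (norm_oddPow_lt hq a)
    have h2 := one_add_ne_zero_of_norm (norm_oddPow_lt hq (t - 1 - a))
    simp only [pairProb, show t - 1 - (t - 1 - a) = a by omega, if_neg hne, if_neg hne.symm, occ]
    rw [← hr] at h3 ⊢
    generalize oddPow q a = α at *
    generalize oddPow q (t - 1 - a) = β at *
    field_simp
    ring
  · intro a ha heq
    have h1 : oddPow q a = q ^ t := by rw [oddPow]; congr 1; omega
    simp only [pairProb, if_pos heq, occ, h1]
    rw [e] at h3 ⊢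
    generalize q ^ t = X at *
    have h4 : 1 - X ^ 2 = (1 - X) * (1 + X) := by ring
    rw [h4]
    field_simp
    ring

theorem sum_var_eq (hq : ‖q‖ < 1) (ht : 1 ≤ t) :
    ∑ a ∈ Finset.range t, (4 * gapPot t q a
          - 4 * (gapProb t (oddPow q) a * pairProb t (oddPow q) a
              + if a = t - 1 - a then 0
                else gapProb t (oddPow q) (t - 1 - a) * pairProb t (oddPow q) a)
          + (pairProb t (oddPow q) a - pairProb t (oddPow q) a ^ 2
              + if a = t - 1 - a then 0
                else pairProb t (oddPow q) a - pairProb t (oddPow q) a ^ 2))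
      = varFun t (q ^ t) := by
  have hX := norm_pow_lt_of_pos hq (k := t) (by omega)
  have hX1 := one_add_ne_zero_of_norm hX
  have hX2 := one_sub_ne_zero_of_norm hX
  have hX3 := one_add_ne_zero_of_norm (norm_pow_lt_of_pos hX (k := 3) (by omega))
  have hX4 := one_add_ne_zero_of_norm (norm_pow_lt_of_pos hX (k := 2) (by omega))
  have e : q ^ (2 * t) = (q ^ t) ^ 2 := by ring
  refine (sum_range_eq_of_reflect t _ (2 * (q ^ t) ^ 2 / (1 - (q ^ t) ^ 4))
    (q ^ t * (1 - q ^ t - 2 * (q ^ t) ^ 2 - (q ^ t) ^ 3 + (q ^ t) ^ 4)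
      / ((1 + q ^ t) ^ 3 * (1 + (q ^ t) ^ 3))) ?_ ?_).trans (by rw [varFun])
  · intro a ha hne
    have hr := oddPow_mul_reflect (q := q) ha
    have h1 := one_add_ne_zero_of_norm (norm_oddPow_lt hq a)
    have h2 := one_add_ne_zero_of_norm (norm_oddPow_lt hq (t - 1 - a))
    have h1' := one_add_ne_zero_of_norm (norm_oddPow_lt hq (a + t))
    have h2' := one_add_ne_zero_of_norm (norm_oddPow_lt hq (t - 1 - a + t))
    have e1 : oddPow q (a + t) = oddPow q a * q ^ (2 * t) := by simp only [oddPow]; ring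
    have e2 : oddPow q (t - 1 - a + t) = oddPow q (t - 1 - a) * q ^ (2 * t) := by
      simp only [oddPow]; ring
    have e3 : 1 - (q ^ t) ^ 4 = (1 - q ^ (2 * t)) * (1 + q ^ (2 * t)) := by ring
    have e4 : 1 - (q ^ (2 * t)) ^ 2 = (1 - q ^ (2 * t)) * (1 + q ^ (2 * t)) := by ring
    have hy := norm_pow_lt_of_pos hq (k := 2 * t) (by omega)
    have h3 := one_sub_ne_zero_of_norm hy
    have h3' := one_add_ne_zero_of_norm hy
    have g1 := gapProb_eq hq ht a
    have g2 := gapProb_eq hq ht (t - 1 - a)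
    simp only [pairProb, show t - 1 - (t - 1 - a) = a by omega, if_neg hne, if_neg hne.symm,
      g1, g2, gapPot, e3, e4]
    rw [← e]
    simp only [occ, e1, e2]
    rw [e1] at h1'
    rw [e2] at h2'
    rw [← hr] at h1' h2' h3 h3' ⊢
    generalize oddPow q a = α at *
    generalize oddPow q (t - 1 - a) = β at *
    have d1 : α / (1 + α) - α * (α * β) / (1 + α * (α * β))
        = α * (1 - α * β) / ((1 + α) * (1 + α * (α * β))) := by
      rw [div_sub_div _ _ h1 h1']; ring
    have d2 : β / (1 + β) - β * (α * β) / (1 + β * (α * β))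
        = β * (1 - α * β) / ((1 + β) * (1 + β * (α * β))) := by
      rw [div_sub_div _ _ h2 h2']; ring
    rw [d1, d2]
    have f1 : 1 + α ^ 2 * β ≠ 0 := by convert h1' using 2; ring
    have f2 : 1 + α * β ^ 2 ≠ 0 := by convert h2' using 2; ring
    field_simp
    ring
  · intro a ha heq
    have h1 : oddPow q a = q ^ t := by rw [oddPow]; congr 1; omega
    have h2 : oddPow q (a + t) = (q ^ t) ^ 3 := by rw [oddPow, ← pow_mul]; congr 1; omega
    simp only [gapPot, gapProb, pairProb, if_pos heq, occ, h1, h2]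
    rw [e]
    generalize q ^ t = X at *
    have h4 : 1 - X ^ 2 = (1 - X) * (1 + X) := by ring
    have h5 : 1 - (X ^ 2) ^ 2 = (1 - X) * (1 + X) * (1 + X ^ 2) := by ring
    have h6 : 1 - X ^ 4 = (1 - X) * (1 + X) * (1 + X ^ 2) := by ring
    rw [h4, h5, h6]
    field_simp
    ring

theorem tendsto_meanUpTo (hq : ‖q‖ < 1) (ht : 1 ≤ t) :
    Tendsto (meanUpTo t (oddPow q)) atTop (nhds (meanFun t (q ^ t))) := by
  simp only [funext (meanUpTo_eq hq ht), sum_mean_eq hq ht]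
  have := (tendsto_finsetSum (Finset.range t) fun i _ => tendsto_occ hq i).const_mul
    (2 * (q ^ (2 * t) / (1 - q ^ (2 * t))))
  simpa using this.const_sub (meanFun t (q ^ t))

theorem tendsto_varUpTo (hq : ‖q‖ < 1) (ht : 1 ≤ t) :
    Tendsto (fun K => varUpTo t (oddPow q) (K + t)) atTop (nhds (varFun t (q ^ t))) := by
  simp only [varUpTo_eq hq ht, sum_var_eq hq ht]
  have h1 := (tendsto_finsetSum (Finset.range t) fun i _ => tendsto_gapPot (t := t) hq i).const_mul 4
  have h2 := (tendsto_finsetSum (Finset.range t) fun i _ =>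
    (tendsto_gapProb (t := t) hq i).sub ((tendsto_gapProb (t := t) hq i).pow 2)).const_mul 4
  simpa using (h1.const_sub (varFun t (q ^ t))).add h2

end

section

variable {q : ℂ} {t : ℕ}

/-- The generating function `∏ (1 + q ^ (2 d + 1))` of self-conjugate partitions. -/
noncomputable def oddProd (q : ℂ) : ℂ := ∏' d : ℕ, (1 + oddPow q d)

/-- The `j`-th moment of the hook statistic (for `j ≤ 2`). -/
noncomputable def momFun (t j : ℕ) (X : ℂ) : ℂ :=
  if j = 0 then 1 else if j = 1 then meanFun t X else meanFun t X ^ 2 + varFun t X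

theorem summable_norm_oddPow (hq : ‖q‖ < 1) : Summable fun d => ‖oddPow q d‖ := by
  have h := summable_geometric_of_lt_one (norm_nonneg q) hq
  refine Summable.of_nonneg_of_le (fun _ => norm_nonneg _) (fun d => ?_) h
  rw [oddPow, norm_pow]
  exact pow_le_pow_of_le_one (norm_nonneg _) hq.le (by omega)

theorem multipliable_oddPow (hq : ‖q‖ < 1) : Multipliable fun d => 1 + oddPow q d :=
  multipliable_one_add_of_summable (summable_norm_oddPow hq)

theorem tendsto_oddProd (hq : ‖q‖ < 1) (m : ℕ) :
    Tendsto (fun K => ∏ d ∈ Finset.range (K + m), (1 + oddPow q d)) atTop (nhds (oddProd q)) :=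
  ((multipliable_oddPow hq).hasProd.tendsto_prod_nat).comp (tendsto_add_atTop_nat m)

theorem tendsto_wsum (hq : ‖q‖ < 1) (ht : 1 ≤ t) {j : ℕ} (hj : j ≤ 2) :
    Tendsto (fun K => wsum (K + t + t) (oddPow q) (fun D => (hookStat t D : ℂ) ^ j)) atTop
      (nhds (oddProd q * momFun t j (q ^ t))) := by
  have hx : ∀ d, 1 + oddPow q d ≠ 0 := fun d => one_add_ne_zero_of_norm (norm_oddPow_lt hq d)
  have hP := tendsto_oddProd hq (t + t)
  simp only [← add_assoc] at hP
  have hm := (tendsto_meanUpTo hq ht).comp (tendsto_add_atTop_nat t)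
  interval_cases j
  · simpa only [pow_zero, wsum_one, momFun, if_true, mul_one] using hP
  · simp only [pow_one, wsum_hookStat hx ht]
    simpa [momFun] using hP.mul hm
  · simp only [wsum_hookStat_sq hx ht (Nat.le_add_left _ _)]
    simpa [momFun] using hP.mul ((hm.pow 2).add (tendsto_varUpTo hq ht))

theorem prod_oddPow (q : ℂ) (D : Finset ℕ) :
    ∏ d ∈ D, oddPow q d = q ^ (∑ d ∈ D, (2 * d + 1)) := by
  simp only [oddPow, Finset.prod_pow_eq_pow_sum]

theorem norm_wsum_le (q : ℂ) (L : ℕ) (f : Finset ℕ → ℕ) (j : ℕ) :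
    ‖wsum L (oddPow q) (fun D => (f D : ℂ) ^ j)‖
      ≤ ‖wsum L (oddPow (‖q‖ : ℂ)) (fun D => (f D : ℂ) ^ j)‖ := by
  have h : wsum L (oddPow (‖q‖ : ℂ)) (fun D => (f D : ℂ) ^ j)
      = ((∑ D ∈ (Finset.range L).powerset, (f D : ℝ) ^ j * ‖q‖ ^ (∑ d ∈ D, (2 * d + 1)) : ℝ) : ℂ) := by
    simp only [wsum, prod_oddPow]
    push_cast
    rfl
  rw [h, Complex.norm_real, Real.norm_of_nonneg (Finset.sum_nonneg fun _ _ => by positivity), wsum]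
  refine (norm_sum_le _ _).trans (Finset.sum_le_sum fun D _ => ?_)
  rw [prod_oddPow]
  simp

theorem exists_bound_wsum (ht : 1 ≤ t) {j : ℕ} (hj : j ≤ 2) {r : ℝ} (hr0 : 0 ≤ r) (hr : r < 1) :
    ∃ B : ℝ, ∀ (q : ℂ) (K : ℕ), ‖q‖ = r →
      ‖wsum (K + t + t) (oddPow q) (fun D => (hookStat t D : ℂ) ^ j)‖ ≤ B := by
  have h := tendsto_wsum (q := (r : ℂ)) (t := t) (by simpa [abs_of_nonneg hr0] using hr) ht hj
  obtain ⟨B, hB⟩ := h.norm.bddAbove_range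
  refine ⟨B, fun q K hq => (norm_wsum_le q _ _ _).trans ?_⟩
  rw [hq]
  exact hB ⟨K, rfl⟩

theorem integral_exp_int_mul (m : ℤ) (z : ℝ) :
    ∫ θ in (-π)..π, Complex.exp (m * (z + θ * I)) = if m = 0 then 2 * π else 0 := by
  split_ifs with h
  · subst h
    simp
    ring
  · have hc : (m : ℂ) * I ≠ 0 := by simp [h]
    have e : ∀ θ : ℝ, Complex.exp (m * (z + θ * I))
        = Complex.exp (m * z) * Complex.exp (m * I * θ) := by
      intro θ; rw [← Complex.exp_add]; ring_nf
    simp only [e]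
    rw [intervalIntegral.integral_const_mul, integral_exp_mul_complex hc]
    have : Complex.exp (m * I * (π : ℝ)) = Complex.exp (m * I * ((-π : ℝ) : ℂ)) := by
      rw [Complex.exp_eq_exp_iff_exists_int]
      exact ⟨m, by push_cast; ring⟩
    rw [this]
    simp

theorem integral_wsum (L : ℕ) (f : Finset ℕ → ℂ) (n : ℕ) (z : ℝ) :
    ∫ θ in (-π)..π, wsum L (oddPow (Complex.exp (-(z + θ * I)))) f
        * Complex.exp (n * (z + θ * I))
      = 2 * π * ∑ D ∈ (Finset.range L).powerset.filter (fun D => ∑ d ∈ D, (2 * d + 1) = n),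
          f D := by
  have e : ∀ θ : ℝ, wsum L (oddPow (Complex.exp (-(z + θ * I)))) f
        * Complex.exp (n * (z + θ * I))
      = ∑ D ∈ (Finset.range L).powerset,
          f D * Complex.exp (((n - (∑ d ∈ D, (2 * d + 1) : ℕ) : ℤ) : ℂ) * (z + θ * I)) := by
    intro θ
    rw [wsum, Finset.sum_mul]
    refine Finset.sum_congr rfl fun D _ => ?_
    rw [prod_oddPow, ← Complex.exp_nat_mul, mul_assoc, ← Complex.exp_add]
    push_cast
    ring_nf
  simp only [e]
  rw [intervalIntegral.integral_finsetSum]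
  · rw [Finset.sum_filter, Finset.mul_sum]
    refine Finset.sum_congr rfl fun D _ => ?_
    rw [intervalIntegral.integral_const_mul, integral_exp_int_mul]
    have : (n - (∑ d ∈ D, (2 * d + 1) : ℕ) : ℤ) = 0 ↔ ∑ d ∈ D, (2 * d + 1) = n := by omega
    simp only [this]
    split_ifs <;> push_cast <;> ring
  · intro D _
    apply Continuous.intervalIntegrable
    fun_prop

/-- Cauchy's formula for the power sums of the hook statistic. -/
theorem integral_eq_sum_SC (ht : 1 ≤ t) {j : ℕ} (hj : j ≤ 2) (n : ℕ) {z : ℝ} (hz : 0 < z) :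
    ∫ θ in (-π)..π, oddProd (Complex.exp (-(z + θ * I)))
        * momFun t j (Complex.exp (-(z + θ * I)) ^ t) * Complex.exp (n * (z + θ * I))
      = 2 * π * ∑ P ∈ SC n, (Nhook t P : ℂ) ^ j := by
  have hq : ∀ θ : ℝ, ‖Complex.exp (-(z + θ * I))‖ = Real.exp (-z) := by
    intro θ; rw [Complex.norm_exp]; simp
  have hr : Real.exp (-z) < 1 := by simpa using hz
  obtain ⟨B, hB⟩ := exists_bound_wsum ht hj (Real.exp_pos _).le hr
  have hlim : Tendsto (fun K : ℕ => ∫ θ in (-π)..π,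
      wsum (K + t + t) (oddPow (Complex.exp (-(z + θ * I)))) (fun D => (hookStat t D : ℂ) ^ j)
        * Complex.exp (n * (z + θ * I))) atTop
      (nhds (∫ θ in (-π)..π, oddProd (Complex.exp (-(z + θ * I)))
        * momFun t j (Complex.exp (-(z + θ * I)) ^ t) * Complex.exp (n * (z + θ * I)))) := by
    apply intervalIntegral.tendsto_integral_filter_of_dominated_convergence
      (fun _ => B * Real.exp (n * z))
    · refine Eventually.of_forall fun K => ?_
      apply Continuous.aestronglyMeasurable
      simp only [wsum, oddPow]
      fun_prop
    · refine Eventually.of_forall fun K => Eventually.of_forall fun θ _ => ?_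
      rw [norm_mul]
      refine mul_le_mul (hB _ _ (hq θ)) ?_ (norm_nonneg _) ((norm_nonneg _).trans (hB _ K (hq θ)))
      rw [Complex.norm_exp]; simp
    · simp
    · refine Eventually.of_forall fun θ _ => ?_
      exact (tendsto_wsum (by rw [hq]; exact hr) ht hj).mul_const _
  refine tendsto_nhds_unique hlim (tendsto_const_nhds.congr' ?_)
  filter_upwards [eventually_ge_atTop n] with K hK
  rw [integral_wsum, sum_SC_eq t n (K + t + t) (by omega) (fun N => (N : ℂ) ^ j)]

end

noncomputable def eulerProd (q : ℂ) : ℂ := ∏' n : ℕ, (1 - q ^ (n + 1))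

theorem eulerProd_eq {q : ℂ} (hq : ‖q‖ < 1) :
    eulerProd q = (∏' d : ℕ, (1 - oddPow q d)) * eulerProd (q ^ 2) := by
  have h1 : Multipliable fun d => 1 - oddPow q d := by
    have := multipliable_one_add_of_summable (f := fun d => -oddPow q d)
      (by simpa using summable_norm_oddPow hq)
    simpa [sub_eq_add_neg] using this
  have h2 : Multipliable fun n : ℕ => 1 - (q ^ 2) ^ (n + 1) :=
    ModularForm.multipliable_one_sub_pow (norm_pow_lt_of_pos hq (by omega))
  rw [eulerProd, eulerProd, ← tprod_even_mul_odd (f := fun n : ℕ => 1 - q ^ (n + 1))]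
  · congr 2
    funext n
    ring
  · exact h1
  · convert h2 using 3
    ring

theorem oddProd_mul_eulerProd {q : ℂ} (hq : ‖q‖ < 1) :
    oddProd q * (eulerProd q * eulerProd (q ^ 4)) = eulerProd (q ^ 2) ^ 2 := by
  have h1 : Multipliable fun d => 1 - oddPow q d := by
    have := multipliable_one_add_of_summable (f := fun d => -oddPow q d)
      (by simpa using summable_norm_oddPow hq)
    simpa [sub_eq_add_neg] using this
  have h2 : oddProd q * (∏' d : ℕ, (1 - oddPow q d)) = ∏' d : ℕ, (1 - oddPow (q ^ 2) d) := by
    rw [oddProd, ← (multipliable_oddPow hq).tprod_mul h1]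
    congr 1
    funext d
    simp only [oddPow]
    ring
  have h3 := eulerProd_eq (q := q ^ 2) (norm_pow_lt_of_pos hq (by omega))
  rw [← h2, show (q ^ 2) ^ 2 = q ^ 4 by ring] at h3
  rw [eulerProd_eq hq, pow_two (eulerProd (q ^ 2))]
  nth_rewrite 3 [h3]
  ring

theorem eta_eq {w : ℂ} :
    ModularForm.eta (I * w / (2 * π)) = cexp (-w / 24) * eulerProd (cexp (-w)) := by
  have hpi : (π : ℂ) ≠ 0 := by exact_mod_cast Real.pi_ne_zero
  have e : 2 * π * I * (I * w / (2 * π)) = -w := by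
    field_simp
    rw [I_sq]; ring
  rw [ModularForm.eta, eulerProd, Function.Periodic.qParam, e]
  simp only [ModularForm.eta_q_eq_pow, e]
  norm_num

/-- The generating function as a function of `w`, where `q = exp (-w)`. -/
noncomputable def oddGen (w : ℂ) : ℂ := oddProd (cexp (-w))

noncomputable def etaRight (w : ℂ) : ℂ := ModularForm.eta (I * w / (2 * π))

theorem mem_upperHalf {w : ℂ} (hw : 0 < w.re) :
    I * w / (2 * π) ∈ UpperHalfPlane.upperHalfPlaneSet := by
  have e : I * w / (2 * π) = ((1 / (2 * π) : ℝ) : ℂ) * (I * w) := by push_cast; ring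
  change 0 < (I * w / (2 * π)).im
  rw [e, Complex.im_ofReal_mul]
  simp only [Complex.mul_im, Complex.I_re, Complex.I_im, zero_mul, one_mul, zero_add]
  positivity

theorem norm_exp_neg_lt {w : ℂ} (hw : 0 < w.re) : ‖cexp (-w)‖ < 1 := by
  rw [Complex.norm_exp]; simpa using hw

theorem etaRight_ne_zero {w : ℂ} (hw : 0 < w.re) : etaRight w ≠ 0 :=
  ModularForm.eta_ne_zero (mem_upperHalf hw)

theorem oddGen_mul_etaRight {w : ℂ} (hw : 0 < w.re) :
    cexp (w / 24) * oddGen w * (etaRight w * etaRight (4 * w)) = etaRight (2 * w) ^ 2 := by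
  simp only [etaRight, eta_eq, oddGen]
  have h := oddProd_mul_eulerProd (norm_exp_neg_lt hw)
  rw [← Complex.exp_nat_mul, ← Complex.exp_nat_mul] at h
  rw [show -(4 * w) = ((4 : ℕ) : ℂ) * -w by push_cast; ring,
    show -(2 * w) = ((2 : ℕ) : ℂ) * -w by push_cast; ring, mul_pow, ← h, ← Complex.exp_nat_mul]
  have : cexp (((2 : ℕ) : ℂ) * (((2 : ℕ) : ℂ) * -w / 24))
      = cexp (w / 24) * cexp (-w / 24) * cexp (((4 : ℕ) : ℂ) * -w / 24) := by
    rw [← Complex.exp_add, ← Complex.exp_add]; congr 1; push_cast; ring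
  rw [this]
  ring

theorem etaRight_inv {w : ℂ} (hw : 0 < w.re) :
    etaRight (4 * π ^ 2 / w) = (Complex.sqrt I)⁻¹ * Complex.sqrt (I * w / (2 * π)) * etaRight w := by
  have h := ModularForm.eta_comp_eq_csqrt_I_inv (mem_upperHalf hw)
  simp only [Function.comp, Pi.smul_apply, Pi.mul_apply, smul_eq_mul] at h
  rw [etaRight, etaRight, mul_assoc, ← h]
  congr 1
  have hpi : (π : ℂ) ≠ 0 := by exact_mod_cast Real.pi_ne_zero
  have hw0 : w ≠ 0 := by rintro rfl; simp at hw
  field_simp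
  rw [I_sq]; ring

theorem re_inv_pos {w : ℂ} (hw : 0 < w.re) (c : ℝ) (hc : 0 < c) : 0 < (c / w).re := by
  rw [div_eq_mul_inv, Complex.re_ofReal_mul, Complex.inv_re]
  have hw0 : w ≠ 0 := by rintro rfl; simp at hw
  have := Complex.normSq_pos.2 hw0
  positivity

/-- `exp (w / 24) * oddGen w` is invariant under `w ↦ π ^ 2 / w`. -/
theorem oddGen_transform {w : ℂ} (hw : 0 < w.re) :
    oddGen w = cexp (π ^ 2 / (24 * w) - w / 24) * oddGen (π ^ 2 / w) := by
  have hpi : (π : ℂ) ≠ 0 := by exact_mod_cast Real.pi_ne_zero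
  have hw0 : w ≠ 0 := by rintro rfl; simp at hw
  have hv : 0 < ((π : ℂ) ^ 2 / w).re := by
    have := re_inv_pos hw (π ^ 2) (by positivity)
    push_cast at this; exact this
  have h2 : 0 < (2 * w).re := by simpa using hw
  have h4 : 0 < (4 * w).re := by simpa using hw
  have e1 := oddGen_mul_etaRight hw
  have e2 := oddGen_mul_etaRight hv
  have f1 := etaRight_inv hw
  have f2 := etaRight_inv h2
  have f4 := etaRight_inv h4
  rw [show 4 * (π : ℂ) ^ 2 / w = 4 * (π ^ 2 / w) by ring] at f1
  rw [show 4 * (π : ℂ) ^ 2 / (2 * w) = 2 * (π ^ 2 / w) by field_simp; ring] at f2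
  rw [show 4 * (π : ℂ) ^ 2 / (4 * w) = π ^ 2 / w by field_simp] at f4
  rw [f1, f2, f4] at e2
  have s4 : Complex.sqrt (I * (4 * w) / (2 * π)) = 2 * Complex.sqrt (I * w / (2 * π)) := by
    rw [show I * (4 * w) / (2 * π) = ((4 : ℝ) : ℂ) * (I * w / (2 * π)) by push_cast; ring]
    have hb : I * w / (2 * π) ≠ 0 :=
      div_ne_zero (mul_ne_zero I_ne_zero hw0) (by simp [hpi])
    have h40 : ((4 : ℝ) : ℂ) ≠ 0 := by norm_num
    rw [Complex.sqrt, Complex.sqrt, Complex.cpow_def_of_ne_zero hb,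
      Complex.cpow_def_of_ne_zero (mul_ne_zero h40 hb), Complex.log_ofReal_mul (by norm_num) hb,
      add_mul, Complex.exp_add, show (4 : ℝ) = 2 ^ 2 by norm_num, Real.log_pow]
    congr 1
    rw [show (((2 : ℕ) * Real.log 2 : ℝ) : ℂ) * 2⁻¹ = ((Real.log 2 : ℝ) : ℂ) by push_cast; ring,
      ← Complex.ofReal_exp, Real.exp_log (by norm_num)]
    norm_num
  have sq : ∀ z : ℂ, Complex.sqrt z ^ 2 = z := by
    intro z
    simp [Complex.sqrt]
  set s := Complex.sqrt (I * w / (2 * π)) with hs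
  have hs2 : s ^ 2 = I * w / (2 * π) := sq _
  have hs0 : s ≠ 0 := by
    intro h; rw [h] at hs2
    have : I * w / (2 * π) ≠ 0 := by
      refine div_ne_zero (mul_ne_zero I_ne_zero hw0) (by simp [hpi])
    exact this (by rw [← hs2]; simp)
  have hk0 : (Complex.sqrt I)⁻¹ ≠ 0 := by
    refine inv_ne_zero fun h => ?_
    have := sq I
    rw [h] at this; exact I_ne_zero (by rw [← this]; simp)
  set k := (Complex.sqrt I)⁻¹ with hk
  have hE1 := etaRight_ne_zero hw
  have hE4 := etaRight_ne_zero h4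
  have s2 : Complex.sqrt (I * (2 * w) / (2 * π)) ^ 2 = 2 * s ^ 2 := by
    rw [sq, hs2]; ring
  rw [mul_pow, mul_pow, s2, s4, ← e1] at e2
  have key : cexp (π ^ 2 / w / 24) * oddGen (π ^ 2 / w) = cexp (w / 24) * oddGen w := by
    have hne : k ^ 2 * (2 * s ^ 2) * (etaRight w * etaRight (4 * w)) ≠ 0 :=
      mul_ne_zero (mul_ne_zero (pow_ne_zero _ hk0) (mul_ne_zero two_ne_zero (pow_ne_zero _ hs0)))
        (mul_ne_zero hE1 hE4)
    apply mul_right_cancel₀ hne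
    linear_combination e2
  rw [Complex.exp_sub, show (π : ℂ) ^ 2 / (24 * w) = π ^ 2 / w / 24 by field_simp, div_mul_eq_mul_div,
    key, mul_div_cancel_left₀ _ (Complex.exp_ne_zero _)]

theorem hasSum_oddPow {q : ℂ} (hq : ‖q‖ < 1) : HasSum (oddPow q) (q / (1 - q ^ 2)) := by
  have h := (hasSum_geometric_of_norm_lt_one (norm_pow_lt_of_pos hq (k := 2) (by omega))).mul_left q
  rw [← div_eq_mul_inv] at h
  have e : oddPow q = fun d => q * (q ^ 2) ^ d := by funext d; rw [oddPow]; ring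
  rw [e]; exact h

theorem norm_oddPow (q : ℂ) (d : ℕ) : ‖oddPow q d‖ = ‖q‖ ^ (2 * d + 1) := by
  rw [oddPow, norm_pow]

theorem norm_oddProd_sub_one_le {q : ℂ} (hq : ‖q‖ ≤ Real.exp (-1)) :
    ‖oddProd q - 1‖ ≤ 4 * ‖q‖ := by
  have he : Real.exp (-1) < 3 / 8 := by
    have := Real.exp_neg_one_lt_d9
    linarith
  have hq1 : ‖q‖ < 1 := by linarith
  have h0 := norm_nonneg q
  set r := ‖q‖ with hr
  have hsum : ∀ K : ℕ, ∑ d ∈ Finset.range K, ‖oddPow q d‖ ≤ 2 * r := by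
    intro K
    have hs : HasSum (fun d => r * (r ^ 2) ^ d) (r * (1 - r ^ 2)⁻¹) :=
      (hasSum_geometric_of_lt_one (by positivity) (by nlinarith)).mul_left r
    have h1 : ∑ d ∈ Finset.range K, ‖oddPow q d‖ ≤ r * (1 - r ^ 2)⁻¹ := by
      have := sum_le_hasSum (Finset.range K) (fun i _ => by positivity) hs
      refine le_trans (le_of_eq (Finset.sum_congr rfl fun d _ => ?_)) this
      rw [norm_oddPow, ← hr]; ring
    have h2 : (1 - r ^ 2)⁻¹ ≤ 2 := by
      rw [inv_le_comm₀ (by nlinarith) (by norm_num)]; nlinarith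
    nlinarith
  have hlim := ((tendsto_oddProd hq1 0).sub_const 1).norm
  refine le_of_tendsto hlim (Eventually.of_forall fun K => ?_)
  refine (Finset.norm_prod_one_add_sub_one_le _ _).trans ?_
  have h2 := hsum (K + 0)
  have h3 : 0 ≤ ∑ d ∈ Finset.range (K + 0), ‖oddPow q d‖ := Finset.sum_nonneg fun _ _ => norm_nonneg _
  have h4 := Real.abs_exp_sub_one_le (x := ∑ d ∈ Finset.range (K + 0), ‖oddPow q d‖)
    (by rw [abs_of_nonneg h3]; linarith)
  rw [abs_of_nonneg h3] at h4
  have := le_abs_self (Real.exp (∑ d ∈ Finset.range (K + 0), ‖oddPow q d‖) - 1)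
  linarith

theorem exp_neg_four_div_le {z : ℝ} (hz : 0 < z) : 4 * Real.exp (-(4 / z)) ≤ z ^ 3 := by
  have h1 := Real.pow_div_factorial_le_exp (4 / z) (by positivity) 3
  have h2 : (4 / z) ^ 3 / (Nat.factorial 3 : ℝ) = 32 / (3 * z ^ 3) := by
    norm_num [Nat.factorial]
    field_simp
    norm_num
  rw [h2] at h1
  rw [Real.exp_neg]
  have h3 : (Real.exp (4 / z))⁻¹ ≤ (32 / (3 * z ^ 3))⁻¹ := inv_anti₀ (by positivity) h1
  rw [inv_div] at h3
  have : 0 < z ^ 3 := by positivity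
  linarith

/-- The error factor in the major-arc approximation of `oddGen`. -/
noncomputable def majorErr (w : ℂ) : ℂ := oddGen (π ^ 2 / w) - 1

theorem oddGen_eq {w : ℂ} (hw : 0 < w.re) :
    oddGen w = cexp (π ^ 2 / (24 * w) - w / 24) * (1 + majorErr w) := by
  rw [oddGen_transform hw, majorErr]
  ring

theorem norm_majorErr_le {w : ℂ} (hw : 0 < w.re) (hw1 : w.re ≤ 1) (him : |w.im| ≤ w.re) :
    ‖majorErr w‖ ≤ w.re ^ 3 := by
  have hre : 4 / w.re ≤ ((π : ℂ) ^ 2 / w).re := by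
    have e : (π : ℂ) ^ 2 / w = ((π ^ 2 : ℝ) : ℂ) * w⁻¹ := by push_cast; ring
    rw [e, Complex.re_ofReal_mul, Complex.inv_re, Complex.normSq_apply]
    have h1 : w.im * w.im ≤ w.re * w.re := by
      rw [← abs_mul_abs_self w.im]; exact mul_self_le_mul_self (abs_nonneg _) him
    have h2 : 0 < w.re * w.re + w.im * w.im := by nlinarith [mul_self_nonneg w.im]
    rw [← mul_div_assoc, div_le_div_iff₀ hw h2]
    have := Real.pi_gt_three
    have h3 : 9 ≤ π ^ 2 := by nlinarith
    nlinarith [mul_pos hw hw]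
  have h4 : 1 ≤ 4 / w.re := by rw [le_div_iff₀ hw]; linarith
  have hn : ‖cexp (-(π ^ 2 / w))‖ = Real.exp (-((π : ℂ) ^ 2 / w).re) := by
    rw [Complex.norm_exp, Complex.neg_re]
  refine (norm_oddProd_sub_one_le ?_).trans ?_
  · rw [hn]; exact Real.exp_le_exp.2 (by linarith)
  · rw [hn]
    refine le_trans ?_ (exp_neg_four_div_le hw)
    have := Real.exp_le_exp.2 (neg_le_neg hre)
    linarith

theorem norm_oddGen_real_le {z : ℝ} (hz : 0 < z) (hz1 : z ≤ 1) :
    ‖oddGen z‖ ≤ 2 * Real.exp (π ^ 2 / (24 * z)) := by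
  rw [oddGen_eq (by simpa using hz), norm_mul, Complex.norm_exp]
  have h1 := norm_majorErr_le (w := (z : ℂ)) (by simpa using hz) (by simpa using hz1)
    (by simpa using hz.le)
  simp only [Complex.ofReal_re] at h1
  have h2 : ‖1 + majorErr z‖ ≤ 2 := by
    refine (norm_add_le _ _).trans ?_
    have : z ^ 3 ≤ 1 := pow_le_one₀ hz.le hz1
    simp only [norm_one]; linarith
  have h3 : ((π : ℂ) ^ 2 / (24 * z) - z / 24).re = π ^ 2 / (24 * z) - z / 24 := by
    rw [show (π : ℂ) ^ 2 / (24 * z) - z / 24 = ((π ^ 2 / (24 * z) - z / 24 : ℝ) : ℂ) by push_cast; ring,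
      Complex.ofReal_re]
  rw [h3, mul_comm]
  exact mul_le_mul h2 (Real.exp_le_exp.2 (by linarith)) (Real.exp_pos _).le (by norm_num)

theorem norm_one_add_le {a : ℂ} (ha : ‖a‖ ≤ 1) :
    ‖1 + a‖ ≤ (1 + ‖a‖) * Real.exp (-((‖a‖ - a.re) / 4)) := by
  have h0 := norm_nonneg a
  have hre := Complex.re_le_norm a
  apply le_of_sq_le_sq _ (by positivity)
  rw [mul_pow, ← Real.exp_nat_mul, Complex.sq_norm, Complex.normSq_apply]
  have h1 : ‖a‖ ^ 2 = a.re * a.re + a.im * a.im := by rw [Complex.sq_norm, Complex.normSq_apply]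
  have h2 := Real.add_one_le_exp (((2 : ℕ) : ℝ) * -((‖a‖ - a.re) / 4))
  push_cast at h2 ⊢
  have h3 : (1 + ‖a‖) ^ 2 * (2 * -((‖a‖ - a.re) / 4) + 1)
      ≤ (1 + ‖a‖) ^ 2 * Real.exp (2 * -((‖a‖ - a.re) / 4)) :=
    mul_le_mul_of_nonneg_left h2 (by positivity)
  refine le_trans ?_ h3
  simp only [Complex.add_re, Complex.add_im, Complex.one_re, Complex.one_im]
  nlinarith [mul_nonneg (sub_nonneg.2 hre) (by nlinarith : 0 ≤ 4 - (1 + ‖a‖) ^ 2)]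

theorem norm_oddProd_le {q : ℂ} (hq : ‖q‖ < 1) :
    ‖oddProd q‖ ≤ ‖oddProd (‖q‖ : ℂ)‖
      * Real.exp (-((‖q‖ / (1 - ‖q‖ ^ 2) - (q / (1 - q ^ 2)).re) / 4)) := by
  have hr : ‖((‖q‖ : ℝ) : ℂ)‖ < 1 := by simpa using hq
  have h1 := (tendsto_oddProd hq 0).norm
  have h2 := (tendsto_oddProd hr 0).norm
  have h3 : Tendsto (fun K => ∑ d ∈ Finset.range (K + 0), (‖oddPow q d‖ - (oddPow q d).re)) atTop
      (nhds (‖q‖ / (1 - ‖q‖ ^ 2) - (q / (1 - q ^ 2)).re)) := by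
    have e1 : HasSum (fun d => ‖oddPow q d‖) (‖q‖ / (1 - ‖q‖ ^ 2)) := by
      have := Complex.hasSum_re (hasSum_oddPow hr)
      convert this using 1
      · funext d
        rw [norm_oddPow, oddPow, ← Complex.ofReal_pow, Complex.ofReal_re]
      · rw [← Complex.ofReal_one, ← Complex.ofReal_pow, ← Complex.ofReal_sub, ← Complex.ofReal_div,
          Complex.ofReal_re]
    exact ((e1.sub (Complex.hasSum_re (hasSum_oddPow hq))).tendsto_sum_nat)
  have h4 := h2.mul ((Real.continuous_exp.tendsto _).comp ((h3.div_const 4).neg))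
  refine le_of_tendsto_of_tendsto' h1 h4 fun K => ?_
  simp only [Function.comp]
  rw [norm_prod, norm_prod, Finset.sum_div, ← Finset.sum_neg_distrib, Real.exp_sum,
    ← Finset.prod_mul_distrib]
  refine Finset.prod_le_prod (fun _ _ => norm_nonneg _) fun d _ => ?_
  refine (norm_one_add_le (norm_oddPow_lt hq d).le).trans (le_of_eq ?_)
  congr 1
  rw [norm_oddPow, oddPow, ← Complex.ofReal_pow, ← Complex.ofReal_one, ← Complex.ofReal_add,
    Complex.norm_real, Real.norm_of_nonneg (by positivity)]

/-- Minor-arc bound. -/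
theorem norm_oddGen_le {z θ : ℝ} (hz : 0 < z) (hz1 : z ≤ 1) (h1 : z ≤ |θ|) (h2 : |θ| ≤ π) :
    ‖oddGen (z + θ * I)‖ ≤ 2 * Real.exp (π ^ 2 / (24 * z) - 1 / (888 * z)) := by
  set q := cexp (-(z + θ * I)) with hq
  have hr : ‖q‖ = Real.exp (-z) := by rw [hq, Complex.norm_exp]; simp
  have hq1 : ‖q‖ < 1 := by rw [hr]; simpa using hz
  have hqr : oddProd (‖q‖ : ℂ) = oddGen z := by
    rw [hr, oddGen]; push_cast; rfl
  refine (norm_oddProd_le hq1).trans ?_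
  rw [hqr, sub_eq_add_neg (π ^ 2 / (24 * z)), Real.exp_add, ← mul_assoc]
  refine mul_le_mul (norm_oddGen_real_le hz hz1) (Real.exp_le_exp.2 (neg_le_neg ?_))
    (Real.exp_pos _).le (by positivity)
  set r := ‖q‖ with hrdef
  have hr0 : 0 < r := by rw [hr]; exact Real.exp_pos _
  have hqre : q.re = r * Real.cos θ := by
    rw [hq, hr, Complex.exp_re]; simp
  have hqim : q.im = -(r * Real.sin θ) := by
    rw [hq, hr, Complex.exp_im]; simp
  have hsc := Real.sin_sq_add_cos_sq θ
  have hs1 : 0 < 1 - r ^ 2 := by nlinarith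
  set D := (1 - r ^ 2) ^ 2 + 4 * r ^ 2 * Real.sin θ ^ 2 with hD
  have hD0 : 0 < D := by positivity
  have hre : (q / (1 - q ^ 2)).re = r * (1 - r ^ 2) * Real.cos θ / D := by
    rw [Complex.div_re, Complex.normSq_apply]
    simp only [Complex.sub_re, Complex.sub_im, Complex.one_re, Complex.one_im, pow_two,
      Complex.mul_re, Complex.mul_im, hqre, hqim]
    have e1 : (1 - (r * Real.cos θ * (r * Real.cos θ) - -(r * Real.sin θ) * -(r * Real.sin θ)))
        * (1 - (r * Real.cos θ * (r * Real.cos θ) - -(r * Real.sin θ) * -(r * Real.sin θ)))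
        + (0 - (r * Real.cos θ * -(r * Real.sin θ) + -(r * Real.sin θ) * (r * Real.cos θ)))
        * (0 - (r * Real.cos θ * -(r * Real.sin θ) + -(r * Real.sin θ) * (r * Real.cos θ))) = D := by
      rw [hD]
      have : Real.cos θ ^ 2 = 1 - Real.sin θ ^ 2 := by linarith
      ring_nf
      rw [show Real.cos θ ^ 4 = (Real.cos θ ^ 2) ^ 2 by ring, this]
      ring
    rw [e1, ← add_div]
    congr 1
    have : Real.cos θ ^ 3 = Real.cos θ * (1 - Real.sin θ ^ 2) := by rw [← hsc]; ring
    ring_nf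
    rw [this]
    ring
  have hrlow : 1 / 3 < r := by
    rw [hr]
    have h5 : Real.exp (-1) ≤ Real.exp (-z) := Real.exp_le_exp.2 (by linarith)
    have := Real.exp_neg_one_gt_d9
    linarith
  have hrz : 1 - r ^ 2 ≤ 2 * z := by
    have := Real.add_one_le_exp (-(2 * z))
    rw [hr, ← Real.exp_nat_mul]
    push_cast
    rw [show 2 * -z = -(2 * z) by ring]
    linarith
  have hb : 1 / (6 * z) ≤ r / (1 - r ^ 2) := by
    rw [div_le_div_iff₀ (by positivity) hs1]
    nlinarith
  have hdiff : 1 / (222 * z) ≤ r / (1 - r ^ 2) - (q / (1 - q ^ 2)).re := by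
    rw [hre]
    by_cases hc : Real.cos θ ≤ 0
    · have : r * (1 - r ^ 2) * Real.cos θ / D ≤ 0 :=
        div_nonpos_of_nonpos_of_nonneg (mul_nonpos_of_nonneg_of_nonpos (by positivity) hc) hD0.le
      have h6 : 1 / (222 * z) ≤ 1 / (6 * z) :=
        one_div_le_one_div_of_le (by positivity) (by linarith)
      linarith
    · push Not at hc
      have hθ : |θ| ≤ π / 2 := by
        by_contra hcon
        push Not at hcon
        have := Real.cos_nonpos_of_pi_div_two_le_of_le hcon.le (by linarith [Real.pi_pos])
        rw [Real.cos_abs] at this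
        linarith
      have hsin : 2 / π * |θ| ≤ Real.sin |θ| := Real.mul_le_sin (abs_nonneg _) hθ
      have hsin2 : Real.sin |θ| ^ 2 = Real.sin θ ^ 2 := by
        rcases abs_choice θ with h | h <;> rw [h]
        rw [Real.sin_neg]; ring
      have h7 : 1 / 2 * z ≤ Real.sin |θ| := by
        refine le_trans (mul_le_mul ?_ h1 hz.le (by positivity)) hsin
        rw [div_le_div_iff₀ (by norm_num) Real.pi_pos]
        linarith [Real.pi_le_four]
      have h8 : z ^ 2 / 4 ≤ Real.sin θ ^ 2 := by rw [← hsin2]; nlinarith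
      have h9 : (1 - r ^ 2) ^ 2 ≤ 4 * z ^ 2 := by nlinarith
      have h10 : z ^ 2 / 9 ≤ 4 * r ^ 2 * Real.sin θ ^ 2 := by
        have : 1 / 9 ≤ r ^ 2 := by nlinarith
        nlinarith
      have hcos : Real.cos θ ≤ 1 := Real.cos_le_one θ
      have h11 : r * (1 - r ^ 2) * Real.cos θ / D ≤ r * (1 - r ^ 2) / D := by
        refine div_le_div_of_nonneg_right ?_ hD0.le
        exact mul_le_of_le_one_right (by positivity) hcos
      have h12 : r * (1 - r ^ 2) / D ≤ r / (1 - r ^ 2) * (36 / 37) := by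
        rw [div_mul_div_comm, div_le_div_iff₀ hD0 (by positivity)]
        have h13 : (1 - r ^ 2) ^ 2 * 37 ≤ 36 * D := by rw [hD]; linarith
        have := mul_le_mul_of_nonneg_left h13 hr0.le
        linarith
      have h14 : 1 / (222 * z) = 1 / (6 * z) * (1 / 37) := by field_simp; norm_num
      rw [h14]
      linarith
  rw [le_div_iff₀ (by norm_num)]
  refine le_trans (le_of_eq ?_) hdiff
  field_simp
  norm_num

section

variable {t : ℕ}

theorem continuousAt_etaRight {w : ℂ} (hw : 0 < w.re) : ContinuousAt etaRight w :=
  ContinuousAt.comp (g := ModularForm.eta) (f := fun w : ℂ => I * w / (2 * π))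
    (ModularForm.differentiableAt_eta_of_mem_upperHalfPlaneSet (mem_upperHalf hw)).continuousAt
    (by fun_prop)

theorem continuousAt_oddGen {w : ℂ} (hw : 0 < w.re) : ContinuousAt oddGen w := by
  have h2 : 0 < (2 * w).re := by simpa using hw
  have h4 : 0 < (4 * w).re := by simpa using hw
  have e : oddGen =ᶠ[nhds w] fun w =>
      etaRight (2 * w) ^ 2 / (cexp (w / 24) * (etaRight w * etaRight (4 * w))) := by
    filter_upwards [(isOpen_lt continuous_const Complex.continuous_re).mem_nhds hw] with v hv
    have hv' : 0 < v.re := hv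
    have hv4 : 0 < (4 * v).re := by simpa using hv'
    rw [eq_div_iff (mul_ne_zero (Complex.exp_ne_zero _)
      (mul_ne_zero (etaRight_ne_zero hv') (etaRight_ne_zero hv4))), ← oddGen_mul_etaRight hv']
    ring
  refine ContinuousAt.congr ?_ e.symm
  have c2 : ContinuousAt (fun w => etaRight (2 * w)) w :=
    ContinuousAt.comp (g := etaRight) (continuousAt_etaRight h2) (by fun_prop)
  have c4 : ContinuousAt (fun w => etaRight (4 * w)) w :=
    ContinuousAt.comp (g := etaRight) (continuousAt_etaRight h4) (by fun_prop)
  refine (c2.pow 2).div (ContinuousAt.mul (by fun_prop) ((continuousAt_etaRight hw).mul c4)) ?_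
  exact mul_ne_zero (Complex.exp_ne_zero _) (mul_ne_zero (etaRight_ne_zero hw) (etaRight_ne_zero h4))

theorem continuousAt_momFun {X : ℂ} (hX : ‖X‖ < 1) (j : ℕ) : ContinuousAt (momFun t j) X := by
  have n1 : 1 - X ^ 2 ≠ 0 := one_sub_ne_zero_of_norm (norm_pow_lt_of_pos hX (by omega))
  have n2 : 1 - X ^ 4 ≠ 0 := one_sub_ne_zero_of_norm (norm_pow_lt_of_pos hX (by omega))
  have n3 : 1 + X ≠ 0 := one_add_ne_zero_of_norm hX
  have n4 : 1 + X ^ 3 ≠ 0 := one_add_ne_zero_of_norm (norm_pow_lt_of_pos hX (by omega))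
  have hm : ContinuousAt (meanFun t) X := by
    unfold meanFun
    fun_prop (disch := first | assumption | exact pow_ne_zero _ n3)
  have hv : ContinuousAt (varFun t) X := by
    unfold varFun
    fun_prop (disch := first | assumption | exact mul_ne_zero (pow_ne_zero _ n3) n4)
  unfold momFun
  split_ifs
  · exact continuousAt_const
  · exact hm
  · exact (hm.pow 2).add hv

theorem norm_exp_neg_pow_lt (ht : 1 ≤ t) {w : ℂ} (hw : 0 < w.re) : ‖cexp (-w) ^ t‖ < 1 :=
  norm_pow_lt_of_pos (norm_exp_neg_lt hw) ht

theorem continuousAt_momFun_exp (ht : 1 ≤ t) {w : ℂ} (hw : 0 < w.re) (j : ℕ) :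
    ContinuousAt (fun w => momFun t j (cexp (-w) ^ t)) w :=
  ContinuousAt.comp (g := momFun t j) (continuousAt_momFun (norm_exp_neg_pow_lt ht hw) j)
    (by fun_prop)

theorem norm_delta_le (t : ℕ) : ‖(delta t : ℂ)‖ ≤ 1 := by
  unfold delta; split_ifs <;> simp

theorem norm_momFun_le {X : ℂ} (hX : ‖X‖ < 1) (j : ℕ) :
    ‖momFun t j X‖ ≤ ((t + 1) ^ 2 + (2 * t + 6)) / (1 - ‖X‖) ^ 4 := by
  set d := 1 - ‖X‖ with hd
  have hx0 := norm_nonneg X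
  have hd0 : 0 < d := by linarith
  have hd1 : d ≤ 1 := by linarith
  have hpow : ∀ k : ℕ, 1 ≤ k → ‖X ^ k‖ ≤ ‖X‖ := fun k hk => by
    rw [norm_pow]; exact pow_le_of_le_one hx0 hX.le (by omega)
  have hsub : ∀ k : ℕ, 1 ≤ k → d ≤ ‖1 - X ^ k‖ := fun k hk => by
    have := norm_sub_norm_le (1 : ℂ) (X ^ k)
    rw [norm_one] at this
    linarith [hpow k hk]
  have hadd : ∀ k : ℕ, 1 ≤ k → d ≤ ‖1 + X ^ k‖ := fun k hk => by
    have := norm_sub_norm_le (1 : ℂ) (-X ^ k)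
    rw [norm_one, norm_neg, sub_neg_eq_add] at this
    linarith [hpow k hk]
  have hle : ∀ k : ℕ, ‖X‖ ^ k ≤ 1 := fun k => pow_le_one₀ hx0 hX.le
  have hδ := norm_delta_le t
  have hadd1 : d ≤ ‖1 + X‖ := by simpa using hadd 1 le_rfl
  have hm : ‖meanFun t X‖ ≤ (t + 1) / d ^ 2 := by
    have a1 : ‖(t : ℂ) * (X ^ 2 / (1 - X ^ 2))‖ ≤ t * (1 / d ^ 2) := by
      rw [norm_mul, Complex.norm_natCast, norm_div, norm_pow]
      refine mul_le_mul_of_nonneg_left (div_le_div₀ zero_le_one (hle 2) (by positivity) ?_)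
        (by positivity)
      exact (by nlinarith : d ^ 2 ≤ d).trans (hsub 2 (by omega))
    have a2 : ‖(delta t : ℂ) * (X / (1 + X) ^ 2)‖ ≤ 1 * (1 / d ^ 2) := by
      rw [norm_mul, norm_div, norm_pow]
      refine mul_le_mul hδ (div_le_div₀ zero_le_one hX.le (by positivity) ?_)
        (by positivity) zero_le_one
      exact pow_le_pow_left₀ hd0.le hadd1 2
    refine (norm_add_le _ _).trans ((add_le_add a1 a2).trans (le_of_eq ?_))
    ring
  have hv : ‖varFun t X‖ ≤ (2 * t + 6) / d ^ 4 := by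
    have a1 : ‖(t : ℂ) * (2 * X ^ 2 / (1 - X ^ 4))‖ ≤ t * (2 / d ^ 4) := by
      rw [norm_mul, Complex.norm_natCast, norm_div, norm_mul, norm_pow, Complex.norm_ofNat]
      refine mul_le_mul_of_nonneg_left (div_le_div₀ (by norm_num) (by linarith [hle 2])
        (by positivity) ?_) (by positivity)
      exact (pow_le_of_le_one hd0.le hd1 (by norm_num)).trans (hsub 4 (by omega))
    have a2 : ‖(delta t : ℂ) * (X * (1 - X - 2 * X ^ 2 - X ^ 3 + X ^ 4)
        / ((1 + X) ^ 3 * (1 + X ^ 3)))‖ ≤ 1 * (6 / d ^ 4) := by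
      rw [norm_mul, norm_div, norm_mul, norm_mul, norm_pow]
      have hp : ‖1 - X - 2 * X ^ 2 - X ^ 3 + X ^ 4‖ ≤ 6 := by
        have b1 := norm_add_le (1 - X - 2 * X ^ 2 - X ^ 3) (X ^ 4)
        have b2 := norm_sub_le (1 - X - 2 * X ^ 2) (X ^ 3)
        have b3 := norm_sub_le (1 - X) (2 * X ^ 2)
        have b4 := norm_sub_le 1 X
        simp only [norm_mul, norm_pow, norm_one, Complex.norm_ofNat] at b1 b2 b3 b4
        linarith [hle 2, hle 3, hle 4]
      refine mul_le_mul hδ (div_le_div₀ (by norm_num) ?_ (by positivity) ?_)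
        (by positivity) zero_le_one
      · calc _ ≤ 1 * (6 : ℝ) := mul_le_mul hX.le hp (norm_nonneg _) zero_le_one
          _ = 6 := one_mul _
      · rw [show d ^ 4 = d ^ 3 * d by ring]
        exact mul_le_mul (pow_le_pow_left₀ hd0.le hadd1 3) (hadd 3 (by omega)) hd0.le
          (by positivity)
    refine (norm_add_le _ _).trans ((add_le_add a1 a2).trans (le_of_eq ?_))
    ring
  have hd4 : d ^ 4 ≤ 1 := pow_le_one₀ hd0.le hd1
  have hd4p : 0 < d ^ 4 := by positivity
  have ht0 : (0 : ℝ) ≤ t := Nat.cast_nonneg t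
  unfold momFun
  split_ifs
  · rw [norm_one, le_div_iff₀ hd4p]; nlinarith
  · refine hm.trans ?_
    rw [div_le_div_iff₀ (by positivity) hd4p]
    have : d ^ 4 ≤ d ^ 2 := pow_le_pow_of_le_one hd0.le hd1 (by norm_num)
    refine mul_le_mul ?_ this hd4p.le (by positivity)
    nlinarith
  · refine (norm_add_le _ _).trans ?_
    rw [norm_pow, add_div]
    refine add_le_add ?_ hv
    calc _ ≤ ((t + 1) / d ^ 2) ^ 2 := pow_le_pow_left₀ (norm_nonneg _) hm 2
      _ = _ := by rw [div_pow, ← pow_mul]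

theorem norm_momFun_exp_le (ht : 1 ≤ t) (j : ℕ) {z : ℝ} (hz : 0 < z) (hz1 : z ≤ 1) (θ : ℝ) :
    ‖momFun t j (cexp (-(z + θ * I)) ^ t)‖ ≤ 16 * ((t + 1) ^ 2 + (2 * t + 6)) / z ^ 4 := by
  have hw : 0 < ((z : ℂ) + θ * I).re := by simpa using hz
  refine (norm_momFun_le (norm_exp_neg_pow_lt ht hw) j).trans ?_
  have hr : ‖cexp (-(z + θ * I))‖ = Real.exp (-z) := by rw [Complex.norm_exp]; simp
  have h1 : z / 2 ≤ 1 - ‖cexp (-(z + θ * I)) ^ t‖ := by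
    have h2 : ‖cexp (-(z + θ * I)) ^ t‖ ≤ ‖cexp (-(z + θ * I))‖ := by
      rw [norm_pow]; exact pow_le_of_le_one (norm_nonneg _) (norm_exp_neg_lt hw).le (by omega)
    have h3 : Real.exp (-z) ≤ 1 - z / 2 := by
      have h4 := Real.add_one_le_exp z
      rw [Real.exp_neg, inv_le_comm₀ (Real.exp_pos _) (by linarith)]
      refine le_trans ?_ h4
      rw [inv_le_iff_one_le_mul₀ (by linarith)]
      nlinarith
    linarith
  have h2 : (z / 2) ^ 4 ≤ (1 - ‖cexp (-(z + θ * I)) ^ t‖) ^ 4 :=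
    pow_le_pow_left₀ (by positivity) h1 4
  calc _ ≤ (((t : ℝ) + 1) ^ 2 + (2 * t + 6)) / (z / 2) ^ 4 :=
        div_le_div_of_nonneg_left (by positivity) (by positivity) h2
    _ = _ := by rw [div_pow]; field_simp; norm_num

end

section

variable {t : ℕ}

/-- The Bose function `1 / (exp x - 1)`. -/
noncomputable def bose (x : ℂ) : ℂ := 1 / (cexp x - 1)

theorem eventually_norm_lt {r : ℝ} (hr : 0 < r) : ∀ᶠ x : ℂ in nhdsWithin 0 {0}ᶜ, ‖x‖ < r := by
  filter_upwards [nhdsWithin_le_nhds (Metric.ball_mem_nhds (0 : ℂ) hr)] with x hx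
  simpa using hx

theorem isBigO_exp_taylor (n : ℕ) :
    (fun x : ℂ => cexp x - ∑ m ∈ Finset.range n, x ^ m / m.factorial) =O[nhdsWithin 0 {0}ᶜ]
      fun x => x ^ n := by
  refine IsBigO.of_bound (Real.exp 1) ?_
  filter_upwards [eventually_norm_lt one_pos] with x hx
  refine (Complex.norm_exp_sub_sum_le_norm_mul_exp x n).trans ?_
  rw [norm_pow, mul_comm]
  exact mul_le_mul_of_nonneg_right (Real.exp_le_exp.2 hx.le) (by positivity)

theorem isBigO_bose_id : bose =O[nhdsWithin 0 {0}ᶜ] fun x => x⁻¹ := by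
  have h : (fun x : ℂ => x) =O[nhdsWithin 0 {0}ᶜ] fun x => cexp x - 1 := by
    refine IsBigO.of_bound 2 ?_
    filter_upwards [eventually_norm_lt (half_pos one_pos)] with x hx
    have h1 := Complex.norm_exp_sub_one_sub_id_le (x := x) (by linarith)
    have h2 := norm_sub_norm_le x (x - (cexp x - 1))
    rw [sub_sub_cancel, ← norm_neg (x - _), neg_sub] at h2
    nlinarith [norm_nonneg x]
  have := h.inv_rev (by
    filter_upwards [self_mem_nhdsWithin] with x hx h0
    exact absurd h0 hx)
  refine this.congr (fun x => ?_) fun x => rfl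
  rw [bose, one_div]

theorem eventually_exp_sub_one_ne_zero : ∀ᶠ x : ℂ in nhdsWithin 0 {0}ᶜ, cexp x - 1 ≠ 0 := by
  filter_upwards [eventually_norm_lt (half_pos one_pos), self_mem_nhdsWithin] with x hx hx0 h0
  have h1 := Complex.norm_exp_sub_one_sub_id_le (x := x) (by linarith)
  rw [h0, zero_sub, norm_neg] at h1
  have : 0 < ‖x‖ := norm_pos_iff.2 hx0
  nlinarith

theorem bose_expansion : (fun x => bose x - (1 / x - 1 / 2 + x / 12)) =O[nhdsWithin 0 {0}ᶜ]
    fun x => x ^ 2 := by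
  have h1 : (fun x : ℂ => x ^ 4 * (1 / 2 - x / 6)
      - (cexp x - ∑ m ∈ Finset.range 4, x ^ m / m.factorial) * (12 - 6 * x + x ^ 2))
      =O[nhdsWithin 0 {0}ᶜ] fun x => x ^ 4 := by
    have c1 : (fun x : ℂ => 1 / 2 - x / 6) =O[nhdsWithin 0 {0}ᶜ] fun _ => (1 : ℂ) :=
      ((Continuous.tendsto (by fun_prop) 0).mono_left nhdsWithin_le_nhds).isBigO_one ℂ
    have c2 : (fun x : ℂ => 12 - 6 * x + x ^ 2) =O[nhdsWithin 0 {0}ᶜ] fun _ => (1 : ℂ) :=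
      ((Continuous.tendsto (by fun_prop) 0).mono_left nhdsWithin_le_nhds).isBigO_one ℂ
    have := ((isBigO_refl (fun x : ℂ => x ^ 4) _).mul c1).sub ((isBigO_exp_taylor 4).mul c2)
    simpa using this
  have h2 := (h1.mul (isBigO_bose_id.mul (isBigO_refl (fun x : ℂ => x⁻¹) _))).const_mul_left (1 / 12)
  refine h2.congr' ?_ ?_
  · filter_upwards [self_mem_nhdsWithin, eventually_exp_sub_one_ne_zero] with x hx he
    have hx' : x ≠ 0 := hx
    simp only [Finset.sum_range_succ, Finset.sum_range_zero, Nat.factorial, bose]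
    push_cast
    field_simp
    ring
  · filter_upwards [self_mem_nhdsWithin] with x hx
    have hx' : x ≠ 0 := hx
    field_simp

theorem tendsto_const_mul_punctured {c : ℂ} (hc : c ≠ 0) :
    Tendsto (fun w : ℂ => c * w) (nhdsWithin 0 {0}ᶜ) (nhdsWithin 0 {0}ᶜ) := by
  refine tendsto_nhdsWithin_iff.2 ⟨?_, ?_⟩
  · have : Tendsto (fun w : ℂ => c * w) (nhds 0) (nhds (c * 0)) := Continuous.tendsto (by fun_prop) 0
    rw [mul_zero] at this
    exact this.mono_left nhdsWithin_le_nhds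
  · filter_upwards [self_mem_nhdsWithin] with w hw
    exact mul_ne_zero hc hw

theorem bose_scaled_expansion {c : ℂ} (hc : c ≠ 0) :
    (fun w => bose (c * w) - (1 / (c * w) - 1 / 2 + c * w / 12)) =O[nhdsWithin 0 {0}ᶜ]
      fun w => w ^ 2 := by
  have h := bose_expansion.comp_tendsto (tendsto_const_mul_punctured hc)
  refine h.trans ?_
  simp only [Function.comp_def, mul_pow]
  exact (isBigO_refl _ _).const_mul_left _

theorem exp_neg_pow_eq (t k : ℕ) (w : ℂ) : (cexp (-w) ^ t) ^ k = (cexp (k * t * w))⁻¹ := by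
  rw [← pow_mul, ← Complex.exp_nat_mul, ← Complex.exp_neg]
  congr 1; push_cast; ring

theorem meanFun_exp (t : ℕ) (w : ℂ) : meanFun t (cexp (-w) ^ t) = t * bose (2 * t * w)
    + delta t * (cexp (-w) ^ t / (1 + cexp (-w) ^ t) ^ 2) := by
  rw [meanFun, exp_neg_pow_eq, bose]
  congr 2
  push_cast
  have h := Complex.exp_ne_zero (2 * t * w)
  generalize cexp (2 * t * w) = e at *
  by_cases h1 : e - 1 = 0
  · have : e = 1 := by linear_combination h1
    subst this; simp
  · have h2 : 1 - e⁻¹ ≠ 0 := by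
      intro h3; apply h1; field_simp at h3; linear_combination h3
    rw [div_eq_div_iff h2 h1]
    field_simp

theorem meanFun_expansion (ht : 1 ≤ t) :
    (fun w => momFun t 1 (cexp (-w) ^ t)
      - (1 / (2 * w) + (-t / 2 + delta t / 4) + t ^ 2 / 6 * w)) =O[nhdsWithin 0 {0}ᶜ]
      fun w => w ^ 2 := by
  have ht0 : (t : ℂ) ≠ 0 := by exact_mod_cast (by omega : t ≠ 0)
  have h1 := (bose_scaled_expansion (c := 2 * t) (mul_ne_zero two_ne_zero ht0)).const_mul_left (t : ℂ)
  have h2 : (fun w : ℂ => delta t * ((1 - cexp (-w) ^ t) ^ 2 * (-1 / (4 * (1 + cexp (-w) ^ t) ^ 2))))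
      =O[nhdsWithin 0 {0}ᶜ] fun w => w ^ 2 := by
    have d1 : DifferentiableAt ℂ (fun w : ℂ => 1 - cexp (-w) ^ t) 0 := by fun_prop
    have b1 : (fun w : ℂ => 1 - cexp (-w) ^ t) =O[nhdsWithin 0 {0}ᶜ] fun w => w := by
      simpa using d1.isBigO_sub.mono nhdsWithin_le_nhds
    have b2 : (fun w : ℂ => -1 / (4 * (1 + cexp (-w) ^ t) ^ 2)) =O[nhdsWithin 0 {0}ᶜ]
        fun _ => (1 : ℂ) := by
      refine (Tendsto.mono_left (ContinuousAt.tendsto ?_) nhdsWithin_le_nhds).isBigO_one ℂ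
      have : 4 * (1 + cexp (-0) ^ t) ^ 2 ≠ 0 := by norm_num
      fun_prop (disch := assumption)
    simpa using ((b1.pow 2).mul b2).const_mul_left (delta t : ℂ)
  refine (h1.add h2).congr' ?_ EventuallyEq.rfl
  have hne : ∀ᶠ w : ℂ in nhdsWithin 0 {0}ᶜ, 1 + cexp (-w) ^ t ≠ 0 := by
    have : ContinuousAt (fun w : ℂ => 1 + cexp (-w) ^ t) 0 := by fun_prop
    exact nhdsWithin_le_nhds (this.eventually_ne (by norm_num))
  filter_upwards [self_mem_nhdsWithin, hne] with w hw hX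
  have hw' : w ≠ 0 := hw
  rw [momFun, if_neg one_ne_zero, if_pos rfl, meanFun_exp]
  generalize cexp (-w) ^ t = X at *
  generalize bose (2 * t * w) = b
  field_simp
  ring

theorem varFun_expansion (ht : 1 ≤ t) :
    (fun w => varFun t (cexp (-w) ^ t) - (1 / (2 * w) - delta t / 8)) =O[nhdsWithin 0 {0}ᶜ]
      fun w => w := by
  have ht0 : (t : ℂ) ≠ 0 := by exact_mod_cast (by omega : t ≠ 0)
  have hsq : (fun w : ℂ => w ^ 2) =O[nhdsWithin 0 {0}ᶜ] fun w => w := by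
    have c1 : (fun x : ℂ => x) =O[nhdsWithin 0 {0}ᶜ] fun _ => (1 : ℂ) :=
      ((Continuous.tendsto (by fun_prop) 0).mono_left nhdsWithin_le_nhds).isBigO_one ℂ
    simpa [pow_two] using c1.mul (isBigO_refl (fun x : ℂ => x) _)
  have h1 := ((bose_scaled_expansion (c := 2 * t) (mul_ne_zero two_ne_zero ht0)).const_mul_left
    (2 * t : ℂ)).trans hsq
  have h2 := ((bose_scaled_expansion (c := 4 * t) (mul_ne_zero (by norm_num : (4 : ℂ) ≠ 0) ht0)).const_mul_left
    (2 * t : ℂ)).trans hsq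
  have h3 : (fun w : ℂ => -(t ^ 2 / 3) * w) =O[nhdsWithin 0 {0}ᶜ] fun w => w :=
    (isBigO_refl _ _).const_mul_left _
  have h4 : (fun w : ℂ => delta t * ((cexp (-w) ^ t * (1 - cexp (-w) ^ t - 2 * (cexp (-w) ^ t) ^ 2
      - (cexp (-w) ^ t) ^ 3 + (cexp (-w) ^ t) ^ 4)
      / ((1 + cexp (-w) ^ t) ^ 3 * (1 + (cexp (-w) ^ t) ^ 3))) + 1 / 8))
      =O[nhdsWithin 0 {0}ᶜ] fun w => w := by
    have hne : (1 + cexp (-0) ^ t) ^ 3 * (1 + (cexp (-0) ^ t) ^ 3) ≠ 0 := by norm_num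
    have d1 : DifferentiableAt ℂ (fun w : ℂ => (cexp (-w) ^ t * (1 - cexp (-w) ^ t
      - 2 * (cexp (-w) ^ t) ^ 2 - (cexp (-w) ^ t) ^ 3 + (cexp (-w) ^ t) ^ 4)
      / ((1 + cexp (-w) ^ t) ^ 3 * (1 + (cexp (-w) ^ t) ^ 3)))) 0 := by
      fun_prop (disch := assumption)
    have := (d1.isBigO_sub.mono (nhdsWithin_le_nhds (s := {0}ᶜ))).const_mul_left (delta t : ℂ)
    refine this.congr (fun w => ?_) (fun w => by simp)
    norm_num
  refine (((h1.sub h2).add h3).add h4).congr' ?_ EventuallyEq.rfl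
  have e2 : ∀ᶠ w : ℂ in nhdsWithin 0 {0}ᶜ, cexp (4 * t * w) - 1 ≠ 0 :=
    (tendsto_const_mul_punctured (mul_ne_zero (by norm_num : (4 : ℂ) ≠ 0) ht0)).eventually
      eventually_exp_sub_one_ne_zero
  filter_upwards [self_mem_nhdsWithin, e2] with w hw hX
  have hw' : w ≠ 0 := hw
  have hbose : 2 * (cexp (-w) ^ t) ^ 2 / (1 - (cexp (-w) ^ t) ^ 4)
      = 2 * bose (2 * t * w) - 2 * bose (4 * t * w) := by
    rw [exp_neg_pow_eq, exp_neg_pow_eq, bose, bose]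
    push_cast
    have he4 : cexp (4 * t * w) = cexp (2 * t * w) ^ 2 := by
      rw [← Complex.exp_nat_mul]; congr 1; push_cast; ring
    rw [he4] at hX ⊢
    have h := Complex.exp_ne_zero (2 * t * w)
    generalize cexp (2 * t * w) = e at hX h ⊢
    have hm : e - 1 ≠ 0 := by
      intro h0; apply hX; linear_combination (e + 1) * h0
    have hp : 1 + e ≠ 0 := by
      intro h0; apply hX; linear_combination (e - 1) * h0
    have hfac : e ^ 2 - 1 = (e - 1) * (1 + e) := by ring
    have hfac2 : 1 - (e ^ 2)⁻¹ = (e - 1) * (1 + e) / e ^ 2 := by field_simp; ring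
    rw [hfac, hfac2]
    field_simp
    ring
  rw [varFun, hbose]
  generalize cexp (-w) ^ t = X at *
  generalize bose (2 * t * w) = b
  generalize bose (4 * t * w) = b'
  generalize X * (1 - X - 2 * X ^ 2 - X ^ 3 + X ^ 4) / ((1 + X) ^ 3 * (1 + X ^ 3)) = Q
  field_simp
  ring

theorem secondMoment_expansion (ht : 1 ≤ t) :
    (fun w => momFun t 2 (cexp (-w) ^ t)
      - (1 / (4 * w ^ 2) + ((-t / 2 + delta t / 4) + 1 / 2) / w
        + ((-t / 2 + delta t / 4) ^ 2 + t ^ 2 / 6 - delta t / 8))) =O[nhdsWithin 0 {0}ᶜ]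
      fun w => w := by
  have hm := meanFun_expansion ht
  have hv := varFun_expansion ht
  set a : ℂ := -t / 2 + delta t / 4 with ha
  set b : ℂ := t ^ 2 / 6 with hb
  have cO : ∀ f : ℂ → ℂ, Continuous f → f =O[nhdsWithin 0 {0}ᶜ] fun _ => (1 : ℂ) := fun f hf =>
    ((hf.tendsto 0).mono_left nhdsWithin_le_nhds).isBigO_one ℂ
  have idO : (fun w : ℂ => w) =O[nhdsWithin 0 {0}ᶜ] fun w => w := isBigO_refl _ _
  have h1 : (fun w => (momFun t 1 (cexp (-w) ^ t) - (1 / (2 * w) + a + b * w)) ^ 2)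
      =O[nhdsWithin 0 {0}ᶜ] fun w => w := by
    refine (hm.pow 2).trans ?_
    refine ((cO (fun w => w ^ 3) (by fun_prop)).mul idO).congr (fun w => ?_) (fun w => ?_) <;> ring
  have h2 : (fun w => (momFun t 1 (cexp (-w) ^ t) - (1 / (2 * w) + a + b * w))
      * (2 * (1 / (2 * w) + a + b * w))) =O[nhdsWithin 0 {0}ᶜ] fun w => w := by
    have h3 : (fun w : ℂ => w ^ 2 * (2 * (1 / (2 * w) + a + b * w))) =O[nhdsWithin 0 {0}ᶜ]
        fun w => w := by
      refine ((cO (fun w => 1 + 2 * a * w + 2 * b * w ^ 2) (by fun_prop)).mul idO).congr' ?_ ?_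
      · filter_upwards [self_mem_nhdsWithin] with w hw
        have hw' : w ≠ 0 := hw
        field_simp
      · exact Eventually.of_forall fun w => one_mul w
    exact (hm.mul (isBigO_refl _ _)).trans h3
  have h4 := (cO (fun w => 2 * a * b + b ^ 2 * w) (by fun_prop)).mul idO
  simp only [one_mul] at h4
  refine (((h1.add h2).add h4).add hv).congr' ?_ EventuallyEq.rfl
  filter_upwards [self_mem_nhdsWithin] with w hw
  have hw' : w ≠ 0 := hw
  simp only [momFun]
  norm_num
  generalize meanFun t (cexp (-w) ^ t) = M
  generalize varFun t (cexp (-w) ^ t) = V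
  field_simp
  ring

end

/-- The saddle-point kernel on the major arc. -/
noncomputable def kern (Y u : ℝ) : ℂ := cexp (-(Y * u ^ 2) / (1 + u * I))

noncomputable def kint (k : ℤ) (Y : ℝ) : ℂ := ∫ u in (-1 : ℝ)..1, (1 + u * I) ^ k * kern Y u

theorem one_add_mul_I_ne_zero (u : ℝ) : (1 : ℂ) + u * I ≠ 0 := by
  intro h
  have := congrArg Complex.re h
  simp at this

theorem continuous_kern (Y : ℝ) : Continuous (kern Y) := by
  unfold kern
  exact Continuous.cexp (Continuous.div (by fun_prop) (by fun_prop) one_add_mul_I_ne_zero)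

theorem continuous_zpow_mul_kern (k : ℤ) (Y : ℝ) :
    Continuous fun u : ℝ => (1 + u * I : ℂ) ^ k * kern Y u :=
  (Continuous.zpow₀ (by fun_prop) k fun u => Or.inl (one_add_mul_I_ne_zero u)).mul
    (continuous_kern Y)

theorem neg_div_one_add_eq (Y u : ℝ) : (-(Y * u ^ 2) / (1 + u * I) : ℂ)
    = ((-(Y * u ^ 2 / (1 + u ^ 2)) : ℝ) : ℂ) + ((Y * u ^ 3 / (1 + u ^ 2) : ℝ) : ℂ) * I := by
  have h : (1 : ℂ) + (u : ℂ) ^ 2 ≠ 0 := by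
    exact_mod_cast (by positivity : (1 : ℝ) + u ^ 2 ≠ 0)
  rw [div_eq_iff (one_add_mul_I_ne_zero u)]
  push_cast
  field_simp
  linear_combination (-(Y : ℂ) * u ^ 4) * I_sq

theorem norm_kern (Y u : ℝ) : ‖kern Y u‖ = Real.exp (-(Y * u ^ 2 / (1 + u ^ 2))) := by
  rw [kern, neg_div_one_add_eq, Complex.norm_exp, Complex.add_re, Complex.ofReal_re,
    Complex.re_ofReal_mul, I_re, mul_zero, add_zero]

theorem norm_kern_le {Y u : ℝ} (hY : 0 ≤ Y) (hu : |u| ≤ 1) :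
    ‖kern Y u‖ ≤ Real.exp (-(Y * u ^ 2 / 2)) := by
  rw [norm_kern]
  have hu2 : u ^ 2 ≤ 1 := by rw [← sq_abs]; exact pow_le_one₀ (abs_nonneg u) hu
  exact Real.exp_le_exp.2 (neg_le_neg
    (div_le_div_of_nonneg_left (by positivity) (by positivity) (by linarith)))

theorem re_kern_ge {Y u : ℝ} (hY : 0 ≤ Y) (hu : |u| ≤ 1) :
    Real.exp (-(Y * u ^ 2)) - Y ^ 2 * u ^ 6 / 2 * Real.exp (-(Y * u ^ 2 / 2)) ≤ (kern Y u).re := by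
  have hn := norm_kern_le hY hu
  rw [norm_kern] at hn
  rw [kern, neg_div_one_add_eq, Complex.exp_re]
  simp only [Complex.add_re, Complex.add_im, Complex.ofReal_re, Complex.ofReal_im, Complex.mul_re,
    Complex.mul_im, I_re, I_im, mul_zero, mul_one, sub_zero, add_zero, zero_add]
  have h1 : Real.exp (-(Y * u ^ 2)) ≤ Real.exp (-(Y * u ^ 2 / (1 + u ^ 2))) :=
    Real.exp_le_exp.2 (neg_le_neg (div_le_self (by positivity) (by nlinarith [sq_nonneg u])))
  have h2 := Real.one_sub_sq_div_two_le_cos (x := Y * u ^ 3 / (1 + u ^ 2))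
  have h3 : (Y * u ^ 3 / (1 + u ^ 2)) ^ 2 ≤ Y ^ 2 * u ^ 6 := by
    rw [div_pow, mul_pow, ← pow_mul]
    refine div_le_self ?_ (one_le_pow₀ (by nlinarith [sq_nonneg u]))
    rw [show u ^ (3 * 2) = (u ^ 3) ^ 2 by ring]
    positivity
  have h4 : 0 ≤ Y ^ 2 * u ^ 6 := by
    rw [show u ^ 6 = (u ^ 3) ^ 2 by ring]; positivity
  set e := Real.exp (-(Y * u ^ 2 / (1 + u ^ 2))) with he
  have he0 : 0 < e := Real.exp_pos _
  have h5 : e * (1 - Y ^ 2 * u ^ 6 / 2) ≤ e * Real.cos (Y * u ^ 3 / (1 + u ^ 2)) :=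
    mul_le_mul_of_nonneg_left (by linarith) he0.le
  have h6 : Y ^ 2 * u ^ 6 / 2 * e ≤ Y ^ 2 * u ^ 6 / 2 * Real.exp (-(Y * u ^ 2 / 2)) :=
    mul_le_mul_of_nonneg_left hn (by linarith)
  linarith

theorem sq_cubed_mul_exp_le {Y : ℝ} (hY : 0 < Y) (u : ℝ) :
    u ^ 6 * Real.exp (-(Y * u ^ 2 / 2)) ≤ 384 / Y ^ 3 * Real.exp (-(Y / 4) * u ^ 2) := by
  have h1 := Real.pow_div_factorial_le_exp (Y * u ^ 2 / 4) (by positivity) 3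
  have h2 : u ^ 6 ≤ 384 / Y ^ 3 * Real.exp (Y * u ^ 2 / 4) := by
    rw [div_mul_eq_mul_div, le_div_iff₀ (by positivity)]
    norm_num [Nat.factorial] at h1
    have : (Y * u ^ 2 / 4) ^ 3 = u ^ 6 * Y ^ 3 / 64 := by ring
    linarith
  calc u ^ 6 * Real.exp (-(Y * u ^ 2 / 2))
      ≤ 384 / Y ^ 3 * Real.exp (Y * u ^ 2 / 4) * Real.exp (-(Y * u ^ 2 / 2)) :=
        mul_le_mul_of_nonneg_right h2 (Real.exp_pos _).le
    _ = _ := by rw [mul_assoc, ← Real.exp_add]; ring_nf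

theorem integral_gaussian_le {b : ℝ} (hb : 0 < b) :
    ∫ u in (-1 : ℝ)..1, Real.exp (-b * u ^ 2) ≤ √(π / b) := by
  rw [← integral_gaussian, intervalIntegral.integral_of_le (by norm_num)]
  exact MeasureTheory.setIntegral_le_integral (integrable_exp_neg_mul_sq hb)
    (Eventually.of_forall fun u => (Real.exp_pos _).le)

theorem sqrt_pi_div_le {Y : ℝ} (hY : 0 < Y) : √(π / (Y / 4)) ≤ 4 * (√Y)⁻¹ := by
  rw [Real.sqrt_le_left (by positivity), mul_pow, inv_pow, Real.sq_sqrt hY.le]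
  rw [div_le_iff₀ (by positivity)]
  field_simp
  linarith [Real.pi_le_four]

/-- The `L¹` norm of the kernel. -/
noncomputable def kernNorm (Y : ℝ) : ℝ := ∫ u in (-1 : ℝ)..1, ‖kern Y u‖

theorem kernNorm_le {Y : ℝ} (hY : 0 < Y) : kernNorm Y ≤ 4 * (√Y)⁻¹ := by
  refine le_trans ?_ ((integral_gaussian_le (b := Y / 4) (by positivity)).trans (sqrt_pi_div_le hY))
  refine intervalIntegral.integral_mono_on (by norm_num)
    ((continuous_kern Y).norm.intervalIntegrable _ _)
    (Continuous.intervalIntegrable (by fun_prop) _ _) fun u hu => ?_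
  refine (norm_kern_le hY.le (abs_le.2 hu)).trans (Real.exp_le_exp.2 ?_)
  nlinarith [mul_nonneg hY.le (sq_nonneg u)]

theorem integral_gaussian_ge {Y : ℝ} (hY : 1 ≤ Y) :
    (1 / 2) * (√Y)⁻¹ ≤ ∫ u in (-1 : ℝ)..1, Real.exp (-(Y * u ^ 2)) := by
  have hs : 0 < √Y := Real.sqrt_pos.2 (by linarith)
  have hs1 : (√Y)⁻¹ ≤ 1 := inv_le_one_of_one_le₀ (Real.one_le_sqrt.2 hY)
  have hs0 : 0 < (√Y)⁻¹ := by positivity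
  have h1 : ∫ u in (-(√Y)⁻¹)..(√Y)⁻¹, Real.exp (-(Y * u ^ 2))
      ≤ ∫ u in (-1 : ℝ)..1, Real.exp (-(Y * u ^ 2)) :=
    intervalIntegral.integral_mono_interval (by linarith) (by linarith) hs1
      (Eventually.of_forall fun u => (Real.exp_pos _).le)
      (Continuous.intervalIntegrable (by fun_prop) _ _)
  have h2 : ∫ u in (-(√Y)⁻¹)..(√Y)⁻¹, Real.exp (-1)
      ≤ ∫ u in (-(√Y)⁻¹)..(√Y)⁻¹, Real.exp (-(Y * u ^ 2)) := by
    refine intervalIntegral.integral_mono_on (by linarith) (by simp)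
      (Continuous.intervalIntegrable (by fun_prop) _ _) fun u hu => Real.exp_le_exp.2 ?_
    have : u ^ 2 ≤ ((√Y)⁻¹) ^ 2 := sq_le_sq' hu.1 hu.2
    rw [inv_pow, Real.sq_sqrt (by linarith)] at this
    have h3 := mul_le_mul_of_nonneg_left this (by linarith : 0 ≤ Y)
    rw [mul_inv_cancel₀ (by linarith)] at h3
    linarith
  rw [intervalIntegral.integral_const, smul_eq_mul] at h2
  have := Real.exp_neg_one_gt_d9
  nlinarith

theorem norm_kint_zero_ge {Y : ℝ} (hY : 1 ≤ Y) :
    (1 / 2 - 768 / Y) * (√Y)⁻¹ ≤ ‖kint 0 Y‖ := by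
  have hY0 : 0 < Y := by linarith
  refine le_trans ?_ (Complex.re_le_norm _)
  have hre : (kint 0 Y).re = ∫ u in (-1 : ℝ)..1, (kern Y u).re := by
    simp only [kint, zpow_zero, one_mul]
    exact (intervalIntegral.intervalIntegral_re ((continuous_kern Y).intervalIntegrable _ _)).symm
  rw [hre]
  have h1 : ∫ u in (-1 : ℝ)..1, (Real.exp (-(Y * u ^ 2)) - 192 / Y * Real.exp (-(Y / 4) * u ^ 2))
      ≤ ∫ u in (-1 : ℝ)..1, (kern Y u).re := by
    refine intervalIntegral.integral_mono_on (by norm_num)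
      (Continuous.intervalIntegrable (by fun_prop) _ _)
      ((Complex.continuous_re.comp (continuous_kern Y)).intervalIntegrable _ _) fun u hu => ?_
    refine le_trans ?_ (re_kern_ge hY0.le (abs_le.2 hu))
    have h2 := mul_le_mul_of_nonneg_left (sq_cubed_mul_exp_le hY0 u) (by positivity : 0 ≤ Y ^ 2 / 2)
    have h3 : Y ^ 2 / 2 * (384 / Y ^ 3 * Real.exp (-(Y / 4) * u ^ 2))
        = 192 / Y * Real.exp (-(Y / 4) * u ^ 2) := by field_simp; norm_num
    linarith
  rw [intervalIntegral.integral_sub (Continuous.intervalIntegrable (by fun_prop) _ _)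
    (Continuous.intervalIntegrable (by fun_prop) _ _), intervalIntegral.integral_const_mul] at h1
  have h4 := integral_gaussian_ge hY
  have h5 := (integral_gaussian_le (b := Y / 4) (by positivity)).trans (sqrt_pi_div_le hY0)
  have h6 := mul_le_mul_of_nonneg_left h5 (by positivity : 0 ≤ 192 / Y)
  have h7 : 192 / Y * (4 * (√Y)⁻¹) = 768 / Y * (√Y)⁻¹ := by ring
  linarith

theorem inv_sqrt_isBigO_kint : (fun Y : ℝ => (√Y)⁻¹) =O[atTop] kint 0 := by
  refine IsBigO.of_bound 4 ?_
  filter_upwards [eventually_ge_atTop 3072] with Y hY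
  have h1 := norm_kint_zero_ge (Y := Y) (by linarith)
  have h2 : 768 / Y ≤ 1 / 4 := by rw [div_le_div_iff₀ (by linarith) (by norm_num)]; linarith
  have hs : 0 ≤ (√Y)⁻¹ := by positivity
  rw [Real.norm_of_nonneg hs]
  nlinarith

theorem kernNorm_isBigO_kint : kernNorm =O[atTop] kint 0 := by
  refine IsBigO.trans (IsBigO.of_bound 4 ?_) inv_sqrt_isBigO_kint
  filter_upwards [eventually_gt_atTop 0] with Y hY
  have h0 : 0 ≤ kernNorm Y :=
    intervalIntegral.integral_nonneg (by norm_num) fun u _ => norm_nonneg _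
  rw [Real.norm_of_nonneg h0,
    Real.norm_of_nonneg (by positivity)]
  exact kernNorm_le hY

theorem hasDerivAt_zpow_mul_kern (k : ℤ) (Y u : ℝ) :
    HasDerivAt (fun u : ℝ => (1 + u * I : ℂ) ^ k * kern Y u)
      (I * (k * ((1 + u * I) ^ (k - 1) * kern Y u) + Y * ((1 + u * I) ^ k * kern Y u
        - (1 + u * I) ^ (k - 2) * kern Y u))) u := by
  have hs := one_add_mul_I_ne_zero u
  have d1 : HasDerivAt (fun u : ℝ => (1 + u * I : ℂ)) I u := by
    simpa using ((HasDerivAt.ofReal_comp (hasDerivAt_id u)).mul_const I).const_add 1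
  have d2 : HasDerivAt (fun u : ℝ => (1 + u * I : ℂ) ^ k) (k * (1 + u * I) ^ (k - 1) * I) u :=
    HasDerivAt.comp (h₂ := fun z : ℂ => z ^ k) u (hasDerivAt_zpow k _ (Or.inl hs)) d1
  have d3 : HasDerivAt (fun u : ℝ => (-(Y * u ^ 2) : ℂ)) (-(Y * (2 * u))) u := by
    have hf : (fun u : ℝ => (-(Y * u ^ 2) : ℂ)) = fun u : ℝ => -(Y : ℂ) * (u : ℂ) ^ 2 := by
      funext u; ring
    rw [hf]
    refine (((HasDerivAt.ofReal_comp (hasDerivAt_id u)).pow 2).const_mul (-(Y : ℂ))).congr_deriv ?_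
    simp
  have d4 := (d3.div d1 hs).cexp
  refine (d2.mul d4).congr_deriv ?_
  rw [zpow_sub₀ hs, zpow_sub₀ hs, kern, zpow_one, show (2 : ℤ) = (2 : ℕ) from rfl, zpow_natCast]
  simp only [Pi.div_apply]
  generalize cexp (-(Y * u ^ 2) / (1 + u * I)) = e
  field_simp
  ring_nf
  simp only [I_sq, show I ^ 3 = -I by rw [pow_succ, I_sq]; ring]
  ring

theorem kint_rec (k : ℤ) (Y : ℝ) :
    I * (k * kint (k - 1) Y + Y * (kint k Y - kint (k - 2) Y))
      = (1 + I) ^ k * kern Y 1 - (1 - I) ^ k * kern Y (-1) := by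
  have hc := continuous_zpow_mul_kern
  have h := intervalIntegral.integral_eq_sub_of_hasDerivAt (a := -1) (b := 1)
    (fun u _ => hasDerivAt_zpow_mul_kern k Y u)
    (Continuous.intervalIntegrable (by
      have h1 := hc k Y
      have h2 := hc (k - 1) Y
      have h3 := hc (k - 2) Y
      exact continuous_const.mul ((continuous_const.mul h2).add
        (continuous_const.mul (h1.sub h3)))) _ _)
  rw [intervalIntegral.integral_const_mul, intervalIntegral.integral_add,
    intervalIntegral.integral_const_mul, intervalIntegral.integral_const_mul,
    intervalIntegral.integral_sub] at h
  · simpa [kint, sub_eq_add_neg] using h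
  · exact (hc _ _).intervalIntegrable _ _
  · exact (hc _ _).intervalIntegrable _ _
  · exact (continuous_const.mul (hc _ _)).intervalIntegrable _ _
  · exact (continuous_const.mul ((hc _ _).sub (hc _ _))).intervalIntegrable _ _

theorem exp_isBigO_kint (m : ℕ) : (fun Y : ℝ => Real.exp (-(Y / 2))) =O[atTop]
    fun Y => ((Y : ℂ)⁻¹) ^ m * kint 0 Y := by
  have h1 : (fun Y : ℝ => Real.exp (-(Y / 2))) =O[atTop] fun Y : ℝ => (Y⁻¹) ^ m * (√Y)⁻¹ := by
    have h2 := (isLittleO_exp_neg_mul_rpow_atTop (half_pos one_pos) (-(m + 1 : ℝ))).isBigO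
    refine IsBigO.trans (h2.congr_left fun Y => by ring_nf) (IsBigO.of_bound 1 ?_)
    filter_upwards [eventually_ge_atTop 1] with Y hY
    have hY0 : 0 < Y := by linarith
    rw [one_mul, Real.norm_of_nonneg (by positivity), Real.norm_of_nonneg (by positivity),
      Real.rpow_neg hY0.le, show (m + 1 : ℝ) = ((m + 1 : ℕ) : ℝ) by push_cast; ring,
      Real.rpow_natCast, pow_succ, mul_inv, inv_pow]
    refine mul_le_mul_of_nonneg_left (inv_anti₀ (Real.sqrt_pos.2 hY0) ?_) (by positivity)
    exact Real.sqrt_le_iff.2 ⟨hY0.le, by nlinarith⟩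
  refine h1.trans (IsBigO.mul (IsBigO.of_bound 1 ?_) inv_sqrt_isBigO_kint)
  exact Eventually.of_forall fun Y => by simp

theorem kint_rec_isBigO (k : ℤ) (m : ℕ) :
    (fun Y : ℝ => kint k Y - (kint (k - 2) Y - k * (Y : ℂ)⁻¹ * kint (k - 1) Y)) =O[atTop]
      fun Y => ((Y : ℂ)⁻¹) ^ m * kint 0 Y := by
  refine IsBigO.trans (IsBigO.of_bound (‖(1 + I : ℂ) ^ k‖ + ‖(1 - I : ℂ) ^ k‖) ?_)
    (exp_isBigO_kint m)
  filter_upwards [eventually_ge_atTop 1] with Y hY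
  have hY0 : (Y : ℂ) ≠ 0 := by exact_mod_cast (by linarith : Y ≠ 0)
  have h := kint_rec k Y
  have e : kint k Y - (kint (k - 2) Y - k * (Y : ℂ)⁻¹ * kint (k - 1) Y)
      = (Y : ℂ)⁻¹ * (-I) * ((1 + I) ^ k * kern Y 1 - (1 - I) ^ k * kern Y (-1)) := by
    rw [← h]
    field_simp
    linear_combination (k * kint (k - 1) Y + Y * (kint k Y - kint (k - 2) Y)) * I_sq
  have b1 := norm_kern_le (Y := Y) (u := 1) (by linarith) (by simp)
  have b2 := norm_kern_le (Y := Y) (u := -1) (by linarith) (by simp)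
  norm_num at b1 b2
  rw [e, norm_mul, norm_mul, norm_neg, norm_I, mul_one, norm_inv, Complex.norm_real,
    Real.norm_of_nonneg (by linarith), Real.norm_of_nonneg (Real.exp_pos _).le]
  have h2 : ‖(1 + I : ℂ) ^ k * kern Y 1 - (1 - I) ^ k * kern Y (-1)‖
      ≤ (‖(1 + I : ℂ) ^ k‖ + ‖(1 - I : ℂ) ^ k‖) * Real.exp (-(Y / 2)) := by
    refine (norm_sub_le _ _).trans ?_
    rw [norm_mul, norm_mul, add_mul]
    exact add_le_add (mul_le_mul_of_nonneg_left b1 (norm_nonneg _))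
      (mul_le_mul_of_nonneg_left b2 (norm_nonneg _))
  calc _ ≤ 1 * ‖(1 + I : ℂ) ^ k * kern Y 1 - (1 - I) ^ k * kern Y (-1)‖ :=
        mul_le_mul_of_nonneg_right (inv_le_one_of_one_le₀ hY) (norm_nonneg _)
    _ ≤ _ := by rw [one_mul]; exact h2

theorem integral_sixth_comb (f : ℤ → ℝ → ℂ) (hf : ∀ k, Continuous (f k)) :
    (∫ u in (-1 : ℝ)..1, f 6 u) - 6 * (∫ u in (-1 : ℝ)..1, f 5 u)
      + 15 * (∫ u in (-1 : ℝ)..1, f 4 u) - 20 * (∫ u in (-1 : ℝ)..1, f 3 u)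
      + 15 * (∫ u in (-1 : ℝ)..1, f 2 u) - 6 * (∫ u in (-1 : ℝ)..1, f 1 u)
      + (∫ u in (-1 : ℝ)..1, f 0 u)
      = ∫ u in (-1 : ℝ)..1, (f 6 u - 6 * f 5 u + 15 * f 4 u - 20 * f 3 u + 15 * f 2 u - 6 * f 1 u
        + f 0 u) := by
  have h0 := hf 0
  have h1 := hf 1
  have h2 := hf 2
  have h3 := hf 3
  have h4 := hf 4
  have h5 := hf 5
  have h6 := hf 6
  generalize f 0 = g0 at *
  generalize f 1 = g1 at *
  generalize f 2 = g2 at *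
  generalize f 3 = g3 at *
  generalize f 4 = g4 at *
  generalize f 5 = g5 at *
  generalize f 6 = g6 at *
  clear hf
  rw [intervalIntegral.integral_add, intervalIntegral.integral_sub, intervalIntegral.integral_add,
    intervalIntegral.integral_sub, intervalIntegral.integral_add, intervalIntegral.integral_sub]
  · simp only [intervalIntegral.integral_const_mul]
  all_goals exact Continuous.intervalIntegrable (by fun_prop) _ _

theorem kint_sixth_isBigO :
    (fun Y : ℝ => kint 6 Y - 6 * kint 5 Y + 15 * kint 4 Y - 20 * kint 3 Y + 15 * kint 2 Y
      - 6 * kint 1 Y + kint 0 Y) =O[atTop] fun Y => ((Y : ℂ)⁻¹) ^ 3 * kint 0 Y := by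
  have e : ∀ Y : ℝ, kint 6 Y - 6 * kint 5 Y + 15 * kint 4 Y - 20 * kint 3 Y + 15 * kint 2 Y
      - 6 * kint 1 Y + kint 0 Y = ∫ u in (-1 : ℝ)..1, -(u : ℂ) ^ 6 * kern Y u := by
    intro Y
    simp only [kint]
    rw [integral_sixth_comb (fun k u => (1 + u * I) ^ k * kern Y u)
      fun k => continuous_zpow_mul_kern k Y]
    refine intervalIntegral.integral_congr fun u _ => ?_
    have hI6 : I ^ 6 = -1 := by
      rw [show I ^ 6 = (I ^ 2) ^ 3 by ring, I_sq]; norm_num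
    have : -(u : ℂ) ^ 6 = ((1 + u * I) - 1) ^ 6 := by
      rw [add_sub_cancel_left, mul_pow, hI6]; ring
    simp only [this]
    norm_cast
    ring
  simp only [e]
  refine IsBigO.trans (g := fun Y : ℝ => (Y⁻¹) ^ 3 * (√Y)⁻¹) (IsBigO.of_bound 1536 ?_)
    (IsBigO.mul (IsBigO.of_bound 1 (Eventually.of_forall fun Y => by simp)) inv_sqrt_isBigO_kint)
  filter_upwards [eventually_gt_atTop 0] with Y hY
  have h1 : ‖∫ u in (-1 : ℝ)..1, -(u : ℂ) ^ 6 * kern Y u‖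
      ≤ ∫ u in (-1 : ℝ)..1, 384 / Y ^ 3 * Real.exp (-(Y / 4) * u ^ 2) := by
    refine intervalIntegral.norm_integral_le_of_norm_le (by norm_num)
      (Eventually.of_forall fun u hu => ?_) (Continuous.intervalIntegrable (by fun_prop) _ _)
    refine le_trans ?_ (sq_cubed_mul_exp_le hY u)
    rw [norm_mul, norm_neg, norm_pow, Complex.norm_real, Real.norm_eq_abs,
      Even.pow_abs (by decide)]
    exact mul_le_mul_of_nonneg_left (norm_kern_le hY.le (abs_le.2 ⟨hu.1.le, hu.2⟩))
      (Even.pow_nonneg (by decide) u)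
  refine h1.trans ?_
  rw [intervalIntegral.integral_const_mul, Real.norm_of_nonneg (by positivity)]
  have h5 := (integral_gaussian_le (b := Y / 4) (by positivity)).trans (sqrt_pi_div_le hY)
  refine (mul_le_mul_of_nonneg_left h5 (by positivity)).trans (le_of_eq ?_)
  field_simp
  norm_num

theorem tendsto_ofReal_inv_atTop : Tendsto (fun Y : ℝ => (Y : ℂ)⁻¹) atTop (nhds 0) := by
  have := (Complex.continuous_ofReal.tendsto 0).comp tendsto_inv_atTop_zero
  simpa [Function.comp_def] using this

theorem kint_one_isBigO :
    (fun Y : ℝ => kint 1 Y - (1 - 3 / 4 * (Y : ℂ)⁻¹ + 3 / 32 * (Y : ℂ)⁻¹ ^ 2) * kint 0 Y)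
      =O[atTop] fun Y => ((Y : ℂ)⁻¹) ^ 3 * kint 0 Y := by
  have polyO : ∀ p : ℂ → ℂ, Continuous p → (fun Y : ℝ => p (Y : ℂ)⁻¹) =O[atTop] fun _ => (1 : ℂ) :=
    fun p hp => ((hp.tendsto 0).comp tendsto_ofReal_inv_atTop).isBigO_one ℂ
  have mulO : ∀ (p : ℂ → ℂ) (f : ℝ → ℂ), Continuous p →
      f =O[atTop] (fun Y : ℝ => ((Y : ℂ)⁻¹) ^ 3 * kint 0 Y) →
      (fun Y : ℝ => p (Y : ℂ)⁻¹ * f Y) =O[atTop] fun Y : ℝ => ((Y : ℂ)⁻¹) ^ 3 * kint 0 Y := by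
    intro p f hp hf
    simpa using (polyO p hp).mul hf
  have e2 := kint_rec_isBigO 2 3
  have e3 := kint_rec_isBigO 3 3
  have e4 := kint_rec_isBigO 4 3
  have e5 := kint_rec_isBigO 5 3
  have e6 := kint_rec_isBigO 6 3
  norm_num [-inv_pow] at e2 e3 e4 e5 e6
  have d3 := e3.sub (mulO (fun v => 3 * v) _ (by fun_prop) e2)
  have d4 := (e4.add e2).sub (mulO (fun v => 4 * v) _ (by fun_prop) d3)
  have d5 := (e5.add d3).sub (mulO (fun v => 5 * v) _ (by fun_prop) d4)
  have d6 := (e6.add d4).sub (mulO (fun v => 6 * v) _ (by fun_prop) d5)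
  have hD := (((d6.sub (d5.const_mul_left 6)).add (d4.const_mul_left 15)).sub
    (d3.const_mul_left 20)).add (e2.const_mul_left 15)
  have hP := mulO (fun v => -3 / 8 + 117 / 2 * v - 945 / 4 * v ^ 2 + 945 / 2 * v ^ 3
    - 135 / 2 * v ^ 4) (fun Y => ((Y : ℂ)⁻¹) ^ 3 * kint 0 Y) (by fun_prop) (isBigO_refl _ _)
  have hR := (kint_sixth_isBigO.sub hD).sub hP
  have hbt : Tendsto (fun Y : ℝ => -(32 + 132 * (Y : ℂ)⁻¹ + 336 * (Y : ℂ)⁻¹ ^ 2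
      + 600 * (Y : ℂ)⁻¹ ^ 3 + 720 * (Y : ℂ)⁻¹ ^ 4 + 720 * (Y : ℂ)⁻¹ ^ 5)) atTop (nhds (-32)) := by
    have hc : Continuous fun v : ℂ => -(32 + 132 * v + 336 * v ^ 2 + 600 * v ^ 3 + 720 * v ^ 4
      + 720 * v ^ 5) := by fun_prop
    have := (hc.tendsto 0).comp tendsto_ofReal_inv_atTop
    simpa [Function.comp_def] using this
  have hbi := (hbt.inv₀ (by norm_num)).isBigO_one ℂ
  have hfin := hbi.mul hR
  refine hfin.congr' ?_ (Eventually.of_forall fun Y => one_mul _)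
  filter_upwards [hbt.eventually_ne (by norm_num : (-32 : ℂ) ≠ 0)] with Y hb
  generalize (Y : ℂ)⁻¹ = v at *
  rw [inv_mul_eq_iff_eq_mul₀ hb]
  ring

theorem kint_neg_one_isBigO :
    (fun Y : ℝ => kint (-1) Y - (1 + 1 / 4 * (Y : ℂ)⁻¹ + 3 / 32 * (Y : ℂ)⁻¹ ^ 2) * kint 0 Y)
      =O[atTop] fun Y => ((Y : ℂ)⁻¹) ^ 3 * kint 0 Y := by
  have e1 := kint_rec_isBigO 1 3
  norm_num [-inv_pow] at e1
  refine (kint_one_isBigO.sub e1).congr_left fun Y => ?_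
  ring

theorem kint_neg_two_isBigO :
    (fun Y : ℝ => kint (-2) Y - kint 0 Y) =O[atTop] fun Y => ((Y : ℂ)⁻¹) ^ 3 * kint 0 Y := by
  have e1 := kint_rec_isBigO 0 3
  norm_num [-inv_pow] at e1
  refine e1.neg_left.congr_left fun Y => ?_
  ring

theorem eventually_kint_zero_ne : ∀ᶠ Y : ℝ in atTop, kint 0 Y ≠ 0 := by
  obtain ⟨C, hC⟩ := inv_sqrt_isBigO_kint.bound
  filter_upwards [hC, eventually_gt_atTop 0] with Y h1 hY h0
  rw [h0, norm_zero, mul_zero, Real.norm_of_nonneg (by positivity)] at h1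
  have : 0 < (√Y)⁻¹ := by positivity
  linarith

section

variable {t : ℕ}

/-- The saddle-point integrand for the `j`-th moment, at the point `w`. -/
noncomputable def saddleFun (t j : ℕ) (z : ℝ) (w : ℂ) : ℂ :=
  oddGen w * momFun t j (cexp (-w) ^ t) * cexp ((π ^ 2 / 24 / z ^ 2 + 1 / 24) * w)

noncomputable def saddleInt (t j : ℕ) (z : ℝ) : ℂ :=
  ∫ θ in (-π)..π, saddleFun t j z (z + θ * I)

/-- The saddle-point integral divided by its exponential growth and by the width of the peak. -/
noncomputable def normSaddle (t j : ℕ) (z : ℝ) : ℂ :=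
  cexp (-(2 * (π ^ 2 / 24 / z))) * (z : ℂ)⁻¹ * saddleInt t j z

theorem continuous_saddleFun (ht : 1 ≤ t) (j : ℕ) {z : ℝ} (hz : 0 < z) :
    Continuous fun θ : ℝ => saddleFun t j z (z + θ * I) := by
  refine continuous_iff_continuousAt.2 fun θ => ?_
  have hw : 0 < ((z : ℂ) + θ * I).re := by simpa using hz
  have hc : ContinuousAt (fun θ : ℝ => (z : ℂ) + θ * I) θ := by fun_prop
  have h : ContinuousAt (saddleFun t j z) ((z : ℂ) + θ * I) :=
    ((continuousAt_oddGen hw).mul (continuousAt_momFun_exp ht hw j)).mul (by fun_prop)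
  exact ContinuousAt.comp (f := fun θ : ℝ => (z : ℂ) + θ * I) h hc

theorem saddleFun_eq (j : ℕ) {z : ℝ} (hz : 0 < z) (u : ℝ) :
    saddleFun t j z (z + (z * u : ℝ) * I) = cexp (2 * (π ^ 2 / 24 / z)) *
      (kern (π ^ 2 / 24 / z) u * ((1 + majorErr (z * (1 + u * I))) *
        momFun t j (cexp (-(z * (1 + u * I))) ^ t))) := by
  have hw : (z : ℂ) + (z * u : ℝ) * I = z * (1 + u * I) := by push_cast; ring
  have hre : 0 < ((z : ℂ) * (1 + u * I)).re := by simpa using hz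
  rw [hw, saddleFun, oddGen_eq hre, kern]
  have hz0 : (z : ℂ) ≠ 0 := by exact_mod_cast hz.ne'
  have hs := one_add_mul_I_ne_zero u
  have hexp : cexp (π ^ 2 / (24 * (z * (1 + u * I))) - z * (1 + u * I) / 24)
      * cexp ((π ^ 2 / 24 / z ^ 2 + 1 / 24) * (z * (1 + u * I)))
      = cexp (2 * (π ^ 2 / 24 / z)) *
        cexp (-(((π ^ 2 / 24 / z : ℝ) : ℂ) * u ^ 2) / (1 + u * I)) := by
    rw [← Complex.exp_add, ← Complex.exp_add]
    congr 1
    push_cast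
    field_simp
    linear_combination (π : ℂ) ^ 2 * u ^ 2 * I_sq
  linear_combination ((1 + majorErr (z * (1 + u * I))) *
    momFun t j (cexp (-(z * (1 + u * I))) ^ t)) * hexp

theorem norm_saddleFun_le (ht : 1 ≤ t) (j : ℕ) {z θ : ℝ} (hz : 0 < z) (hz1 : z ≤ 1)
    (h1 : z ≤ |θ|) (h2 : |θ| ≤ π) :
    ‖saddleFun t j z (z + θ * I)‖ ≤ Real.exp (2 * (π ^ 2 / 24 / z)) *
      (64 * ((t + 1) ^ 2 + (2 * t + 6)) * (Nat.factorial 9 * 888 ^ 9) * z ^ 5) := by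
  have ho := norm_oddGen_le hz hz1 h1 h2
  have hm := norm_momFun_exp_le ht j hz hz1 θ
  have he : ‖cexp (((π : ℂ) ^ 2 / 24 / z ^ 2 + 1 / 24) * (z + θ * I))‖
      ≤ Real.exp (π ^ 2 / (24 * z)) * 2 := by
    rw [Complex.norm_exp]
    have hre : (((π : ℂ) ^ 2 / 24 / z ^ 2 + 1 / 24) * (z + θ * I)).re
        = π ^ 2 / (24 * z) + z / 24 := by
      have : ((π : ℂ) ^ 2 / 24 / z ^ 2 + 1 / 24) = ((π ^ 2 / 24 / z ^ 2 + 1 / 24 : ℝ) : ℂ) := by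
        push_cast; ring
      rw [this, Complex.re_ofReal_mul]
      simp
      field_simp
    rw [hre, Real.exp_add]
    have : Real.exp (z / 24) ≤ 2 := by
      have h := Real.exp_bound_div_one_sub_of_interval (x := z / 24) (by positivity) (by linarith)
      refine h.trans ?_
      rw [div_le_iff₀ (by linarith)]
      linarith
    gcongr
  have hd : Real.exp (-(1 / (888 * z))) ≤ Nat.factorial 9 * 888 ^ 9 * z ^ 9 := by
    have h := Real.pow_div_factorial_le_exp (1 / (888 * z)) (by positivity) 9
    rw [Real.exp_neg, inv_le_comm₀ (Real.exp_pos _) (by positivity)]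
    refine le_trans (le_of_eq ?_) h
    field_simp
  rw [saddleFun, norm_mul, norm_mul]
  calc _ ≤ (2 * Real.exp (π ^ 2 / (24 * z) - 1 / (888 * z))) *
        (16 * ((t + 1) ^ 2 + (2 * t + 6)) / z ^ 4) * (Real.exp (π ^ 2 / (24 * z)) * 2) := by
        gcongr
    _ = Real.exp (2 * (π ^ 2 / 24 / z)) * (64 * ((t + 1) ^ 2 + (2 * t + 6)) / z ^ 4) *
        Real.exp (-(1 / (888 * z))) := by
        rw [sub_eq_add_neg, Real.exp_add, show 2 * (π ^ 2 / 24 / z)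
          = π ^ 2 / (24 * z) + π ^ 2 / (24 * z) by field_simp; ring, Real.exp_add]
        ring
    _ ≤ Real.exp (2 * (π ^ 2 / 24 / z)) * (64 * ((t + 1) ^ 2 + (2 * t + 6)) / z ^ 4) *
        (Nat.factorial 9 * 888 ^ 9 * z ^ 9) := by gcongr
    _ = _ := by field_simp

/-- The contribution of the major arc to `normSaddle`. -/
noncomputable def majorInt (t j : ℕ) (z : ℝ) : ℂ :=
  ∫ u in (-1 : ℝ)..1, kern (π ^ 2 / 24 / z) u * ((1 + majorErr (z * (1 + u * I))) *
    momFun t j (cexp (-(z * (1 + u * I))) ^ t))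

theorem norm_normSaddle_sub_majorInt_le (ht : 1 ≤ t) (j : ℕ) {z : ℝ} (hz : 0 < z) (hz1 : z ≤ 1) :
    ‖normSaddle t j z - majorInt t j z‖ ≤
      2 * π * (64 * ((t + 1) ^ 2 + (2 * t + 6)) * (Nat.factorial 9 * 888 ^ 9)) * z ^ 4 := by
  have hint : ∀ a b : ℝ, IntervalIntegrable (fun θ : ℝ => saddleFun t j z (z + θ * I))
      MeasureTheory.volume a b := fun a b => (continuous_saddleFun ht j hz).intervalIntegrable a b
  have hz0 : (z : ℂ) ≠ 0 := by exact_mod_cast hz.ne'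
  have hmaj : ∫ θ in (-z)..z, saddleFun t j z (z + θ * I)
      = z * (cexp (2 * (π ^ 2 / 24 / z)) * majorInt t j z) := by
    have h := intervalIntegral.smul_integral_comp_mul_left (a := -1) (b := 1)
      (fun θ : ℝ => saddleFun t j z (z + θ * I)) z
    rw [mul_neg, mul_one] at h
    rw [← h, majorInt, ← intervalIntegral.integral_const_mul, Complex.real_smul]
    simp_rw [saddleFun_eq j hz]
  have hsplit : saddleInt t j z = (∫ θ in (-π)..(-z), saddleFun t j z (z + θ * I))
      + (∫ θ in (-z)..z, saddleFun t j z (z + θ * I))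
      + ∫ θ in z..π, saddleFun t j z (z + θ * I) := by
    rw [intervalIntegral.integral_add_adjacent_intervals (hint _ _) (hint _ _),
      intervalIntegral.integral_add_adjacent_intervals (hint _ _) (hint _ _), saddleInt]
  set M := Real.exp (2 * (π ^ 2 / 24 / z)) *
      (64 * ((t + 1) ^ 2 + (2 * t + 6)) * (Nat.factorial 9 * 888 ^ 9) * z ^ 5) with hM
  have hM0 : 0 ≤ M := by positivity
  have hpi := Real.pi_gt_three
  have hb1 : ‖∫ θ in (-π)..(-z), saddleFun t j z (z + θ * I)‖ ≤ M * π := by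
    refine (intervalIntegral.norm_integral_le_of_norm_le_const fun θ hθ => ?_).trans
      (mul_le_mul_of_nonneg_left (b := |-z - -π|) ?_ hM0)
    · rw [Set.uIoc_of_le (by linarith)] at hθ
      have : |θ| = -θ := abs_of_neg (by linarith [hθ.2])
      exact norm_saddleFun_le ht j hz hz1 (by linarith [hθ.2]) (by linarith [hθ.1])
    · rw [abs_of_nonneg] <;> linarith
  have hb2 : ‖∫ θ in z..π, saddleFun t j z (z + θ * I)‖ ≤ M * π := by
    refine (intervalIntegral.norm_integral_le_of_norm_le_const fun θ hθ => ?_).trans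
      (mul_le_mul_of_nonneg_left (b := |π - z|) ?_ hM0)
    · rw [Set.uIoc_of_le (by linarith)] at hθ
      have : |θ| = θ := abs_of_pos (by linarith [hθ.1])
      exact norm_saddleFun_le ht j hz hz1 (by linarith [hθ.1]) (by linarith [hθ.2])
    · rw [abs_of_nonneg] <;> linarith
  set e1 := ∫ θ in (-π)..(-z), saddleFun t j z (z + θ * I)
  set e2 := ∫ θ in z..π, saddleFun t j z (z + θ * I)
  have hdiff : normSaddle t j z - majorInt t j z
      = cexp (-(2 * (π ^ 2 / 24 / z))) * (z : ℂ)⁻¹ * (e1 + e2) := by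
    rw [normSaddle, hsplit, hmaj]
    have : cexp (-(2 * (π ^ 2 / 24 / z))) * cexp (2 * (π ^ 2 / 24 / z)) = 1 := by
      rw [← Complex.exp_add, neg_add_cancel, Complex.exp_zero]
    linear_combination (majorInt t j z * (z : ℂ)⁻¹ * z) * this
      + majorInt t j z * inv_mul_cancel₀ hz0
  have hne : ‖cexp (-(2 * ((π : ℂ) ^ 2 / 24 / z)))‖ = (Real.exp (2 * (π ^ 2 / 24 / z)))⁻¹ := by
    rw [← Real.exp_neg, ← Complex.norm_exp_ofReal]
    push_cast
    rfl
  rw [hdiff, norm_mul, norm_mul, hne, norm_inv, Complex.norm_real, Real.norm_of_nonneg hz.le]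
  calc _ ≤ (Real.exp (2 * (π ^ 2 / 24 / z)))⁻¹ * z⁻¹ * (M * π + M * π) := by
        gcongr
        exact (norm_add_le _ _).trans (add_le_add hb1 hb2)
    _ = _ := by
        rw [hM]
        field_simp
        ring

end

section

variable {t : ℕ}

theorem tendsto_saddleConst_div : Tendsto (fun z : ℝ => π ^ 2 / 24 / z)
    (nhdsWithin 0 (Set.Ioi 0)) atTop := by
  simpa [div_eq_mul_inv] using tendsto_inv_nhdsGT_zero.const_mul_atTop
    (show (0 : ℝ) < π ^ 2 / 24 by positivity)

theorem self_isBigO_kint : (fun z : ℝ => z) =O[nhdsWithin 0 (Set.Ioi 0)]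
    fun z => kint 0 (π ^ 2 / 24 / z) := by
  refine IsBigO.trans (IsBigO.of_bound (√(π ^ 2 / 24)) ?_)
    (inv_sqrt_isBigO_kint.comp_tendsto tendsto_saddleConst_div)
  filter_upwards [self_mem_nhdsWithin, nhdsWithin_le_nhds (eventually_lt_nhds one_pos)]
    with z hz hz1
  have hz : 0 < z := hz
  have h1 : √z ≤ 1 := Real.sqrt_le_one.2 hz1.le
  have h2 := Real.mul_self_sqrt hz.le
  have h3 : √z * √z ≤ √z * 1 := mul_le_mul_of_nonneg_left h1 (Real.sqrt_nonneg z)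
  have h4 : √(π ^ 2 / 24) ≠ 0 := (Real.sqrt_pos.2 (by positivity)).ne'
  have h5 : √(π ^ 2 / 24) * (√(π ^ 2 / 24) / √z)⁻¹ = √z := by
    rw [inv_div, mul_div_cancel₀ _ h4]
  rw [Function.comp_apply, Real.sqrt_div (x := π ^ 2 / 24) (by positivity) z, Real.norm_of_nonneg hz.le,
    Real.norm_of_nonneg (by positivity), h5]
  linarith

/-- If the moment function is approximated by `p` near `0`, its major arc integral is approximated
by the kernel integral of `p`. -/
theorem normSaddle_isBigO (ht : 1 ≤ t) (j : ℕ) {p : ℂ → ℂ} {r : ℕ} (hr : r ≤ 3)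
    (hp : ∀ w ≠ 0, ContinuousAt p w)
    (h1 : (fun w => momFun t j (cexp (-w) ^ t) - p w) =O[nhdsWithin 0 {0}ᶜ] fun w => w ^ r)
    (h2 : (fun w => momFun t j (cexp (-w) ^ t)) =O[nhdsWithin 0 {0}ᶜ] fun w => (w⁻¹) ^ (3 - r)) :
    (fun z : ℝ => normSaddle t j z
      - ∫ u in (-1 : ℝ)..1, kern (π ^ 2 / 24 / z) u * p (z * (1 + u * I)))
      =O[nhdsWithin 0 (Set.Ioi 0)] fun z => (z : ℂ) ^ r * kint 0 (π ^ 2 / 24 / z) := by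
  have hminor : (fun z : ℝ => normSaddle t j z - majorInt t j z)
      =O[nhdsWithin 0 (Set.Ioi 0)] fun z => (z : ℂ) ^ r * kint 0 (π ^ 2 / 24 / z) := by
    have hz4 : (fun z : ℝ => z ^ 3 * z) =O[nhdsWithin 0 (Set.Ioi 0)]
        fun z => (z : ℂ) ^ r * kint 0 (π ^ 2 / 24 / z) := by
      refine IsBigO.mul (IsBigO.of_bound 1 ?_) self_isBigO_kint
      filter_upwards [self_mem_nhdsWithin, nhdsWithin_le_nhds (eventually_lt_nhds one_pos)]
        with z hz hz1
      have hz : 0 < z := hz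
      rw [norm_pow, norm_pow, Complex.norm_real, one_mul, Real.norm_of_nonneg hz.le]
      exact pow_le_pow_of_le_one hz.le hz1.le hr
    refine IsBigO.trans (IsBigO.of_bound
      (2 * π * (64 * ((t + 1) ^ 2 + (2 * t + 6)) * (Nat.factorial 9 * 888 ^ 9))) ?_) hz4
    filter_upwards [self_mem_nhdsWithin, nhdsWithin_le_nhds (eventually_lt_nhds one_pos)]
      with z hz hz1
    have hz : 0 < z := hz
    refine (norm_normSaddle_sub_majorInt_le ht j hz hz1.le).trans (le_of_eq ?_)
    rw [← pow_succ, Real.norm_of_nonneg (by positivity)]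
  suffices hmajor : (fun z : ℝ => majorInt t j z
      - ∫ u in (-1 : ℝ)..1, kern (π ^ 2 / 24 / z) u * p (z * (1 + u * I)))
      =O[nhdsWithin 0 (Set.Ioi 0)] fun z => (z : ℂ) ^ r * kint 0 (π ^ 2 / 24 / z) from
    (hminor.add hmajor).congr_left fun z => by ring
  obtain ⟨C1, hC1, h1⟩ := h1.exists_pos
  obtain ⟨C2, hC2, h2⟩ := h2.exists_pos
  obtain ⟨ε, hε, hball⟩ := Metric.mem_nhdsWithin_iff.1 (Filter.inter_mem h1.bound h2.bound)
  have hkn : (fun z : ℝ => z ^ r * kernNorm (π ^ 2 / 24 / z)) =O[nhdsWithin 0 (Set.Ioi 0)]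
      fun z => (z : ℂ) ^ r * kint 0 (π ^ 2 / 24 / z) := by
    refine IsBigO.mul (IsBigO.of_bound 1 ?_)
      (kernNorm_isBigO_kint.comp_tendsto tendsto_saddleConst_div)
    exact Eventually.of_forall fun z => by simp
  refine IsBigO.trans (IsBigO.of_bound (C1 * 2 ^ r + C2) ?_) hkn
  filter_upwards [self_mem_nhdsWithin, nhdsWithin_le_nhds (eventually_lt_nhds one_pos),
    nhdsWithin_le_nhds (eventually_lt_nhds (half_pos hε))] with z hz hz1 hzε
  have hz : 0 < z := hz
  have hw0 : ∀ u : ℝ, (z : ℂ) * (1 + u * I) ≠ 0 := fun u =>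
    mul_ne_zero (by exact_mod_cast hz.ne') (one_add_mul_I_ne_zero u)
  have hre : ∀ u : ℝ, ((z : ℂ) * (1 + u * I)).re = z := fun u => by simp
  have him : ∀ u : ℝ, ((z : ℂ) * (1 + u * I)).im = z * u := fun u => by simp
  have hrepos : ∀ u : ℝ, 0 < ((z : ℂ) * (1 + u * I)).re := fun u => by rw [hre]; exact hz
  have hcw : Continuous fun u : ℝ => (z : ℂ) * (1 + u * I) := by fun_prop
  have hcp : Continuous fun u : ℝ => p (z * (1 + u * I)) := continuous_iff_continuousAt.2 fun u =>
    ContinuousAt.comp (f := fun u : ℝ => (z : ℂ) * (1 + u * I)) (hp _ (hw0 u)) hcw.continuousAt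
  have hcm : Continuous fun u : ℝ => momFun t j (cexp (-(z * (1 + u * I))) ^ t) :=
    continuous_iff_continuousAt.2 fun u =>
      ContinuousAt.comp (f := fun u : ℝ => (z : ℂ) * (1 + u * I))
        (continuousAt_momFun_exp ht (hrepos u) j) hcw.continuousAt
  have hce : Continuous fun u : ℝ => majorErr (z * (1 + u * I)) := by
    unfold majorErr
    refine Continuous.sub (continuous_iff_continuousAt.2 fun u => ?_) continuous_const
    refine ContinuousAt.comp (g := oddGen) (f := fun u : ℝ => (π : ℂ) ^ 2 / (z * (1 + u * I)))
      (continuousAt_oddGen ?_) (continuous_const.div hcw hw0).continuousAt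
    have e : (π : ℂ) ^ 2 / (z * (1 + u * I)) = ((π ^ 2 : ℝ) : ℂ) * (z * (1 + u * I))⁻¹ := by
      push_cast; ring
    rw [e, Complex.re_ofReal_mul, Complex.inv_re]
    have := Complex.normSq_pos.2 (hw0 u)
    have := hrepos u
    positivity
  have hi1 : Continuous fun u : ℝ => kern (π ^ 2 / 24 / z) u *
      ((1 + majorErr (z * (1 + u * I))) * momFun t j (cexp (-(z * (1 + u * I))) ^ t)) :=
    (continuous_kern _).mul ((continuous_const.add hce).mul hcm)
  have hi2 : Continuous fun u : ℝ => kern (π ^ 2 / 24 / z) u * p (z * (1 + u * I)) :=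
    (continuous_kern _).mul hcp
  rw [majorInt, ← intervalIntegral.integral_sub (hi1.intervalIntegrable _ _)
    (hi2.intervalIntegrable _ _)]
  have hbound : ∀ u ∈ Set.Ioc (-1 : ℝ) 1,
      ‖kern (π ^ 2 / 24 / z) u * ((1 + majorErr (z * (1 + u * I))) *
        momFun t j (cexp (-(z * (1 + u * I))) ^ t))
        - kern (π ^ 2 / 24 / z) u * p (z * (1 + u * I))‖
      ≤ (C1 * 2 ^ r + C2) * z ^ r * ‖kern (π ^ 2 / 24 / z) u‖ := by
    intro u hu
    have hu1 : |u| ≤ 1 := abs_le.2 ⟨hu.1.le, hu.2⟩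
    set w := (z : ℂ) * (1 + u * I) with hw
    have hwle : ‖w‖ ≤ 2 * z := by
      rw [hw, norm_mul, Complex.norm_real, Real.norm_of_nonneg hz.le, mul_comm]
      refine mul_le_mul_of_nonneg_right ((norm_add_le _ _).trans ?_) hz.le
      rw [norm_one, norm_mul, norm_I, Complex.norm_real, Real.norm_eq_abs]
      linarith
    have hwge : z ≤ ‖w‖ := by
      have := Complex.re_le_norm w
      rwa [hre] at this
    have hmem : w ∈ Metric.ball (0 : ℂ) ε ∩ {0}ᶜ :=
      ⟨by rw [mem_ball_zero_iff]; linarith, hw0 u⟩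
    have hb1 : ‖momFun t j (cexp (-w) ^ t) - p w‖ ≤ C1 * ‖w ^ r‖ := (hball hmem).1
    have hb2 : ‖momFun t j (cexp (-w) ^ t)‖ ≤ C2 * ‖(w⁻¹) ^ (3 - r)‖ := (hball hmem).2
    have he : ‖majorErr w‖ ≤ z ^ 3 := by
      have := norm_majorErr_le (hrepos u) (by rw [hre]; exact hz1.le)
        (by rw [hre, him, abs_mul, abs_of_pos hz]; exact mul_le_of_le_one_right hz.le hu1)
      rwa [hre] at this
    have hb3 : ‖momFun t j (cexp (-w) ^ t) - p w‖ ≤ C1 * 2 ^ r * z ^ r := by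
      refine hb1.trans ?_
      rw [mul_assoc, ← mul_pow, norm_pow]
      gcongr
    have hb4 : ‖majorErr w * momFun t j (cexp (-w) ^ t)‖ ≤ C2 * z ^ r := by
      rw [norm_mul]
      calc _ ≤ z ^ 3 * (C2 * (z⁻¹) ^ (3 - r)) := by
            refine mul_le_mul he (hb2.trans ?_) (norm_nonneg _) (by positivity)
            rw [norm_pow, norm_inv]
            gcongr
        _ = _ := by
            rw [show z ^ 3 = z ^ r * z ^ (3 - r) by rw [← pow_add]; congr 1; omega, inv_pow]
            field_simp
    rw [← mul_sub, norm_mul, mul_comm]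
    refine mul_le_mul_of_nonneg_right ?_ (norm_nonneg _)
    calc _ = ‖(momFun t j (cexp (-w) ^ t) - p w) + majorErr w * momFun t j (cexp (-w) ^ t)‖ := by
          congr 1; ring
      _ ≤ _ := (norm_add_le _ _).trans (by linarith)
  refine (intervalIntegral.norm_integral_le_of_norm_le (by norm_num)
    (Eventually.of_forall hbound)
    (((continuous_kern _).norm.const_mul _).intervalIntegrable _ _)).trans (le_of_eq ?_)
  rw [intervalIntegral.integral_const_mul, ← kernNorm, Real.norm_of_nonneg, mul_assoc]
  refine mul_nonneg (by positivity) ?_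
  exact intervalIntegral.integral_nonneg (by norm_num) fun u _ => norm_nonneg _

end

section

variable {t : ℕ}

theorem normSaddle_zero_isBigO (ht : 1 ≤ t) :
    (fun z : ℝ => normSaddle t 0 z - kint 0 (π ^ 2 / 24 / z))
      =O[nhdsWithin 0 (Set.Ioi 0)] fun z => (z : ℂ) ^ 3 * kint 0 (π ^ 2 / 24 / z) := by
  refine (normSaddle_isBigO ht 0 (p := fun _ => 1) le_rfl (fun _ _ => continuousAt_const)
    ?_ ?_).congr_left fun z => ?_
  · simpa [momFun] using isBigO_zero (fun w : ℂ => w ^ 3) _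
  · simpa [momFun] using isBigO_refl (fun _ : ℂ => (1 : ℂ)) _
  · simp [kint]

theorem integral_kern_mul_zpow (k : ℤ) (Y : ℝ) (z : ℝ) :
    ∫ u in (-1 : ℝ)..1, kern Y u * (z * (1 + u * I) : ℂ) ^ k = (z : ℂ) ^ k * kint k Y := by
  rw [kint, ← intervalIntegral.integral_const_mul]
  congr 1
  ext u
  rw [mul_zpow]
  ring

theorem intervalIntegrable_kern_mul_zpow (k : ℤ) (Y : ℝ) {z : ℝ} (hz : z ≠ 0) :
    IntervalIntegrable (fun u : ℝ => kern Y u * (z * (1 + u * I) : ℂ) ^ k)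
      MeasureTheory.volume (-1) 1 :=
  ((continuous_kern Y).mul (Continuous.zpow₀ (by fun_prop) k fun u => Or.inl
    (mul_ne_zero (by exact_mod_cast hz) (one_add_mul_I_ne_zero u)))).intervalIntegrable _ _

theorem integral_kern_mul_three (a b c : ℂ) (k l m : ℤ) (Y : ℝ) {z : ℝ} (hz : z ≠ 0) :
    ∫ u in (-1 : ℝ)..1, kern Y u * (a * (z * (1 + u * I) : ℂ) ^ k + b * (z * (1 + u * I) : ℂ) ^ l
      + c * (z * (1 + u * I) : ℂ) ^ m)
      = a * ((z : ℂ) ^ k * kint k Y) + b * ((z : ℂ) ^ l * kint l Y)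
        + c * ((z : ℂ) ^ m * kint m Y) := by
  have hi := fun k => intervalIntegrable_kern_mul_zpow k Y hz
  simp_rw [← integral_kern_mul_zpow, ← intervalIntegral.integral_const_mul]
  rw [← intervalIntegral.integral_add ((hi k).const_mul a) ((hi l).const_mul b),
    ← intervalIntegral.integral_add (((hi k).const_mul a).add ((hi l).const_mul b))
      ((hi m).const_mul c)]
  congr 1
  ext u
  ring

theorem pow_isBigO_inv_pow (m n : ℕ) :
    (fun w : ℂ => w ^ m) =O[nhdsWithin 0 {0}ᶜ] fun w => (w⁻¹) ^ n := by
  refine IsBigO.of_bound 1 ?_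
  filter_upwards [eventually_norm_lt one_pos, self_mem_nhdsWithin] with w h1 h0
  have h0 : w ≠ 0 := h0
  rw [norm_pow, norm_pow, norm_inv, one_mul]
  exact (pow_le_one₀ (norm_nonneg _) h1.le).trans
    (one_le_pow₀ ((one_le_inv₀ (norm_pos_iff.2 h0)).2 h1.le))

theorem inv_pow_isBigO_inv_pow {m n : ℕ} (h : m ≤ n) :
    (fun w : ℂ => (w⁻¹) ^ m) =O[nhdsWithin 0 {0}ᶜ] fun w => (w⁻¹) ^ n := by
  refine IsBigO.of_bound 1 ?_
  filter_upwards [eventually_norm_lt one_pos, self_mem_nhdsWithin] with w h1 h0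
  have h0 : w ≠ 0 := h0
  rw [norm_pow, norm_pow, norm_inv, one_mul]
  exact pow_le_pow_right₀ ((one_le_inv₀ (norm_pos_iff.2 h0)).2 h1.le) h

theorem normSaddle_one_isBigO (ht : 1 ≤ t) :
    (fun z : ℝ => normSaddle t 1 z - (1 / 2 * (z : ℂ)⁻¹ * kint (-1) (π ^ 2 / 24 / z)
      + (-t / 2 + delta t / 4) * kint 0 (π ^ 2 / 24 / z)
      + t ^ 2 / 6 * z * kint 1 (π ^ 2 / 24 / z)))
      =O[nhdsWithin 0 (Set.Ioi 0)] fun z => (z : ℂ) ^ 2 * kint 0 (π ^ 2 / 24 / z) := by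
  have h1 := meanFun_expansion ht
  refine (normSaddle_isBigO ht 1 (p := fun w => 1 / 2 * w ^ (-1 : ℤ)
    + (-t / 2 + delta t / 4) * w ^ (0 : ℤ) + t ^ 2 / 6 * w ^ (1 : ℤ)) (r := 2) (by norm_num)
    (fun w hw => ?_) ?_ ?_).congr' ?_ EventuallyEq.rfl
  · have := fun k : ℤ => continuousAt_zpow₀ w k (Or.inl hw)
    exact ((continuousAt_const.mul (this _)).add (continuousAt_const.mul (this _))).add
      (continuousAt_const.mul (this _))
  · refine h1.congr_left fun w => ?_
    rw [zpow_neg_one, zpow_zero, zpow_one, one_div, one_div, mul_inv]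
    ring
  · refine ((((h1.trans (pow_isBigO_inv_pow 2 1)).add
      ((isBigO_refl (fun w : ℂ => (w⁻¹) ^ 1) _).const_mul_left (1 / 2))).add
      ((pow_isBigO_inv_pow 0 1).const_mul_left (-t / 2 + delta t / 4 : ℂ))).add
      ((pow_isBigO_inv_pow 1 1).const_mul_left (t ^ 2 / 6 : ℂ))).congr_left fun w => ?_
    rw [one_div (2 * w), mul_inv]
    ring
  · filter_upwards [self_mem_nhdsWithin] with z hz
    rw [integral_kern_mul_three _ _ _ _ _ _ _ (ne_of_gt hz), zpow_neg_one, zpow_zero, zpow_one]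
    ring

theorem normSaddle_two_isBigO (ht : 1 ≤ t) :
    (fun z : ℝ => normSaddle t 2 z - (1 / 4 * (z : ℂ)⁻¹ ^ 2 * kint (-2) (π ^ 2 / 24 / z)
      + ((-t / 2 + delta t / 4) + 1 / 2) * (z : ℂ)⁻¹ * kint (-1) (π ^ 2 / 24 / z)
      + ((-t / 2 + delta t / 4) ^ 2 + t ^ 2 / 6 - delta t / 8) * kint 0 (π ^ 2 / 24 / z)))
      =O[nhdsWithin 0 (Set.Ioi 0)] fun z => (z : ℂ) ^ 1 * kint 0 (π ^ 2 / 24 / z) := by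
  have h1 := secondMoment_expansion ht
  refine (normSaddle_isBigO ht 2 (p := fun w => 1 / 4 * w ^ (-2 : ℤ)
    + ((-t / 2 + delta t / 4) + 1 / 2) * w ^ (-1 : ℤ)
    + ((-t / 2 + delta t / 4) ^ 2 + t ^ 2 / 6 - delta t / 8) * w ^ (0 : ℤ)) (r := 1) (by norm_num)
    (fun w hw => ?_) ?_ ?_).congr' ?_ EventuallyEq.rfl
  · have := fun k : ℤ => continuousAt_zpow₀ w k (Or.inl hw)
    exact ((continuousAt_const.mul (this _)).add (continuousAt_const.mul (this _))).add
      (continuousAt_const.mul (this _))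
  · simp_rw [pow_one]
    refine h1.congr_left fun w => ?_
    rw [zpow_neg_one, zpow_zero, zpow_neg, one_div (4 * w ^ 2), mul_inv, div_eq_mul_inv _ w]
    norm_cast
    ring
  · refine (((((h1.congr_right fun w => (pow_one w).symm).trans (pow_isBigO_inv_pow 1 2)).add
      ((isBigO_refl (fun w : ℂ => (w⁻¹) ^ 2) _).const_mul_left (1 / 4))).add
      ((inv_pow_isBigO_inv_pow one_le_two).const_mul_left
        ((-t / 2 + delta t / 4) + 1 / 2 : ℂ))).add
      ((pow_isBigO_inv_pow 0 2).const_mul_left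
        ((-t / 2 + delta t / 4) ^ 2 + t ^ 2 / 6 - delta t / 8 : ℂ))).congr_left fun w => ?_
    rw [one_div (4 * w ^ 2), mul_inv, div_eq_mul_inv _ w]
    ring
  · filter_upwards [self_mem_nhdsWithin] with z hz
    rw [integral_kern_mul_three _ _ _ _ _ _ _ (ne_of_gt hz), zpow_neg_one, zpow_zero, zpow_neg,
      inv_pow]
    norm_cast
    ring

theorem tendsto_div_of_isBigO {f : ℝ → ℂ} {n : ℕ} (h : f =O[nhdsWithin 0 (Set.Ioi 0)]
      fun z => (z : ℂ) ^ (n + 1) * kint 0 (π ^ 2 / 24 / z)) :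
    Tendsto (fun z => f z / ((z : ℂ) ^ n * kint 0 (π ^ 2 / 24 / z))) (nhdsWithin 0 (Set.Ioi 0))
      (nhds 0) := by
  have hz : Tendsto (fun z : ℝ => (z : ℂ)) (nhdsWithin 0 (Set.Ioi 0)) (nhds 0) := by
    have := (Complex.continuous_ofReal.tendsto 0).mono_left
      (nhdsWithin_le_nhds (s := Set.Ioi (0 : ℝ)))
    simpa using this
  have h1 := h.mul (isBigO_refl (fun z : ℝ => ((z : ℂ) ^ n * kint 0 (π ^ 2 / 24 / z))⁻¹)
    (nhdsWithin 0 (Set.Ioi 0)))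
  refine IsBigO.trans_tendsto (h1.congr' ?_ ?_) hz
  · exact Eventually.of_forall fun z => (div_eq_mul_inv _ _).symm
  · filter_upwards [self_mem_nhdsWithin,
      tendsto_saddleConst_div.eventually eventually_kint_zero_ne] with z hz hk
    have : (z : ℂ) ≠ 0 := by exact_mod_cast (ne_of_gt hz)
    generalize kint 0 (π ^ 2 / 24 / z) = K at hk ⊢
    rw [pow_succ]
    field_simp

theorem kint_isBigO_saddle {k : ℤ} {p : ℂ → ℂ} {n : ℕ}
    (h : (fun Y : ℝ => kint k Y - p (Y : ℂ)⁻¹ * kint 0 Y) =O[atTop]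
      fun Y => ((Y : ℂ)⁻¹) ^ n * kint 0 Y) :
    (fun z : ℝ => kint k (π ^ 2 / 24 / z) - p (24 / π ^ 2 * z) * kint 0 (π ^ 2 / 24 / z))
      =O[nhdsWithin 0 (Set.Ioi 0)] fun z => (z : ℂ) ^ n * kint 0 (π ^ 2 / 24 / z) := by
  have hY : ∀ z : ℝ, (((π ^ 2 / 24 / z : ℝ) : ℂ))⁻¹ = 24 / π ^ 2 * z := fun z => by
    push_cast
    rw [inv_div, div_div_eq_mul_div, mul_comm, mul_div_right_comm]
  have h1 := h.comp_tendsto tendsto_saddleConst_div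
  simp only [Function.comp_def, hY] at h1
  refine h1.trans (((isBigO_refl (fun z : ℝ => (z : ℂ) ^ n * kint 0 (π ^ 2 / 24 / z))
    (nhdsWithin 0 (Set.Ioi 0))).const_mul_left ((24 / π ^ 2) ^ n : ℂ)).congr_left fun z => ?_)
  ring

end

section

variable {t : ℕ}

theorem second_sub_sq_first {K z f₀ f₁ f₂ a b d h : ℂ} (hK : K ≠ 0) (hz : z ≠ 0)
    (h0 : 1 + z ^ 2 * f₀ ≠ 0) :
    K * (1 / 4 * z⁻¹ ^ 2 + h * z⁻¹ + d + f₂) / (K * (1 + z ^ 2 * f₀))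
      - (K * (1 / 2 * z⁻¹ + a + b * z + z * f₁) / (K * (1 + z ^ 2 * f₀))) ^ 2
      - ((h - a) * z⁻¹ + (d - a ^ 2 - b))
    = (f₂ + f₀ * (1 / 4 + h * z + d * z ^ 2 + f₂ * z ^ 2) - 2 * a * b * z - b ^ 2 * z ^ 2
      - f₁ * (1 + 2 * a * z + 2 * b * z ^ 2) - z ^ 2 * f₁ ^ 2
      - ((h - a) * z + (d - a ^ 2 - b) * z ^ 2) * (2 * f₀ + z ^ 2 * f₀ ^ 2))
      / (1 + z ^ 2 * f₀) ^ 2 := by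
  rw [mul_div_mul_left _ _ hK, mul_div_mul_left _ _ hK]
  field_simp
  ring

theorem saddle_variance_tendsto (ht : 1 ≤ t) :
    Tendsto (fun z : ℝ => normSaddle t 2 z / normSaddle t 0 z
        - (normSaddle t 1 z / normSaddle t 0 z) ^ 2
        - ((1 / 2 - 24 / π ^ 2 / 8) * (z : ℂ)⁻¹
          + (24 / π ^ 2 / 8 - (24 / π ^ 2) ^ 2 / 16 - delta t / 8)))
      (nhdsWithin 0 (Set.Ioi 0)) (nhds 0) := by
  set F := nhdsWithin (0 : ℝ) (Set.Ioi 0) with hF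
  set c : ℂ := 24 / π ^ 2 with hc
  set a₀ : ℂ := -t / 2 + delta t / 4 with ha₀
  have hz : Tendsto (fun z : ℝ => (z : ℂ)) F (nhds 0) := by
    have := (Complex.continuous_ofReal.tendsto 0).mono_left
      (nhdsWithin_le_nhds (s := Set.Ioi (0 : ℝ)))
    simpa using this
  have l0 := tendsto_div_of_isBigO (normSaddle_zero_isBigO ht)
  have l1 := tendsto_div_of_isBigO (normSaddle_one_isBigO ht)
  have l2 := tendsto_div_of_isBigO (normSaddle_two_isBigO ht)
  have km1 := tendsto_div_of_isBigO (kint_isBigO_saddle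
    (p := fun v => 1 + 1 / 4 * v + 3 / 32 * v ^ 2) kint_neg_one_isBigO)
  have km2 := tendsto_div_of_isBigO (kint_isBigO_saddle (p := fun _ => 1)
    (by simpa only [one_mul] using kint_neg_two_isBigO))
  have kp1 := tendsto_div_of_isBigO (n := 2) (kint_isBigO_saddle
    (p := fun v => 1 - 3 / 4 * v + 3 / 32 * v ^ 2) kint_one_isBigO)
  simp only [← hc, ← ha₀, ← hF] at l0 l1 l2 km1 km2 kp1
  set L0 := fun z : ℝ => (normSaddle t 0 z - kint 0 (π ^ 2 / 24 / z)) /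
    ((z : ℂ) ^ 2 * kint 0 (π ^ 2 / 24 / z)) with hL0
  set L1 := fun z : ℝ => (normSaddle t 1 z - (1 / 2 * (z : ℂ)⁻¹ * kint (-1) (π ^ 2 / 24 / z)
      + a₀ * kint 0 (π ^ 2 / 24 / z) + t ^ 2 / 6 * z * kint 1 (π ^ 2 / 24 / z))) /
    ((z : ℂ) ^ 1 * kint 0 (π ^ 2 / 24 / z)) with hL1
  set L2 := fun z : ℝ => (normSaddle t 2 z - (1 / 4 * (z : ℂ)⁻¹ ^ 2 * kint (-2) (π ^ 2 / 24 / z)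
      + (a₀ + 1 / 2) * (z : ℂ)⁻¹ * kint (-1) (π ^ 2 / 24 / z)
      + (a₀ ^ 2 + t ^ 2 / 6 - delta t / 8) * kint 0 (π ^ 2 / 24 / z))) /
    ((z : ℂ) ^ 0 * kint 0 (π ^ 2 / 24 / z)) with hL2
  set M1 := fun z : ℝ => (kint (-1) (π ^ 2 / 24 / z) - (1 + 1 / 4 * (c * z) + 3 / 32 * (c * z) ^ 2)
    * kint 0 (π ^ 2 / 24 / z)) / ((z : ℂ) ^ 2 * kint 0 (π ^ 2 / 24 / z)) with hM1
  set M2 := fun z : ℝ => (kint (-2) (π ^ 2 / 24 / z) - 1 * kint 0 (π ^ 2 / 24 / z))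
    / ((z : ℂ) ^ 2 * kint 0 (π ^ 2 / 24 / z)) with hM2
  set P1 := fun z : ℝ => (kint 1 (π ^ 2 / 24 / z) - (1 - 3 / 4 * (c * z) + 3 / 32 * (c * z) ^ 2)
    * kint 0 (π ^ 2 / 24 / z)) / ((z : ℂ) ^ 2 * kint 0 (π ^ 2 / 24 / z)) with hP1
  set f₁ := fun z : ℝ => L1 z + 1 / 2 * M1 z
    + t ^ 2 / 6 * ((z : ℂ) ^ 2 * P1 z + (-3 / 4 * (c * z) + 3 / 32 * (c * z) ^ 2)) with hf₁
  set f₂ := fun z : ℝ => L2 z + 1 / 4 * M2 z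
    + (a₀ + 1 / 2) * ((z : ℂ) * M1 z + 3 / 32 * c ^ 2 * z) with hf₂
  have t1 : Tendsto f₁ F (nhds 0) := by
    have := (l1.add (km1.const_mul (1 / 2))).add ((((hz.pow 2).mul kp1).add
      (((hz.const_mul c).const_mul (-3 / 4)).add
        (((hz.const_mul c).pow 2).const_mul (3 / 32)))).const_mul (t ^ 2 / 6 : ℂ))
    simpa [hf₁] using this
  have t2 : Tendsto f₂ F (nhds 0) := by
    have := (l2.add (km2.const_mul (1 / 4))).add
      (((hz.mul km1).add (hz.const_mul (3 / 32 * c ^ 2))).const_mul (a₀ + 1 / 2))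
    simpa [hf₂] using this
  set a := c / 8 + a₀ with ha
  set b := 3 * c ^ 2 / 64 + t ^ 2 / 6 with hb
  set d := (a₀ + 1 / 2) * c / 4 + a₀ ^ 2 + t ^ 2 / 6 - delta t / 8 with hd
  set h := a₀ + 1 / 2 with hh
  have hden : Tendsto (fun z : ℝ => 1 + (z : ℂ) ^ 2 * L0 z) F (nhds 1) := by
    simpa using ((hz.pow 2).mul l0).const_add 1
  have hR : Tendsto (fun z : ℝ => (f₂ z + L0 z * (1 / 4 + h * z + d * z ^ 2 + f₂ z * z ^ 2)
      - 2 * a * b * z - b ^ 2 * z ^ 2 - f₁ z * (1 + 2 * a * z + 2 * b * z ^ 2) - z ^ 2 * f₁ z ^ 2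
      - ((h - a) * z + (d - a ^ 2 - b) * z ^ 2) * (2 * L0 z + z ^ 2 * L0 z ^ 2))
      / (1 + z ^ 2 * L0 z) ^ 2) F (nhds 0) := by
    have hcont : Continuous fun x : ℂ × ℂ × ℂ × ℂ => x.2.2.2 + x.2.1 * (1 / 4 + h * x.1
      + d * x.1 ^ 2 + x.2.2.2 * x.1 ^ 2) - 2 * a * b * x.1 - b ^ 2 * x.1 ^ 2
      - x.2.2.1 * (1 + 2 * a * x.1 + 2 * b * x.1 ^ 2) - x.1 ^ 2 * x.2.2.1 ^ 2
      - ((h - a) * x.1 + (d - a ^ 2 - b) * x.1 ^ 2) * (2 * x.2.1 + x.1 ^ 2 * x.2.1 ^ 2) := by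
      fun_prop
    have hnum := (hcont.tendsto (0, 0, 0, 0)).comp
      (hz.prodMk_nhds (l0.prodMk_nhds (t1.prodMk_nhds t2)))
    have := hnum.div (hden.pow 2) (by norm_num)
    simpa [Function.comp_def, Pi.div_def] using this
  refine hR.congr' ?_
  filter_upwards [self_mem_nhdsWithin, tendsto_saddleConst_div.eventually eventually_kint_zero_ne,
    hden.eventually_ne one_ne_zero] with z hz hk h0
  have hz0 : (z : ℂ) ≠ 0 := by exact_mod_cast (ne_of_gt hz)
  rw [← second_sub_sq_first hk hz0 h0]
  have e0 : kint 0 (π ^ 2 / 24 / z) * (1 + z ^ 2 * L0 z) = normSaddle t 0 z := by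
    simp only [hL0]
    generalize kint 0 (π ^ 2 / 24 / z) = K at *
    field_simp
    ring
  have e1 : kint 0 (π ^ 2 / 24 / z) * (1 / 2 * (z : ℂ)⁻¹ + a + b * z + z * f₁ z)
      = normSaddle t 1 z := by
    simp only [hf₁, hL1, hM1, hP1, ha, hb]
    generalize kint 0 (π ^ 2 / 24 / z) = K at *
    generalize kint (-1) (π ^ 2 / 24 / z) = K' at *
    generalize kint 1 (π ^ 2 / 24 / z) = K'' at *
    field_simp
    ring
  have e2 : kint 0 (π ^ 2 / 24 / z) * (1 / 4 * (z : ℂ)⁻¹ ^ 2 + h * (z : ℂ)⁻¹ + d + f₂ z)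
      = normSaddle t 2 z := by
    simp only [hf₂, hL2, hM1, hM2, hh, hd]
    generalize kint 0 (π ^ 2 / 24 / z) = K at *
    generalize kint (-1) (π ^ 2 / 24 / z) = K' at *
    generalize kint (-2) (π ^ 2 / 24 / z) = K'' at *
    field_simp
    ring
  rw [e0, e1, e2]
  congr 1
  simp only [hh, ha, hb, hd]
  ring

theorem eventually_normSaddle_zero_ne (ht : 1 ≤ t) :
    ∀ᶠ z : ℝ in nhdsWithin 0 (Set.Ioi 0), normSaddle t 0 z ≠ 0 := by
  have hz : Tendsto (fun z : ℝ => (z : ℂ)) (nhdsWithin 0 (Set.Ioi 0)) (nhds 0) := by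
    have := (Complex.continuous_ofReal.tendsto 0).mono_left
      (nhdsWithin_le_nhds (s := Set.Ioi (0 : ℝ)))
    simpa using this
  have l0 := (hz.pow 2).mul (tendsto_div_of_isBigO (normSaddle_zero_isBigO ht))
  rw [mul_zero] at l0
  filter_upwards [self_mem_nhdsWithin, tendsto_saddleConst_div.eventually eventually_kint_zero_ne,
    l0.eventually_ne (show (0 : ℂ) ≠ -1 by norm_num)] with z hz hk h0 hs
  have hz0 : (z : ℂ) ≠ 0 := by exact_mod_cast (ne_of_gt hz)
  apply h0
  rw [hs]
  generalize kint 0 (π ^ 2 / 24 / z) = K at *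
  field_simp
  ring

end

section

variable {t : ℕ}

theorem normSaddle_eq_sum_SC (ht : 1 ≤ t) {j : ℕ} (hj : j ≤ 2) {n : ℕ} {z : ℝ} (hz : 0 < z)
    (hn : π ^ 2 / 24 / z ^ 2 + 1 / 24 = n) :
    normSaddle t j z = cexp (-(2 * (π ^ 2 / 24 / z))) * (z : ℂ)⁻¹ *
      (2 * π * ∑ P ∈ SC n, (Nhook t P : ℂ) ^ j) := by
  have hn' : (π : ℂ) ^ 2 / 24 / z ^ 2 + 1 / 24 = n := by
    have := congrArg Complex.ofReal hn
    push_cast at this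
    exact this
  rw [normSaddle, ← integral_eq_sum_SC ht hj n hz, saddleInt]
  simp only [saddleFun, hn']
  rfl

theorem variance_identity {ι : Type*} (s : Finset ι) (f : ι → ℝ) (hs : (s.card : ℝ) ≠ 0) :
    (∑ i ∈ s, (f i - (∑ k ∈ s, f k) / s.card) ^ 2) / s.card
      = (∑ i ∈ s, f i ^ 2) / s.card - ((∑ i ∈ s, f i) / s.card) ^ 2 := by
  simp only [sub_sq, Finset.sum_add_distrib, Finset.sum_sub_distrib, ← Finset.sum_mul,
    ← Finset.mul_sum, Finset.sum_const, nsmul_eq_mul]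
  field_simp
  ring

theorem tendsto_sqrt_sub_one_sub_sqrt :
    Tendsto (fun x : ℝ => √(x - 1) - √x) atTop (nhds 0) := by
  have h0 : Tendsto (fun x : ℝ => -(√x)⁻¹) atTop (nhds 0) := by
    simpa using (tendsto_inv_atTop_zero.comp Real.tendsto_sqrt_atTop).neg
  refine tendsto_of_tendsto_of_tendsto_of_le_of_le' h0 tendsto_const_nhds ?_ ?_
  · filter_upwards [eventually_ge_atTop 1] with x hx
    have hs : 0 < √x := Real.sqrt_pos.2 (by linarith)
    have h2 : √x ^ 2 = x := Real.sq_sqrt (by linarith)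
    have hs1 : 1 ≤ √x := Real.one_le_sqrt.2 hx
    have hi : (√x)⁻¹ ≤ 1 := inv_le_one_of_one_le₀ hs1
    have : √x - (√x)⁻¹ ≤ √(x - 1) := by
      refine Real.le_sqrt_of_sq_le ?_
      have h3 : √x * (√x)⁻¹ = 1 := mul_inv_cancel₀ hs.ne'
      nlinarith [inv_pos.2 hs]
    linarith
  · exact Eventually.of_forall fun x => sub_nonpos.2 (Real.sqrt_le_sqrt (by linarith))

theorem tendsto_natCast_mul_const : Tendsto (fun n : ℕ => (24 : ℝ) * n) atTop atTop :=
  tendsto_natCast_atTop_atTop.const_mul_atTop (by norm_num)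

/-- The saddle point of the `n`-th coefficient integral. -/
noncomputable def saddlePt (n : ℕ) : ℝ := π / √(24 * n - 1)

theorem saddlePt_pos {n : ℕ} (hn : 1 ≤ n) : 0 < saddlePt n := by
  have : (1 : ℝ) ≤ n := by exact_mod_cast hn
  exact div_pos Real.pi_pos (Real.sqrt_pos.2 (by linarith))

theorem saddlePt_spec {n : ℕ} (hn : 1 ≤ n) : π ^ 2 / 24 / saddlePt n ^ 2 + 1 / 24 = n := by
  have : (1 : ℝ) ≤ n := by exact_mod_cast hn
  have h1 : (0 : ℝ) < 24 * n - 1 := by linarith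
  rw [saddlePt, div_pow, Real.sq_sqrt h1.le]
  have := Real.pi_ne_zero
  field_simp
  ring

theorem tendsto_saddlePt : Tendsto saddlePt atTop (nhdsWithin 0 (Set.Ioi 0)) := by
  refine tendsto_nhdsWithin_iff.2 ⟨?_, ?_⟩
  · exact tendsto_const_nhds.div_atTop
      (Real.tendsto_sqrt_atTop.comp (tendsto_atTop_add_const_right _ _ tendsto_natCast_mul_const))
  · filter_upwards [eventually_ge_atTop 1] with n hn using saddlePt_pos hn

theorem variance_sub_saddle_tendsto (ht : 1 ≤ t) :
    Tendsto (fun n : ℕ => (∑ P ∈ SC n, ((Nhook t P : ℝ)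
        - (∑ Q ∈ SC n, (Nhook t Q : ℝ)) / ((SC n).card : ℝ)) ^ 2) / ((SC n).card : ℝ)
        - ((1 / 2 - 24 / π ^ 2 / 8) * (saddlePt n)⁻¹
          + (24 / π ^ 2 / 8 - (24 / π ^ 2) ^ 2 / 16 - delta t / 8))) atTop (nhds 0) := by
  have h := (saddle_variance_tendsto ht).comp tendsto_saddlePt
  refine ((Complex.continuous_re.tendsto 0).comp h).congr' ?_
  filter_upwards [eventually_ge_atTop 1,
    tendsto_saddlePt.eventually (eventually_normSaddle_zero_ne ht)] with n hn hne
  have hE := fun {j : ℕ} (hj : j ≤ 2) =>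
    normSaddle_eq_sum_SC ht hj (saddlePt_pos hn) (saddlePt_spec hn)
  rw [hE zero_le_two] at hne
  obtain ⟨hne1, hne2⟩ := mul_ne_zero_iff.1 hne
  obtain ⟨hne3, hne4⟩ := mul_ne_zero_iff.1 hne2
  have hcard : ∑ P ∈ SC n, (Nhook t P : ℂ) ^ 0 = (SC n).card := by simp
  rw [hcard] at hne4
  have hs : ((SC n).card : ℝ) ≠ 0 := by exact_mod_cast hne4
  rw [variance_identity _ _ hs, Function.comp_apply, Function.comp_apply, hE zero_le_two,
    hE one_le_two, hE le_rfl, mul_div_mul_left _ _ hne1, mul_div_mul_left _ _ hne1,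
    mul_div_mul_left _ _ hne3, mul_div_mul_left _ _ hne3, hcard]
  simp only [pow_one]
  rw [← Complex.ofReal_re (_ - _)]
  congr 1
  push_cast
  rfl

end

/-- The variance of `N_t` over `SC(n)` satisfies
`lim_{n→∞} ( (1/sc(n)) Σ_{λ ∈ SC(n)} (N_t(λ) - m_n)² - (π²-6)√(6n)/π³ ) = 3(π²-12)/π⁴ - δ_t/8`,
where `m_n` is the mean of `N_t` over `SC(n)`. -/
theorem stmt16 (t : ℕ) (ht : 1 ≤ t) :
    Filter.Tendsto (fun n : ℕ =>
        (∑ P ∈ SC n,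
            ((Nhook t P : ℝ) - (∑ Q ∈ SC n, (Nhook t Q : ℝ)) / ((SC n).card : ℝ))^2)
          / ((SC n).card : ℝ)
        - (π^2 - 6) * Real.sqrt (6*n) / π^3)
      Filter.atTop (nhds (3*(π^2 - 12)/π^4 - delta t/8)) := by
  have h1 := variance_sub_saddle_tendsto ht
  have h2 := (tendsto_sqrt_sub_one_sub_sqrt.comp tendsto_natCast_mul_const).const_mul
    ((1 / 2 - 24 / π ^ 2 / 8) / π)
  have h3 := (h1.add h2).add_const (3 * (π ^ 2 - 12) / π ^ 4 - delta t / 8)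
  rw [mul_zero, add_zero, zero_add] at h3
  refine h3.congr fun n => ?_
  have h24 : √(24 * (n : ℝ)) = 2 * √(6 * n) := by
    rw [show (24 * (n : ℝ)) = 2 ^ 2 * (6 * n) by ring, Real.sqrt_mul (by positivity),
      Real.sqrt_sq (by norm_num)]
  rw [Function.comp_apply, h24, saddlePt, inv_div]
  have := Real.pi_ne_zero
  field_simp
  ring
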